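/- There exists a real number μ > 0 such that μ is not a natural number, μ is not of the form 2k + 3/2 with k a natural number, and there exists a nontrivial μ-homogeneous solution of the thin obstacle problem in ℝ³. (That is, the set of frequencies in dimension 3 is strictly larger than the explicit two-dimensional set ℕ ∪ {2k + 3/2 : k ∈ ℕ}.) -/

import Mathlib

open Real Set Filter

/-- Partial derivative of `f : ℝⁿ → ℝ` in the `i`-th coordinate direction. -/
noncomputable def pd {n : ℕ} (i : Fin n) (f : (Fin n → ℝ) → ℝ) (x : Fin n → ℝ) : ℝ :=
  fderiv ℝ f x (Pi.single i 1)

/-- The Laplacian of `f : ℝⁿ → ℝ`. -/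
noncomputable def lap {n : ℕ} (f : (Fin n → ℝ) → ℝ) (x : Fin n → ℝ) : ℝ :=
  ∑ i, pd i (pd i f) x

/-- The contact set `Z(u) = {xᵢ = 0} ∩ {u = 0}`, `i` being the distinguished coordinate. -/
def contactSet {n : ℕ} (u : (Fin n → ℝ) → ℝ) (i : Fin n) : Set (Fin n → ℝ) :=
  {x | x i = 0 ∧ u x = 0}

/-- `d` is the one-sided derivative `∂ᵢ⁺u(x) = lim_{t→0⁺} (u(x+t eᵢ) - u(x))/t`. -/
def HasUpperDeriv {n : ℕ} (u : (Fin n → ℝ) → ℝ) (i : Fin n) (x : Fin n → ℝ) (d : ℝ) : Prop :=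
  Filter.Tendsto (fun t : ℝ => (u (x + t • (Pi.single i 1 : Fin n → ℝ)) - u x) / t)
    (nhdsWithin 0 (Set.Ioi 0)) (nhds d)

/-- `u` is a `μ`-homogeneous solution of the thin obstacle problem in `ℝⁿ`,
with thin space `{xᵢ = 0}`. -/
structure IsTOPSol {n : ℕ} (μ : ℝ) (u : (Fin n → ℝ) → ℝ) (i : Fin n) : Prop where
  cont : Continuous u
  symm : ∀ x, u (Function.update x i (-(x i))) = u x
  homog : ∀ r : ℝ, 0 < r → ∀ x, u (r • x) = r ^ μ * u x
  smooth : ContDiffOn ℝ 2 u (contactSet u i)ᶜ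
  harm : ∀ x ∈ (contactSet u i)ᶜ, lap u x = 0
  nonneg : ∀ x, x i = 0 → 0 ≤ u x
  upper : ∀ x, x i = 0 → ∃ d, d ≤ 0 ∧ HasUpperDeriv u i x d


namespace TOP

/-- Coefficients of the hypergeometric kernel. -/
noncomputable def cc (μ : ℝ) : ℕ → ℝ
  | 0 => 1
  | n + 1 => cc μ n * ((n : ℝ) * (n + 1) - μ * (μ + 1)) / ((n : ℝ) + 1) ^ 2

noncomputable def bt (n m : ℕ) : ℝ := (Nat.choose (2 * n) (n + m) : ℝ) / 4 ^ n

noncomputable def ee (m : ℕ) (μ : ℝ) : ℝ := ∑' n, cc μ n * bt n m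

noncomputable def qq (μ : ℝ) (m : ℕ) : ℝ := (m : ℝ) * (m + 1) - μ * (μ + 1)

abbrev II : Set ℝ := Icc (19 / 2 : ℝ) (99 / 10)

lemma lam_bounds {μ : ℝ} (h : μ ∈ II) : 99 < μ * (μ + 1) ∧ μ * (μ + 1) < 108 := by
  obtain ⟨h1, h2⟩ := h
  constructor <;> nlinarith

lemma cc_succ (μ : ℝ) (n : ℕ) :
    cc μ (n + 1) = cc μ n * qq μ n / ((n : ℝ) + 1) ^ 2 := rfl

lemma qq_neg {μ : ℝ} (h : μ ∈ II) {n : ℕ} (hn : n ≤ 9) : qq μ n < 0 := by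
  have := (lam_bounds h).1
  have hn' : (n : ℝ) ≤ 9 := by exact_mod_cast hn
  have h0 : (0 : ℝ) ≤ n := Nat.cast_nonneg n
  unfold qq; nlinarith

lemma qq_pos {μ : ℝ} (h : μ ∈ II) {n : ℕ} (hn : 10 ≤ n) : 0 < qq μ n := by
  have := (lam_bounds h).2
  have hn' : (10 : ℝ) ≤ n := by exact_mod_cast hn
  unfold qq; nlinarith

lemma cc_sign {μ : ℝ} (h : μ ∈ II) : ∀ n : ℕ, n ≤ 10 → 0 < (-1 : ℝ) ^ n * cc μ n := by
  intro n
  induction n with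
  | zero => intro _; simp [cc]
  | succ n ih =>
    intro hn
    have h1 := ih (by omega)
    have h2 := qq_neg h (n := n) (by omega)
    rw [cc_succ, pow_succ]
    have : (-1 : ℝ) ^ n * -1 * (cc μ n * qq μ n / ((n : ℝ) + 1) ^ 2)
      = ((-1 : ℝ) ^ n * cc μ n) * (-qq μ n) / ((n : ℝ) + 1) ^ 2 := by ring
    rw [this]
    have : 0 < -qq μ n := by linarith
    positivity

lemma cc_pos {μ : ℝ} (h : μ ∈ II) {n : ℕ} (hn : 10 ≤ n) : 0 < cc μ n := by
  induction n, hn using Nat.le_induction with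
  | base => have := cc_sign h 10 le_rfl; norm_num at this; exact this
  | succ n hn ih =>
    rw [cc_succ]
    have := qq_pos h hn
    positivity

lemma cc_mul_anti {μ : ℝ} {n : ℕ} (hn : 10 ≤ n) :
    ((n + 1 : ℕ) : ℝ) * cc μ (n + 1) = n * cc μ n * (1 - μ * (μ + 1) / (n * (n + 1))) := by
  have hn' : (10 : ℝ) ≤ n := by exact_mod_cast hn
  rw [cc_succ]; unfold qq; push_cast; field_simp

noncomputable def Bc : ℝ := 11 * 110 ^ 10

lemma Bc_pos : 0 < Bc := by unfold Bc; positivity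

lemma cc_small {μ : ℝ} (h : μ ∈ II) : ∀ n : ℕ, n ≤ 10 → |cc μ n| ≤ 110 ^ n := by
  intro n
  induction n with
  | zero => intro _; simp [cc]
  | succ n ih =>
    intro hn
    have h1 := ih (by omega)
    have h2 := qq_neg h (n := n) (by omega)
    have h3 := (lam_bounds h).2
    rw [cc_succ, abs_div, abs_mul, abs_of_neg h2]
    have h4 : -qq μ n ≤ 110 := by
      unfold qq; have : (0 : ℝ) ≤ n := Nat.cast_nonneg n
      nlinarith
    rw [abs_of_pos (by positivity : (0 : ℝ) < ((n : ℝ) + 1) ^ 2)]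
    have h0 : (0 : ℝ) ≤ n := Nat.cast_nonneg n
    rw [div_le_iff₀ (by positivity), pow_succ]
    have h5 : |cc μ n| * -qq μ n ≤ 110 ^ n * 110 :=
      mul_le_mul h1 h4 (by linarith) (by positivity)
    have h6 : (1 : ℝ) ≤ ((n : ℝ) + 1) ^ 2 := by nlinarith
    have h7 : (0 : ℝ) ≤ 110 ^ n * 110 := by positivity
    nlinarith

lemma ncc_le {μ : ℝ} (h : μ ∈ II) {n : ℕ} (hn : 10 ≤ n) :
    (n : ℝ) * cc μ n ≤ 10 * 110 ^ 10 := by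
  induction n, hn using Nat.le_induction with
  | base =>
    have := cc_small h 10 le_rfl
    have := le_abs_self (cc μ 10)
    push_cast; linarith
  | succ n hn ih =>
    rw [cc_mul_anti hn]
    have hc := cc_pos h hn
    have h3 := (lam_bounds h).1
    have : (0 : ℝ) ≤ μ * (μ + 1) / (n * (n + 1)) := by positivity
    have h4 : (0 : ℝ) ≤ n * cc μ n := by positivity
    nlinarith

lemma cc_bound {μ : ℝ} (h : μ ∈ II) (n : ℕ) : |cc μ n| ≤ Bc / ((n : ℝ) + 1) := by
  rw [le_div_iff₀ (by positivity)]
  rcases le_or_gt 10 n with hn | hn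
  · have h1 := ncc_le h hn
    have hc := cc_pos h hn
    rw [abs_of_pos hc]
    have hn' : (10 : ℝ) ≤ n := by exact_mod_cast hn
    unfold Bc; nlinarith
  · have h1 := cc_small h n hn.le
    have h2 : (110 : ℝ) ^ n ≤ 110 ^ 10 := pow_le_pow_right₀ (by norm_num) hn.le
    have hn' : (n : ℝ) + 1 ≤ 11 := by have : (n : ℝ) ≤ 10 := by exact_mod_cast hn.le
                                      linarith
    unfold Bc
    have := mul_le_mul (h1.trans h2) hn' (by positivity) (by positivity)
    linarith

/-! ### binomial weights -/

lemma bt_nonneg (n m : ℕ) : 0 ≤ bt n m := by unfold bt; positivity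

lemma bt_succ_rel (n m : ℕ) : ((n : ℝ) + m + 1) * bt n (m + 1) = ((n : ℝ) - m) * bt n m := by
  unfold bt
  rcases le_or_gt m n with h | h
  · have := Nat.choose_succ_right_eq (2 * n) (n + m)
    have h2 : 2 * n - (n + m) = n - m := by omega
    rw [h2] at this
    have h3 : ((Nat.choose (2 * n) (n + m + 1) : ℕ) : ℝ) * ((n : ℝ) + m + 1)
        = (Nat.choose (2 * n) (n + m) : ℝ) * ((n : ℝ) - m) := by
      have := congrArg (Nat.cast (R := ℝ)) this
      push_cast [Nat.cast_sub h] at this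
      linarith
    rw [← add_assoc]
    linear_combination h3 / 4 ^ n
  · rw [Nat.choose_eq_zero_of_lt (by omega : 2 * n < n + (m + 1)),
      Nat.choose_eq_zero_of_lt (by omega : 2 * n < n + m)]; simp

lemma bt_zero_of_lt {n m : ℕ} (h : n < m) : bt n m = 0 := by
  unfold bt; rw [Nat.choose_eq_zero_of_lt (by omega)]; simp

lemma bt_rec (n m : ℕ) : bt (n + 1) (m + 1) = bt n (m + 1) / 2 + (bt n m + bt n (m + 2)) / 4 := by
  unfold bt
  have e1 : 2 * (n + 1) = (2 * n + 1) + 1 := by ring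
  have e2 : n + 1 + (m + 1) = (n + m + 1) + 1 := by ring
  rw [e1, e2, Nat.choose_succ_succ, Nat.choose_succ_succ (2 * n) (n + m),
    Nat.choose_succ_succ (2 * n) (n + m + 1)]
  push_cast
  simp only [← add_assoc]
  rw [pow_succ]
  ring

lemma bt_rec0 (n : ℕ) : bt (n + 1) 0 = bt n 0 / 2 + bt n 1 / 2 := by
  have h1 := bt_rec n 0
  have r1 := bt_succ_rel (n + 1) 0
  have r2 := bt_succ_rel n 0
  have r3 := bt_succ_rel n 1
  push_cast at *
  simp only [add_zero, sub_zero] at *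
  have hn : (0 : ℝ) ≤ n := Nat.cast_nonneg n
  rw [h1] at r1
  have hn1 : ((n : ℝ) + 1) ≠ 0 := by positivity
  have hn2 : ((n : ℝ) + 2) ≠ 0 := by positivity
  have b1 : bt n 1 = n * bt n 0 / (n + 1) := by field_simp; linarith
  have b2 : bt n 2 = (n - 1) * bt n 1 / (n + 2) := by field_simp; linarith
  have : bt (n + 1) 0 = (n + 1 + 1) * (bt n 1 / 2 + (bt n 0 + bt n 2) / 4) / (n + 1) := by
    field_simp; field_simp at r1; linarith
  rw [this, b2, b1]; field_simp; ring

lemma bt_pred_rel (n m : ℕ) : (((n : ℝ) + 1) ^ 2 - m ^ 2) * bt (n + 1) m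
    = (n + 1) * (2 * n + 1) / 2 * bt n m := by
  have hn : (0 : ℝ) ≤ n := Nat.cast_nonneg n
  rcases m with _ | m
  · rw [bt_rec0]
    have r2 := bt_succ_rel n 0
    push_cast at *
    simp only [add_zero, sub_zero] at *
    linear_combination (n+1) / 2 * r2
  · rw [bt_rec]
    have r2 := bt_succ_rel n m
    have r3 := bt_succ_rel n (m + 1)
    push_cast at *
    have hm : (0 : ℝ) ≤ m := Nat.cast_nonneg m
    have b2 : bt n (m + 2) = (n - (m + 1)) * bt n (m + 1) / (n + (m + 1) + 1) := by
      field_simp; linarith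
    rw [b2]; field_simp
    linear_combination (-2 * (n + m + 2) * (n + m + 2) : ℝ) * r2

lemma bt_anti (n m : ℕ) : bt n (m + 1) ≤ bt n m := by
  have h := bt_succ_rel n m
  have h0 := bt_nonneg n m
  have hn : (0 : ℝ) ≤ n := Nat.cast_nonneg n
  have hm : (0 : ℝ) ≤ m := Nat.cast_nonneg m
  by_contra hc
  push Not at hc
  have : ((n : ℝ) + m + 1) * bt n m < ((n : ℝ) + m + 1) * bt n (m + 1) :=
    mul_lt_mul_of_pos_left hc (by positivity)
  nlinarith

lemma bt_diff (n m : ℕ) : |bt n m - bt n (m + 1)| ≤ (2 * m + 1) * bt n m / (n + 1) := by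
  have h := bt_succ_rel n m
  have h0 := bt_nonneg n m
  have h1 := bt_anti n m
  have hn : (0 : ℝ) ≤ n := Nat.cast_nonneg n
  have hm : (0 : ℝ) ≤ m := Nat.cast_nonneg m
  rw [abs_of_nonneg (by linarith), le_div_iff₀ (by positivity)]
  nlinarith

lemma bt_le0 (n m : ℕ) : bt n m ≤ bt n 0 := by
  induction m with
  | zero => exact le_rfl
  | succ m ih => exact (bt_anti n m).trans ih

lemma bt0_sq (n : ℕ) : bt n 0 ^ 2 * (2 * n + 1) ≤ 1 := by
  induction n with
  | zero => simp [bt]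
  | succ n ih =>
    have r2 := bt_succ_rel n 0
    have r1 := bt_rec0 n
    push_cast at *
    simp only [add_zero, sub_zero] at *
    have hn : (0 : ℝ) ≤ n := Nat.cast_nonneg n
    have b1 : bt n 1 = n * bt n 0 / (n + 1) := by field_simp; linarith
    have : bt (n + 1) 0 = bt n 0 * ((2 * n + 1) / (2 * n + 2)) := by
      rw [r1, b1]; field_simp; ring
    rw [this]
    have h2 : ((2 * (n : ℝ) + 1) / (2 * n + 2)) ^ 2 * (2 * (n + 1) + 1) ≤ 2 * n + 1 := by
      rw [div_pow, div_mul_eq_mul_div, div_le_iff₀ (by positivity)]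
      nlinarith [mul_nonneg hn hn]
    calc _ = bt n 0 ^ 2 * (((2 * (n : ℝ) + 1) / (2 * n + 2)) ^ 2 * (2 * (n + 1) + 1)) := by ring
      _ ≤ bt n 0 ^ 2 * (2 * n + 1) := by gcongr
      _ ≤ 1 := ih

lemma bt_le (n m : ℕ) : bt n m ≤ ((n : ℝ) + 1) ^ (-(1 / 2) : ℝ) := by
  refine (bt_le0 n m).trans ?_
  have h := bt0_sq n
  have hn : (0 : ℝ) ≤ n := Nat.cast_nonneg n
  have h1 : bt n 0 ^ 2 * (n + 1) ≤ 1 := by nlinarith [sq_nonneg (bt n 0)]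
  rw [Real.rpow_neg (by positivity), ← Real.sqrt_eq_rpow]
  rw [← one_div, le_div_iff₀ (by positivity)]
  have : (bt n 0 * √((n : ℝ) + 1)) ^ 2 ≤ 1 := by
    rw [mul_pow, Real.sq_sqrt (by positivity)]; exact h1
  nlinarith [mul_nonneg (bt_nonneg n 0) (Real.sqrt_nonneg ((n : ℝ) + 1))]

lemma summable_rp {s : ℝ} (hs : s < -1) : Summable (fun n : ℕ => ((n : ℝ) + 1) ^ s) := by
  have := (summable_nat_add_iff 1).2 (Real.summable_nat_rpow.2 hs)
  simpa using this

lemma cb_bound {μ : ℝ} (h : μ ∈ II) (n m : ℕ) :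
    ‖cc μ n * bt n m‖ ≤ Bc * ((n : ℝ) + 1) ^ (-(3 / 2) : ℝ) := by
  rw [norm_mul, Real.norm_eq_abs, Real.norm_eq_abs, abs_of_nonneg (bt_nonneg n m)]
  have h1 := cc_bound h n
  have h2 := bt_le n m
  have h3 : Bc * ((n : ℝ) + 1) ^ (-(3 / 2) : ℝ) = Bc / ((n : ℝ) + 1) * ((n : ℝ) + 1) ^ (-(1 / 2) : ℝ) := by
    have e : (-(3 / 2) : ℝ) = -1 + -(1 / 2) := by norm_num
    rw [e, Real.rpow_add (by positivity), Real.rpow_neg_one]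
    ring
  rw [h3]
  exact mul_le_mul h1 h2 (bt_nonneg _ _) (div_nonneg Bc_pos.le (by positivity))

lemma cb_summable {μ : ℝ} (h : μ ∈ II) (m : ℕ) : Summable (fun n => cc μ n * bt n m) :=
  Summable.of_norm_bounded ((summable_rp (by norm_num)).mul_left Bc) (fun n => cb_bound h n m)

lemma cc_cont (n : ℕ) : Continuous (fun μ => cc μ n) := by
  induction n with
  | zero => simp only [cc]; fun_prop
  | succ n ih => simp only [cc]; fun_prop

lemma ee_cont (m : ℕ) : ContinuousOn (ee m) II := by
  unfold ee
  exact continuousOn_tsum (fun n => ((cc_cont n).mul continuous_const).continuousOn)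
    ((summable_rp (by norm_num : (-(3 / 2) : ℝ) < -1)).mul_left Bc) (fun n x hx => cb_bound hx n m)

/-- telescoping term -/
noncomputable def TT (μ : ℝ) (m : ℕ) : ℕ → ℝ
  | 0 => 0
  | n + 1 => cc μ (n + 1) * ((n : ℝ) + 1) ^ 2 * (bt n (m + 2) - bt n m)

lemma TT_step (μ : ℝ) (m n : ℕ) :
    cc μ n * bt n (m + 2) * qq μ (m + 1) - cc μ n * bt n m * qq μ m = TT μ m (n + 1) - TT μ m n := by
  have key : ∀ n : ℕ, TT μ m (n + 1) = cc μ n * qq μ n * (bt n (m + 2) - bt n m) := by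
    intro n
    simp only [TT]; rw [cc_succ]
    have : ((n : ℝ) + 1) ≠ 0 := by positivity
    field_simp
  rw [key]
  rcases n with _ | n
  · have : bt 0 (m + 2) = 0 := bt_zero_of_lt (by omega)
    rw [this]
    rcases m with _ | m
    · simp [TT, qq]; ring
    · rw [bt_zero_of_lt (by omega : 0 < m + 1)]; simp [TT]
  · simp only [TT]
    have r1 := bt_succ_rel (n + 1) m
    have r2 := bt_succ_rel (n + 1) (m + 1)
    have p1 := bt_pred_rel n m
    have p2 := bt_pred_rel n (m + 2)
    have hn : (0 : ℝ) ≤ n := Nat.cast_nonneg n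
    have hm : (0 : ℝ) ≤ m := Nat.cast_nonneg m
    push_cast at *
    unfold qq
    push_cast
    have b0 : bt n m = 2 * (((n : ℝ) + 1) ^ 2 - m ^ 2) * bt (n + 1) m / ((n + 1) * (2 * n + 1)) := by
      field_simp; linarith
    have b2 : bt n (m + 2) = 2 * (((n : ℝ) + 1) ^ 2 - (m + 2) ^ 2) * bt (n + 1) (m + 2) / ((n + 1) * (2 * n + 1)) := by
      field_simp; linarith
    rw [b0, b2]
    have r3 : ((n : ℝ) + 1 + m + 1) * (n + 1 + (m + 1) + 1) * bt (n + 1) (m + 2)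
       = (n + 1 - (m + 1)) * (n + 1 - m) * bt (n + 1) m := by
      have e : m + 1 + 1 = m + 2 := rfl
      rw [e] at r2
      linear_combination ((n : ℝ) + 1 + m + 1) * r2 + (n + 1 - (m + 1)) * r1
    field_simp
    linear_combination (-cc μ (n + 1)) * r3

lemma TT_lim {μ : ℝ} (h : μ ∈ II) (m : ℕ) : Tendsto (TT μ m) atTop (nhds 0) := by
  rw [← tendsto_add_atTop_iff_nat 1]
  apply squeeze_zero_norm (a := fun n : ℕ => Bc * (4 * m + 4) * ((n : ℝ) + 1) ^ (-(1 / 2) : ℝ))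
  · intro n
    simp only [TT]
    have hn : (0 : ℝ) ≤ n := Nat.cast_nonneg n
    have hm : (0 : ℝ) ≤ m := Nat.cast_nonneg m
    have h1 := cc_bound h (n + 1)
    have h2 := bt_diff n m
    have h3 := bt_diff n (m + 1)
    have h4 := bt_le n 0
    have h5 : bt n m ≤ _ := bt_le n m
    have h6 : bt n (m + 1) ≤ _ := bt_le n (m + 1)
    set X := ((n : ℝ) + 1) ^ (-(1 / 2) : ℝ) with hX
    have h7 : |bt n (m + 2) - bt n m| ≤ (4 * m + 4) * X / (n + 1) := by
      have : bt n (m + 2) - bt n m = -((bt n m - bt n (m + 1)) + (bt n (m + 1) - bt n (m + 1 + 1))) := by ring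
      rw [this, abs_neg]
      refine (abs_add_le _ _).trans ?_
      have e1 : (2 * (m : ℝ) + 1) * bt n m / (n + 1) ≤ (2 * m + 1) * X / (n + 1) := by gcongr
      have e2 : (2 * ((m + 1 : ℕ) : ℝ) + 1) * bt n (m + 1) / (n + 1) ≤ (2 * ((m + 1 : ℕ) : ℝ) + 1) * X / (n + 1) := by gcongr
      have e3 : (4 * (m : ℝ) + 4) * X / (n + 1) = (2 * m + 1) * X / (n + 1) + (2 * ((m + 1 : ℕ) : ℝ) + 1) * X / (n + 1) := by
        push_cast; ring
      rw [e3]; linarith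
    rw [norm_mul, norm_mul, Real.norm_eq_abs, Real.norm_eq_abs, Real.norm_eq_abs,
      abs_of_pos (by positivity : (0 : ℝ) < ((n : ℝ) + 1) ^ 2)]
    have hX0 : 0 ≤ X := by positivity
    have hB := Bc_pos
    calc |cc μ (n + 1)| * ((n : ℝ) + 1) ^ 2 * |bt n (m + 2) - bt n m|
        ≤ (Bc / ((n + 1 : ℕ) + 1)) * ((n : ℝ) + 1) ^ 2 * ((4 * m + 4) * X / (n + 1)) := by gcongr
      _ = Bc * (4 * m + 4) * X * ((n + 1) / (n + 2)) := by push_cast; field_simp; ring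
      _ ≤ Bc * (4 * m + 4) * X * 1 := by
          gcongr
          rw [div_le_one (by positivity)]; linarith
      _ = _ := by ring
  · have : Tendsto (fun n : ℕ => ((n : ℝ) + 1) ^ (-(1 / 2) : ℝ)) atTop (nhds 0) :=
      (tendsto_rpow_neg_atTop (by norm_num)).comp
        (tendsto_atTop_add_const_right _ _ tendsto_natCast_atTop_atTop)
    simpa using this.const_mul (Bc * (4 * m + 4))

lemma ee_rec {μ : ℝ} (h : μ ∈ II) (m : ℕ) : ee (m + 2) μ * qq μ (m + 1) = ee m μ * qq μ m := by
  have h1 := (cb_summable h (m + 2)).hasSum.mul_right (qq μ (m + 1))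
  have h2 := (cb_summable h m).hasSum.mul_right (qq μ m)
  have h3 := (h1.sub h2).tendsto_sum_nat
  have h4 : (fun N => ∑ n ∈ Finset.range N, (cc μ n * bt n (m + 2) * qq μ (m + 1) - cc μ n * bt n m * qq μ m))
     = TT μ m := by
    funext N
    simp_rw [TT_step]
    rw [Finset.sum_range_sub]; simp [TT]
  rw [h4] at h3
  have := tendsto_nhds_unique h3 (TT_lim h m)
  unfold ee; linarith

lemma ee_pos {μ : ℝ} (h : μ ∈ II) {m : ℕ} (hm : 10 ≤ m) : 0 < ee m μ := by
  unfold ee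
  have h0 : ∀ n, 0 ≤ cc μ n * bt n m := by
    intro n
    rcases le_or_gt m n with hn | hn
    · exact mul_nonneg (cc_pos h (hm.trans hn)).le (bt_nonneg _ _)
    · rw [bt_zero_of_lt hn]; simp
  refine (cb_summable h m).tsum_pos h0 m (mul_pos (cc_pos h hm) ?_)
  unfold bt
  have : 0 < Nat.choose (2 * m) (m + m) := Nat.choose_pos (by omega)
  positivity

lemma ee_anti {μ : ℝ} (h : μ ∈ II) {m : ℕ} (hm : 10 ≤ m) : ee (m + 1) μ ≤ ee m μ := by
  unfold ee
  refine (cb_summable h (m + 1)).tsum_le_tsum (fun n => ?_) (cb_summable h m)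
  rcases le_or_gt m n with hn | hn
  · exact mul_le_mul_of_nonneg_left (bt_anti n m) (cc_pos h (hm.trans hn)).le
  · rw [bt_zero_of_lt hn, bt_zero_of_lt (by omega : n < m + 1)]

end TOP

namespace TOP

noncomputable def kap (μ : ℝ) : ℝ := ee 10 μ * ee 11 μ * qq μ 10

lemma kap_eq {μ : ℝ} (h : μ ∈ II) {m : ℕ} (hm : 10 ≤ m) :
    ee m μ * ee (m + 1) μ * qq μ m = kap μ := by
  induction m, hm using Nat.le_induction with
  | base => rfl
  | succ n hn ih =>
    rw [← ih]
    have := ee_rec h n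
    linear_combination ee (n + 1) μ * this

lemma kap_pos {μ : ℝ} (h : μ ∈ II) : 0 < kap μ :=
  mul_pos (mul_pos (ee_pos h le_rfl) (ee_pos h (by norm_num))) (qq_pos h le_rfl)

lemma kap_le {μ : ℝ} (h : μ ∈ II) {m : ℕ} (hm : 10 ≤ m) : kap μ ≤ ee m μ ^ 2 * qq μ m := by
  rw [← kap_eq h hm, sq]
  have := ee_anti h hm
  have := ee_pos h hm
  have := qq_pos h hm
  gcongr

lemma le_kap {μ : ℝ} (h : μ ∈ II) {m : ℕ} (hm : 10 ≤ m) :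
    ee (m + 1) μ ^ 2 * qq μ m ≤ kap μ := by
  rw [← kap_eq h hm, sq]
  have := ee_anti h hm
  have := ee_pos h (by omega : 10 ≤ m + 1)
  have := qq_pos h hm
  gcongr

lemma ee_low {μ : ℝ} (h : μ ∈ II) (m : ℕ) (hm : m ≤ 8) :
    ee m μ = ee (m + 2) μ * (qq μ (m + 1) / qq μ m) := by
  have h1 := ee_rec h m
  have h2 := (qq_neg h (n := m) (by omega)).ne
  field_simp; linarith

lemma e0_eq {μ : ℝ} (h : μ ∈ II) : ee 0 μ = ee 10 μ * ((qq μ 9 / qq μ 8) * (qq μ 7 / qq μ 6) *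
    (qq μ 5 / qq μ 4) * (qq μ 3 / qq μ 2) * (qq μ 1 / qq μ 0)) := by
  rw [ee_low h 0 (by norm_num), ee_low h 2 (by norm_num), ee_low h 4 (by norm_num),
    ee_low h 6 (by norm_num), ee_low h 8 (by norm_num)]
  norm_num
  ring

lemma e0_pos {μ : ℝ} (h : μ ∈ II) : 0 < ee 0 μ := by
  rw [e0_eq h]
  have : ∀ n ≤ 8, 0 < qq μ (n + 1) / qq μ n := fun n hn =>
    div_pos_of_neg_of_neg (qq_neg h (by omega)) (qq_neg h (by omega))
  have h0 := this 0 (by norm_num)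
  have h2 := this 2 (by norm_num)
  have h4 := this 4 (by norm_num)
  have h6 := this 6 (by norm_num)
  have h8 := this 8 (by norm_num)
  have := ee_pos h (m := 10) le_rfl
  norm_num at *
  positivity

lemma e9_eq {μ : ℝ} (h : μ ∈ II) : ee 9 μ = ee 11 μ * (qq μ 10 / qq μ 9) := by
  have h1 := ee_rec h 9
  have h2 := (qq_neg h (n := 9) (by omega)).ne
  field_simp; linarith

lemma e9_neg {μ : ℝ} (h : μ ∈ II) : ee 9 μ < 0 := by
  rw [e9_eq h]
  exact mul_neg_of_pos_of_neg (ee_pos h (by norm_num))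
    (div_neg_of_pos_of_neg (qq_pos h le_rfl) (qq_neg h le_rfl))

lemma e_right : - ee 9 (99 / 10) < ee 0 (99 / 10) / 2 := by
  have h : (99 / 10 : ℝ) ∈ II := by constructor <;> norm_num
  rw [e9_eq h, e0_eq h]
  have h1 := ee_anti h (m := 10) le_rfl
  have h2 := ee_pos h (m := 11) (by norm_num)
  norm_num [qq] at h1 ⊢
  linarith

lemma e_left : 2 * ee 0 (19 / 2) < - ee 9 (19 / 2) := by
  have h : (19 / 2 : ℝ) ∈ II := by constructor <;> norm_num
  rw [e9_eq h, e0_eq h]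
  have r10 := ee_rec h 10
  have r11 := ee_rec h 11
  have r12 := ee_rec h 12
  have r13 := ee_rec h 13
  have r14 := ee_rec h 14
  have r15 := ee_rec h 15
  have r16 := ee_rec h 16
  have r17 := ee_rec h 17
  have r18 := ee_rec h 18
  have h1 := ee_anti h (m := 19) (by norm_num)
  have h2 := ee_pos h (m := 20) (by norm_num)
  norm_num [qq] at *
  linarith

noncomputable def EE (j : ℕ) (μ : ℝ) : ℝ := ee (9 * j) μ

lemma EE_cont (j : ℕ) : ContinuousOn (EE j) II := ee_cont _

lemma kap_cont : ContinuousOn kap II := by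
  unfold kap qq
  exact ((ee_cont 10).mul (ee_cont 11)).mul (by fun_prop)

lemma EE_pos {μ : ℝ} (h : μ ∈ II) {j : ℕ} (hj : j ≠ 1) : 0 < EE j μ := by
  rcases j with _ | _ | j
  · exact e0_pos h
  · exact absurd rfl hj
  · exact ee_pos h (by omega)

lemma II_ne : II.Nonempty := ⟨19 / 2, by constructor <;> norm_num⟩

lemma EE_bounds : ∃ A B : ℝ, 0 < A ∧ 0 < B ∧ ∀ μ ∈ II, ∀ j : ℕ, j ≠ 1 →
    A / ((j : ℝ) + 1) ≤ EE j μ ∧ EE j μ ≤ B / ((j : ℝ) + 1) := by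
  obtain ⟨x1, hx1, m1⟩ := isCompact_Icc.exists_isMinOn II_ne kap_cont
  obtain ⟨x2, hx2, m2⟩ := isCompact_Icc.exists_isMaxOn II_ne kap_cont
  obtain ⟨x3, hx3, m3⟩ := isCompact_Icc.exists_isMinOn II_ne (EE_cont 0)
  obtain ⟨x4, hx4, m4⟩ := isCompact_Icc.exists_isMaxOn II_ne (EE_cont 0)
  have k1 := kap_pos hx1
  have k2 := kap_pos hx2
  have k3 := EE_pos hx3 (j := 0) (by norm_num)
  have k4 := EE_pos hx4 (j := 0) (by norm_num)
  refine ⟨min (EE 0 x3) (√(kap x1) / 10), max (EE 0 x4) (√(kap x2)), by positivity, by positivity, ?_⟩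
  intro μ hμ j hj
  have hp := EE_pos hμ hj
  rcases j with _ | _ | i
  · norm_num
    exact ⟨Or.inl (m3 hμ), Or.inl (m4 hμ)⟩
  · exact absurd rfl hj
  · have hl := lam_bounds hμ
    have hi : (0 : ℝ) ≤ i := Nat.cast_nonneg i
    have a1 := kap_le hμ (m := 9 * (i + 1 + 1)) (by omega)
    have a2 := le_kap hμ (m := 9 * (i + 1 + 1) - 1) (by omega)
    have e1 : 9 * (i + 1 + 1) - 1 + 1 = 9 * (i + 1 + 1) := by omega
    rw [e1] at a2
    have e2 : ((9 * (i + 1 + 1) - 1 : ℕ) : ℝ) = 9 * (i + 2) - 1 := by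
      rw [Nat.cast_sub (by omega)]; push_cast; ring
    have q1 : qq μ (9 * (i + 1 + 1)) ≤ 100 * ((i : ℝ) + 3) ^ 2 := by
      unfold qq; push_cast; nlinarith
    have q2 : ((i : ℝ) + 3) ^ 2 ≤ qq μ (9 * (i + 1 + 1) - 1) := by
      unfold qq; rw [e2]; nlinarith
    have b1 : kap x1 ≤ kap μ := m1 hμ
    have b2 : kap μ ≤ kap x2 := m2 hμ
    change 0 < ee (9 * (i + 1 + 1)) μ at hp
    change _ ≤ ee (9 * (i + 1 + 1)) μ ∧ ee (9 * (i + 1 + 1)) μ ≤ _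
    push_cast
    constructor
    · rw [div_le_iff₀ (by positivity)]
      refine (min_le_right _ _).trans ?_
      rw [div_le_iff₀ (by norm_num)]
      apply Real.sqrt_le_iff.2 ⟨by positivity, ?_⟩
      nlinarith [mul_le_mul_of_nonneg_left q1 (sq_nonneg (ee (9 * (i + 1 + 1)) μ))]
    · rw [le_div_iff₀ (by positivity)]
      refine le_trans ?_ (le_max_right _ _)
      apply Real.le_sqrt_of_sq_le
      nlinarith [mul_le_mul_of_nonneg_left q2 (sq_nonneg (ee (9 * (i + 1 + 1)) μ))]

lemma EE_asym {μ : ℝ} (h : μ ∈ II) {j : ℕ} (hj : 2 ≤ j) :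
    |√(kap μ) / EE j μ - 9 * j| ≤ 5 := by
  have hp := EE_pos h (j := j) (by omega)
  have a1 := kap_le h (m := 9 * j) (by omega)
  have a2 := le_kap h (m := 9 * j - 1) (by omega)
  have e1 : 9 * j - 1 + 1 = 9 * j := by omega
  rw [e1] at a2
  have e2 : ((9 * j - 1 : ℕ) : ℝ) = 9 * j - 1 := by
    rw [Nat.cast_sub (by omega)]; push_cast; ring
  have hl := lam_bounds h
  have hj' : (2 : ℝ) ≤ j := by exact_mod_cast hj
  change kap μ ≤ EE j μ ^ 2 * _ at a1
  change EE j μ ^ 2 * _ ≤ kap μ at a2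
  have q1 : qq μ (9 * j) ≤ (9 * (j : ℝ) + 5) ^ 2 := by
    unfold qq; push_cast; nlinarith
  have q2 : (9 * (j : ℝ) - 5) ^ 2 ≤ qq μ (9 * j - 1) := by
    unfold qq; rw [e2]; nlinarith
  rw [abs_le]
  constructor
  · have : (9 * (j : ℝ) - 5) ≤ √(kap μ) / EE j μ := by
      rw [le_div_iff₀ hp]
      apply Real.le_sqrt_of_sq_le
      nlinarith [mul_le_mul_of_nonneg_left q2 (sq_nonneg (EE j μ))]
    linarith
  · have : √(kap μ) / EE j μ ≤ (9 * (j : ℝ) + 5) := by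
      rw [div_le_iff₀ hp]
      apply Real.sqrt_le_iff.2 ⟨by positivity, ?_⟩
      nlinarith [mul_le_mul_of_nonneg_left q1 (sq_nonneg (EE j μ))]
    linarith

end TOP

namespace TOP

/-- Abel means of the cosine series with coefficients `a`. -/
noncomputable def PS (a : ℕ → ℝ) (ρ ψ : ℝ) : ℝ := ∑' j : ℕ, a j * ρ ^ j * cos (j * ψ)

/-- The cone of (coefficients of) nonnegative cosine series. -/
def Cone (a : ℕ → ℝ) : Prop :=
  (∀ ρ : ℝ, 0 ≤ ρ → ρ < 1 → ∀ ψ : ℝ, 0 ≤ PS a ρ ψ) ∧ |a 1| ≤ 2 * a 0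

lemma PS_term_bound {a : ℕ → ℝ} {C ρ : ℝ} (h : ∀ j, |a j| ≤ C) (h0 : 0 ≤ ρ) (ψ : ℝ) (j : ℕ) :
    ‖a j * ρ ^ j * cos (j * ψ)‖ ≤ C * ρ ^ j := by
  rw [norm_mul, norm_mul, Real.norm_eq_abs, Real.norm_eq_abs, Real.norm_eq_abs, abs_of_nonneg (pow_nonneg h0 j)]
  have h1 := abs_cos_le_one (j * ψ)
  have h2 := h j
  have h3 := pow_nonneg h0 j
  calc |a j| * ρ ^ j * |cos (j * ψ)| ≤ |a j| * ρ ^ j * 1 := by gcongr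
    _ ≤ C * ρ ^ j := by rw [mul_one]; gcongr

lemma PS_summable {a : ℕ → ℝ} {C ρ : ℝ} (h : ∀ j, |a j| ≤ C) (h0 : 0 ≤ ρ) (h1 : ρ < 1) (ψ : ℝ) :
    Summable (fun j : ℕ => a j * ρ ^ j * cos (j * ψ)) :=
  Summable.of_norm_bounded ((summable_geometric_of_lt_one h0 h1).mul_left C) (PS_term_bound h h0 ψ)

lemma bdd_of_energy {a : ℕ → ℝ} (h : Summable (fun j : ℕ => ((j : ℝ) + 1) * a j ^ 2)) :
    ∃ C, ∀ j, |a j| ≤ C := by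
  refine ⟨1 + ∑' j : ℕ, ((j : ℝ) + 1) * a j ^ 2, fun j => ?_⟩
  have h1 := h.le_tsum j (fun i _ => by positivity)
  have h2 : a j ^ 2 ≤ ((j : ℝ) + 1) * a j ^ 2 := by
    have : (0 : ℝ) ≤ j := Nat.cast_nonneg j
    nlinarith [mul_nonneg this (sq_nonneg (a j))]
  have : |a j| ^ 2 = a j ^ 2 := sq_abs _
  nlinarith [abs_nonneg (a j), sq_nonneg (|a j| - 1)]

lemma Cone.add_smul {a v : ℕ → ℝ} (ha : Cone a) (hv : Cone v)
    (ea : Summable (fun j : ℕ => ((j : ℝ) + 1) * a j ^ 2))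
    (ev : Summable (fun j : ℕ => ((j : ℝ) + 1) * v j ^ 2)) {s : ℝ} (hs : 0 ≤ s) :
    Cone (fun j => a j + s * v j) := by
  obtain ⟨Ca, hCa⟩ := bdd_of_energy ea
  obtain ⟨Cv, hCv⟩ := bdd_of_energy ev
  refine ⟨fun ρ h0 h1 ψ => ?_, ?_⟩
  · have : PS (fun j => a j + s * v j) ρ ψ = PS a ρ ψ + s * PS v ρ ψ := by
      unfold PS
      rw [← tsum_mul_left, ← (PS_summable hCa h0 h1 ψ).tsum_add ((PS_summable hCv h0 h1 ψ).mul_left s)]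
      congr 1; ext j; ring
    rw [this]
    exact add_nonneg (ha.1 ρ h0 h1 ψ) (mul_nonneg hs (hv.1 ρ h0 h1 ψ))
  · calc |a 1 + s * v 1| ≤ |a 1| + |s * v 1| := abs_add_le _ _
      _ = |a 1| + s * |v 1| := by rw [abs_mul, abs_of_nonneg hs]
      _ ≤ 2 * a 0 + s * (2 * v 0) := by gcongr; exact ha.2; exact hv.2
      _ = 2 * (a 0 + s * v 0) := by ring

lemma Cone.smul {a : ℕ → ℝ} (ha : Cone a) {s : ℝ} (hs : 0 ≤ s) : Cone (fun j => s * a j) := by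
  refine ⟨fun ρ h0 h1 ψ => ?_, ?_⟩
  · have : PS (fun j => s * a j) ρ ψ = s * PS a ρ ψ := by
      unfold PS
      rw [← tsum_mul_left]
      congr 1; ext j; ring
    rw [this]
    exact (mul_nonneg hs (ha.1 ρ h0 h1 ψ))
  · simp only
    rw [abs_mul, abs_of_nonneg hs]
    nlinarith [ha.2]

lemma Cone.cosmul {a : ℕ → ℝ} (ha : Cone a)
    (ea : Summable (fun j : ℕ => ((j : ℝ) + 1) * a j ^ 2)) (t : ℝ) :
    Cone (fun j => a j * cos (j * t)) := by
  obtain ⟨Ca, hCa⟩ := bdd_of_energy ea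
  refine ⟨fun ρ h0 h1 ψ => ?_, ?_⟩
  · have : PS (fun j => a j * cos (j * t)) ρ ψ = (1/2) * (PS a ρ (ψ + t) + PS a ρ (ψ - t)) := by
      unfold PS
      rw [← (PS_summable hCa h0 h1 _).tsum_add ((PS_summable hCa h0 h1 _)), ← tsum_mul_left]
      congr 1; ext j
      have e1 : (j:ℝ) * (ψ + t) = j * ψ + j * t := by ring
      have e2 : (j:ℝ) * (ψ - t) = j * ψ - j * t := by ring
      rw [e1, e2, cos_add, cos_sub]; ring
    rw [this]
    have := ha.1 ρ h0 h1 (ψ + t)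
    have := ha.1 ρ h0 h1 (ψ - t)
    linarith
  · simp only [Nat.cast_zero, zero_mul, cos_zero, mul_one]
    rw [abs_mul]
    have := abs_cos_le_one ((1 : ℕ) * t)
    have h2 := ha.2
    nlinarith [abs_nonneg (a 1), abs_nonneg (cos ((1 : ℕ) * t))]

set_option maxHeartbeats 1000000 in
/-- The variational lemma. -/
theorem var (D : ℕ → ℝ → ℝ) (hc : ∀ j, Continuous (D j)) {α β : ℝ} (hα : 0 < α)
    (h1 : ∀ μ, ∀ j : ℕ, j ≠ 1 → α * ((j : ℝ) + 1) ≤ D j μ)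
    (h2 : ∀ μ, ∀ j : ℕ, |D j μ| ≤ β * ((j : ℝ) + 1))
    (hl : 0 < D 0 (19 / 2) / 4 + D 1 (19 / 2)) (hr : D 0 (99 / 10) + D 1 (99 / 10) ≤ 0) :
    ∃ μ ∈ II, 19 / 2 < μ ∧ ∃ a : ℕ → ℝ, a 1 ^ 2 = 1 ∧ Cone a ∧
      Summable (fun j : ℕ => ((j : ℝ) + 1) ^ 3 * a j ^ 2) ∧
      HasSum (fun j => D j μ * a j ^ 2) 0 ∧
      ∀ v, Cone v → Summable (fun j : ℕ => ((j : ℝ) + 1) * v j ^ 2) →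
        0 ≤ ∑' j, D j μ * a j * v j := by
  have hD : ∀ μ (j : ℕ), j ≠ 1 → 0 < D j μ := fun μ j hj =>
    lt_of_lt_of_le (by positivity) (h1 μ j hj)
  have hβ : 0 < β := by
    have := h2 0 0
    have h3 := hD 0 0 (by norm_num)
    have := le_abs_self (D 0 0)
    simp at *; linarith
  set C : ℝ := 1 + 2 * β / α with hC
  have hC1 : 1 ≤ C := by rw [hC]; have : 0 < 2 * β / α := by positivity
                         linarith
  -- bound
  have hbd : ∀ μ (a : ℕ → ℝ), a 1 ^ 2 = 1 →
      (∀ J : ℕ, ∑ j ∈ Finset.range (J + 2), D j μ * a j ^ 2 ≤ 0) →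
      ∀ J : ℕ, ∑ j ∈ (Finset.range J).erase 1, D j μ * a j ^ 2 ≤ 2 * β := by
    intro μ a ha hs J
    have e := hs J
    rw [← Finset.add_sum_erase (Finset.range (J + 2)) _ (by simp : 1 ∈ Finset.range (J + 2)), ha, mul_one] at e
    have h3 := (abs_le.1 (h2 μ 1)).1
    norm_num at h3
    have h4 : ∑ j ∈ (Finset.range J).erase 1, D j μ * a j ^ 2 ≤
        ∑ j ∈ (Finset.range (J + 2)).erase 1, D j μ * a j ^ 2 := by
      apply Finset.sum_le_sum_of_subset_of_nonneg
      · intro x hx; simp at hx ⊢; omega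
      · intro i hi _
        exact mul_nonneg (hD μ i (Finset.ne_of_mem_erase hi)).le (sq_nonneg _)
    linarith
  have hbdC : ∀ μ (a : ℕ → ℝ), a 1 ^ 2 = 1 →
      (∀ J : ℕ, ∑ j ∈ Finset.range (J + 2), D j μ * a j ^ 2 ≤ 0) → ∀ j, |a j| ≤ C := by
    intro μ a ha hs j
    have key : a j ^ 2 ≤ C := by
      by_cases hj : j = 1
      · rw [hj, ha]; exact hC1
      · have e := hbd μ a ha hs (j + 1)
        have e2 : D j μ * a j ^ 2 ≤ 2 * β := le_trans (Finset.single_le_sum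
          (f := fun j => D j μ * a j ^ 2)
          (fun i hi => mul_nonneg (hD μ i (Finset.ne_of_mem_erase hi)).le (sq_nonneg _))
          (by simp [hj])) e
        have e3 : α * a j ^ 2 ≤ D j μ * a j ^ 2 := by
          apply mul_le_mul_of_nonneg_right _ (sq_nonneg _)
          have := h1 μ j hj
          have : (0:ℝ) ≤ α * j := by positivity
          nlinarith
        have : a j ^ 2 ≤ 2 * β / α := by rw [le_div_iff₀ hα]; linarith
        linarith
    rw [← sq_abs] at key
    nlinarith [abs_nonneg (a j)]
  set K : Set (ℝ × (ℕ → ℝ)) := {p | p.1 ∈ II ∧ (∀ j, p.2 j ∈ Icc (-C) C) ∧ p.2 1 ^ 2 = 1 ∧ Cone p.2 ∧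
    ∀ J : ℕ, ∑ j ∈ Finset.range (J + 2), D j p.1 * p.2 j ^ 2 ≤ 0} with hK
  have hKc : IsCompact K := by
    have hbox : IsCompact (II ×ˢ (Set.pi univ (fun _ : ℕ => Icc (-C) C))) :=
      isCompact_Icc.prod (isCompact_univ_pi (fun _ => isCompact_Icc))
    have hK' : K = (II ×ˢ (Set.pi univ (fun _ : ℕ => Icc (-C) C))) ∩
      (⋂ (ρ : Ico (0:ℝ) 1) (ψ : ℝ), (II ×ˢ (Set.pi univ (fun _ : ℕ => Icc (-C) C))) ∩ (fun p : ℝ × (ℕ → ℝ) => PS p.2 ρ ψ) ⁻¹' Ici 0) ∩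
      ({p | p.2 1 ^ 2 = 1} ∩ {p | |p.2 1| ≤ 2 * p.2 0} ∩
      ⋂ J : ℕ, {p | ∑ j ∈ Finset.range (J + 2), D j p.1 * p.2 j ^ 2 ≤ 0}) := by
      ext p
      simp only [hK, Cone, mem_ofPred_eq, mem_inter_iff, mem_iInter, mem_prod, Set.mem_pi, mem_univ, true_imp_iff,
        mem_preimage, mem_Ici, Subtype.forall]
      constructor
      · rintro ⟨h1, h2, h3, ⟨h4, h5⟩, h6⟩
        exact ⟨⟨⟨h1, h2⟩, fun ρ hρ ψ => ⟨⟨h1, h2⟩, h4 ρ hρ.1 hρ.2 ψ⟩⟩, ⟨h3, h5⟩, h6⟩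
      · rintro ⟨⟨⟨h1, h2⟩, h4⟩, ⟨h3, h5⟩, h6⟩
        exact ⟨h1, h2, h3, ⟨fun ρ a b ψ => (h4 ρ ⟨a, b⟩ ψ).2, h5⟩, h6⟩
    rw [hK']
    refine (hbox.inter_right ?_).inter_right ?_
    · refine isClosed_iInter fun ρ => isClosed_iInter fun ψ => ?_
      refine ContinuousOn.preimage_isClosed_of_isClosed ?_ hbox.isClosed isClosed_Ici
      unfold PS
      refine continuousOn_tsum (u := fun j => C * (ρ : ℝ) ^ j) (fun j => ?_) ((summable_geometric_of_lt_one ρ.2.1 ρ.2.2).mul_left C) ?_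
      · apply Continuous.continuousOn; fun_prop
      · intro j p hp
        have hp2 : ∀ j, |p.2 j| ≤ C := fun j => abs_le.2 (hp.2 j (mem_univ _))
        exact PS_term_bound hp2 ρ.2.1 ψ j
    · refine ((isClosed_eq (by fun_prop) (by fun_prop)).inter (isClosed_le (by fun_prop) (by fun_prop))).inter ?_
      refine isClosed_iInter fun J => isClosed_le ?_ continuous_const
      refine continuous_finsetSum _ fun j _ => ?_
      exact ((hc j).comp continuous_fst).mul (by fun_prop)
  have hKne : K.Nonempty := by
    refine ⟨(99/10, fun j => if j ≤ 1 then 1 else 0), ⟨by norm_num, by norm_num⟩, ?_, by simp, ⟨?_, by norm_num⟩, ?_⟩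
    · intro j; dsimp only; split_ifs <;> constructor <;> linarith
    · intro ρ h0 h1 ψ
      unfold PS
      rw [tsum_eq_sum (s := Finset.range 2)]
      · simp [Finset.sum_range_succ]
        have := neg_one_le_cos ψ
        nlinarith
      · intro j hj
        have : ¬ (j ≤ 1) := by simp at hj; omega
        simp [this]
    · intro J
      rw [← Finset.sum_subset (s₁ := Finset.range 2)]
      · simpa [Finset.sum_range_succ] using hr
      · intro x hx; simp at hx ⊢; omega
      · intro j _ hj
        have : ¬ (j ≤ 1) := by simp at hj; omega
        simp [this]
  obtain ⟨⟨μ, a⟩, hpK, hmin⟩ := hKc.exists_isMinOn hKne continuous_fst.continuousOn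
  have hmin' : ∀ μ' b, (μ', b) ∈ K → μ ≤ μ' := fun μ' b hb => hmin hb
  obtain ⟨hμ, hab, ha1, hacone, hasum⟩ := hpK
  dsimp only at hμ hab ha1 hacone hasum
  have hμl : 19 / 2 < μ := by
    refine lt_of_le_of_ne hμ.1 fun he => ?_
    have e := hasum 0
    simp only [zero_add, Finset.sum_range_succ, Finset.sum_range_zero] at e
    rw [ha1, ← he] at e
    have h3 := hacone.2
    have h4 : 1 ≤ 4 * a 0 ^ 2 := by
      rw [← ha1, ← sq_abs (a 1)]
      nlinarith [abs_nonneg (a 1)]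
    have h5 := hD (19/2) 0 (by norm_num)
    nlinarith
  -- energy
  have sumD : ∀ μ (v : ℕ → ℝ), Summable (fun j : ℕ => ((j : ℝ) + 1) * v j ^ 2) →
      Summable (fun j => D j μ * v j ^ 2) := by
    intro μ v hv
    refine Summable.of_norm_bounded (hv.mul_left β) fun j => ?_
    rw [norm_mul, Real.norm_eq_abs, norm_pow, Real.norm_eq_abs, sq_abs]
    nlinarith [h2 μ j, sq_nonneg (v j)]
  have sumB : ∀ μ (u v : ℕ → ℝ), Summable (fun j : ℕ => ((j : ℝ) + 1) * u j ^ 2) →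
      Summable (fun j : ℕ => ((j : ℝ) + 1) * v j ^ 2) →
      Summable (fun j => D j μ * u j * v j) := by
    intro μ u v hu hv
    refine Summable.of_norm_bounded ((hu.add hv).mul_left β) fun j => ?_
    rw [norm_mul, norm_mul, Real.norm_eq_abs, Real.norm_eq_abs, Real.norm_eq_abs, mul_assoc]
    have q1 : |u j| * |v j| ≤ u j ^ 2 + v j ^ 2 := by
      rw [← sq_abs (u j), ← sq_abs (v j)]; nlinarith [sq_nonneg (|u j| - |v j|), sq_nonneg (|u j|), sq_nonneg (|v j|)]
    calc |D j μ| * (|u j| * |v j|) ≤ (β * ((j : ℝ) + 1)) * (u j ^ 2 + v j ^ 2) := by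
          gcongr; exact h2 μ j
      _ = _ := by ring
  have qnn : ∀ b, Cone b → Summable (fun j : ℕ => ((j : ℝ) + 1) * b j ^ 2) →
      0 ≤ ∑' j, D j μ * b j ^ 2 := by
    intro b hb eb
    by_contra hneg
    push Not at hneg
    have hb1 : b 1 ≠ 0 := by
      intro hb1
      refine absurd hneg (not_lt.2 (tsum_nonneg fun j => ?_))
      by_cases hj : j = 1
      · rw [hj, hb1]; simp
      · exact mul_nonneg (hD μ j hj).le (sq_nonneg _)
    have hcont : Continuous (fun μ' => ∑' j, D j μ' * b j ^ 2) := by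
      refine continuous_tsum (fun j => (hc j).mul continuous_const) (eb.mul_left β) fun j μ' => ?_
      rw [norm_mul, Real.norm_eq_abs, norm_pow, Real.norm_eq_abs, sq_abs]
      nlinarith [h2 μ' j, sq_nonneg (b j)]
    have hev := (hcont.continuousAt (x := μ)).eventually_lt (g := fun _ => (0:ℝ)) continuousAt_const hneg
    have hev2 : ∀ᶠ μ' in nhdsWithin μ (Iio μ), μ' ∈ Ioo (19/2) μ :=
      Ioo_mem_nhdsLT hμl
    obtain ⟨μ', hm1, hm2⟩ := ((hev.filter_mono nhdsWithin_le_nhds).and hev2).exists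
    have hpos : 0 < |b 1| := abs_pos.2 hb1
    have hb1' : (|b 1|⁻¹ * b 1) ^ 2 = 1 := by
      rw [mul_pow, ← sq_abs (b 1)]; field_simp
    have hs' : ∀ J : ℕ, ∑ j ∈ Finset.range (J + 2), D j μ' * (|b 1|⁻¹ * b j) ^ 2 ≤ 0 := by
      intro J
      have e1 : ∑ j ∈ Finset.range (J + 2), D j μ' * b j ^ 2 ≤ ∑' j, D j μ' * b j ^ 2 := by
        refine (sumD μ' b eb).sum_le_tsum _ fun i hi => ?_
        have : i ≠ 1 := by simp at hi; omega
        exact mul_nonneg (hD μ' i this).le (sq_nonneg _)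
      have e2 : ∑ j ∈ Finset.range (J + 2), D j μ' * (|b 1|⁻¹ * b j) ^ 2 = (|b 1|⁻¹) ^ 2 * ∑ j ∈ Finset.range (J + 2), D j μ' * b j ^ 2 := by
        rw [Finset.mul_sum]; refine Finset.sum_congr rfl fun j _ => by ring
      rw [e2]
      exact mul_nonpos_of_nonneg_of_nonpos (sq_nonneg _) (by linarith)
    have : (μ', fun j => |b 1|⁻¹ * b j) ∈ K :=
      ⟨⟨hm2.1.le, hm2.2.le.trans hμ.2⟩, fun j => abs_le.1 (hbdC μ' _ hb1' hs' j), hb1',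
        hb.smul (by positivity), hs'⟩
    have := hmin' _ _ this
    linarith [hm2.2]
  have sa : Summable (fun j => D j μ * a j ^ 2) := by
    have : Summable (fun j => if j = 1 then 0 else D j μ * a j ^ 2) := by
      refine summable_of_sum_range_le (c := 2 * β) (fun j => ?_) fun J => ?_
      · split_ifs with h
        · exact le_rfl
        · exact mul_nonneg (hD μ j h).le (sq_nonneg _)
      · refine le_trans (le_of_eq ?_) (hbd μ a ha1 hasum J)
        rw [← Finset.sum_subset (Finset.erase_subset 1 (Finset.range J))]
        · refine Finset.sum_congr rfl fun j hj => ?_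
          rw [if_neg (Finset.ne_of_mem_erase hj)]
        · intro j h1 h2
          have : j = 1 := by simp at h1 h2; by_contra h3; exact absurd (h2 h3) (by omega)
          simp [this]
    refine (summable_congr_cofinite ?_).1 this
    filter_upwards [(Set.finite_singleton 1).compl_mem_cofinite] with j hj
    rw [if_neg (by simpa using hj)]
  have ea : Summable (fun j : ℕ => ((j : ℝ) + 1) * a j ^ 2) := by
    have h3 : Summable (fun j => |D j μ * a j ^ 2| / α) := (sa.abs.div_const α)
    refine Summable.of_norm_bounded_eventually h3 ?_
    filter_upwards [(Set.finite_singleton 1).compl_mem_cofinite] with j hj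
    have hj' : j ≠ 1 := by simpa using hj
    rw [Real.norm_eq_abs, abs_of_nonneg (by positivity), abs_of_nonneg (mul_nonneg (hD μ j hj').le (sq_nonneg _)), le_div_iff₀ hα]
    nlinarith [mul_le_mul_of_nonneg_right (h1 μ j hj') (sq_nonneg (a j))]
  have hQ0 : ∑' j, D j μ * a j ^ 2 = 0 := by
    refine le_antisymm ?_ (qnn a hacone ea)
    have := (tendsto_add_atTop_iff_nat 2).2 sa.hasSum.tendsto_sum_nat
    exact le_of_tendsto' this hasum
  have hQ : HasSum (fun j => D j μ * a j ^ 2) 0 := hQ0 ▸ sa.hasSum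
  have hB : ∀ v, Cone v → Summable (fun j : ℕ => ((j : ℝ) + 1) * v j ^ 2) →
        0 ≤ ∑' j, D j μ * a j * v j := by
    intro v hv ev
    have key : ∀ s : ℝ, 0 < s → 0 ≤ 2 * (∑' j, D j μ * a j * v j) + s * ∑' j, D j μ * v j ^ 2 := by
      intro s hs
      have e1 := qnn _ (hacone.add_smul hv ea ev hs.le) (by
        refine Summable.of_nonneg_of_le (fun j => by positivity) (fun j => ?_) ((ea.mul_left 2).add (ev.mul_left (2 * s ^ 2)))
        have : (a j + s * v j) ^ 2 ≤ 2 * a j ^ 2 + 2 * s ^ 2 * v j ^ 2 := by nlinarith [sq_nonneg (a j - s * v j)]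
        have h0 : (0:ℝ) ≤ (j : ℝ) + 1 := by positivity
        nlinarith [mul_le_mul_of_nonneg_left this h0])
      have hh := (hQ.add ((sumB μ a v ea ev).hasSum.mul_left (2 * s))).add ((sumD μ v ev).hasSum.mul_left (s ^ 2))
      have e2 : ∑' j, D j μ * (a j + s * v j) ^ 2 = 0 + 2 * s * (∑' j, D j μ * a j * v j) + s ^ 2 * ∑' j, D j μ * v j ^ 2 := by
        rw [← hh.tsum_eq]; congr 1; ext j; ring
      rw [e2] at e1
      have : 0 ≤ s * (2 * (∑' j, D j μ * a j * v j) + s * ∑' j, D j μ * v j ^ 2) := by linarith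
      exact nonneg_of_mul_nonneg_right this hs
    have lim : Tendsto (fun s : ℝ => 2 * (∑' j, D j μ * a j * v j) + s * ∑' j, D j μ * v j ^ 2) (nhdsWithin 0 (Ioi 0))
        (nhds (2 * (∑' j, D j μ * a j * v j) + 0 * ∑' j, D j μ * v j ^ 2)) := by
      refine Tendsto.mono_left ?_ nhdsWithin_le_nhds
      exact (Continuous.tendsto (by fun_prop) 0)
    have := ge_of_tendsto lim (by filter_upwards [self_mem_nhdsWithin] with s hs using key s hs)
    linarith
  refine ⟨μ, hμ, hμl, a, ha1, hacone, ?_, hQ, hB⟩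
  -- regularity
  have key : ∀ J : ℕ, ∑ j ∈ (Finset.range J).erase 1, D j μ * a j ^ 2 * (j : ℝ) ^ 2 ≤ 20 * β := by
    intro J
    set t : ℝ := π / (J + 2) with ht
    have hJ : (0:ℝ) < (J : ℝ) + 2 := by positivity
    have htp : 0 < t := by positivity
    have ecos : Summable (fun j : ℕ => ((j : ℝ) + 1) * (a j * cos (j * t)) ^ 2) := by
      refine Summable.of_nonneg_of_le (fun j => by positivity) (fun j => ?_) ea
      have := cos_sq_le_one (j * t)
      have h0 : (0:ℝ) ≤ ((j : ℝ) + 1) * a j ^ 2 := by positivity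
      rw [mul_pow]; nlinarith
    have e1 := hB _ (hacone.cosmul ea t) ecos
    have s1 := hQ.sub (sumB μ a _ ea ecos).hasSum
    have s2 : ∑' j : ℕ, D j μ * a j ^ 2 * (1 - cos (j * t)) ≤ 0 := by
      have : ∑' j : ℕ, D j μ * a j ^ 2 * (1 - cos (j * t)) = 0 - ∑' j : ℕ, D j μ * a j * (a j * cos (j * t)) := by
        rw [← s1.tsum_eq]; congr 1; ext j; ring
      rw [this]; linarith
    have s3 : Summable (fun j : ℕ => D j μ * a j ^ 2 * (1 - cos (j * t))) := by
      refine s1.summable.congr fun j => ?_; ring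
    have e2 : ∑ j ∈ Finset.range (J + 2), D j μ * a j ^ 2 * (1 - cos (j * t)) ≤ 0 := by
      refine le_trans (s3.sum_le_tsum _ fun i hi => ?_) s2
      have : i ≠ 1 := by simp at hi; omega
      exact mul_nonneg (mul_nonneg (hD μ i this).le (sq_nonneg _)) (by linarith [cos_le_one (i * t)])
    rw [← Finset.add_sum_erase (Finset.range (J + 2)) _ (by simp : 1 ∈ Finset.range (J + 2)), ha1, mul_one] at e2
    have h3 := (abs_le.1 (h2 μ 1)).1
    norm_num at h3
    have h4 : 1 - cos t ≤ t ^ 2 / 2 := by linarith [one_sub_sq_div_two_le_cos (x := t)]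
    have h4' : 0 ≤ 1 - cos t := by linarith [cos_le_one t]
    have e3 : ∑ j ∈ (Finset.range (J + 2)).erase 1, D j μ * a j ^ 2 * (1 - cos (j * t)) ≤ β * t ^ 2 := by
      simp only [Nat.cast_one, one_mul] at e2
      nlinarith
    have e4 : ∑ j ∈ (Finset.range J).erase 1, D j μ * a j ^ 2 * (2 / π ^ 2 * (j * t) ^ 2) ≤ 
       ∑ j ∈ (Finset.range (J + 2)).erase 1, D j μ * a j ^ 2 * (1 - cos (j * t)) := by
      refine le_trans (Finset.sum_le_sum fun j hj => ?_) (Finset.sum_le_sum_of_subset_of_nonneg (t := (Finset.range (J + 2)).erase 1) ?_ ?_)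
      · apply mul_le_mul_of_nonneg_left _ (mul_nonneg (hD μ j (Finset.ne_of_mem_erase hj)).le (sq_nonneg _))
        have hjJ : (j : ℝ) ≤ J + 2 := by
          have : j < J := by simpa using Finset.mem_of_mem_erase hj
          have : (j : ℝ) < J := by exact_mod_cast this
          linarith
        have := cos_le_one_sub_mul_cos_sq (x := j * t) (by
          rw [abs_of_nonneg (by positivity), ht, mul_div_assoc', div_le_iff₀ hJ]
          nlinarith [pi_pos])
        linarith
      · intro x hx; simp at hx ⊢; omega
      · intro i hi _
        exact mul_nonneg (mul_nonneg (hD μ i (Finset.ne_of_mem_erase hi)).le (sq_nonneg _)) (by linarith [cos_le_one (i * t)])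
    have e5 : ∑ j ∈ (Finset.range J).erase 1, D j μ * a j ^ 2 * (2 / π ^ 2 * (j * t) ^ 2) =
       (2 / π ^ 2 * t ^ 2) * ∑ j ∈ (Finset.range J).erase 1, D j μ * a j ^ 2 * (j : ℝ) ^ 2 := by
      rw [Finset.mul_sum]; refine Finset.sum_congr rfl fun j _ => by ring
    rw [e5] at e4
    have e6 := e4.trans e3
    have e7 : 2 / π ^ 2 * ∑ j ∈ (Finset.range J).erase 1, D j μ * a j ^ 2 * (j : ℝ) ^ 2 ≤ β := by
      have : 0 < t ^ 2 := by positivity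
      nlinarith
    have e8 : π ^ 2 ≤ 16 := by nlinarith [pi_pos, pi_lt_four]
    have hp : 0 < π ^ 2 := by positivity
    rw [div_mul_eq_mul_div, div_le_iff₀ hp] at e7
    nlinarith
  have s4 : Summable (fun j : ℕ => if j = 1 then 0 else D j μ * a j ^ 2 * (j : ℝ) ^ 2) := by
    refine summable_of_sum_range_le (c := 20 * β) (fun j => ?_) fun J => ?_
    · split_ifs with h
      · exact le_rfl
      · exact mul_nonneg (mul_nonneg (hD μ j h).le (sq_nonneg _)) (sq_nonneg _)
    · refine le_trans (le_of_eq ?_) (key J)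
      rw [← Finset.sum_subset (Finset.erase_subset 1 (Finset.range J))]
      · refine Finset.sum_congr rfl fun j hj => ?_
        rw [if_neg (Finset.ne_of_mem_erase hj)]
      · intro j h1 h2
        have : j = 1 := by simp at h1 h2; by_contra h3; exact absurd (h2 h3) (by omega)
        simp [this]
  refine Summable.of_norm_bounded_eventually (s4.mul_left (4 / α)) ?_
  filter_upwards [((Set.finite_singleton 1).union (Set.finite_singleton 0)).compl_mem_cofinite] with j hj
  have hj' : j ≠ 1 ∧ j ≠ 0 := by simp at hj; tauto
  have hj1 : (1:ℝ) ≤ j := by exact_mod_cast Nat.one_le_iff_ne_zero.2 hj'.2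
  rw [if_neg hj'.1, Real.norm_eq_abs, abs_of_nonneg (by positivity), div_mul_eq_mul_div, le_div_iff₀ hα]
  have q1 := h1 μ j hj'.1
  have q2 : ((j:ℝ) + 1) ^ 2 ≤ 4 * (j:ℝ) ^ 2 := by nlinarith
  calc ((j:ℝ) + 1) ^ 3 * a j ^ 2 * α = (α * ((j:ℝ) + 1)) * a j ^ 2 * ((j:ℝ) + 1) ^ 2 := by ring
    _ ≤ D j μ * a j ^ 2 * (4 * (j:ℝ) ^ 2) := by gcongr; exact mul_nonneg (hD μ j hj'.1).le (sq_nonneg _)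
    _ = _ := by ring


noncomputable def ww (j : ℕ) : ℝ := if j = 0 then 2 else 1

lemma ww_pos (j : ℕ) : 0 < ww j := by unfold ww; split_ifs <;> norm_num
lemma one_le_ww (j : ℕ) : 1 ≤ ww j := by unfold ww; split_ifs <;> norm_num
lemma ww_le (j : ℕ) : ww j ≤ 2 := by unfold ww; split_ifs <;> norm_num

lemma E1_neg {μ : ℝ} (h : μ ∈ II) : EE 1 μ < 0 := e9_neg h

lemma EE_ne {μ : ℝ} (h : μ ∈ II) (j : ℕ) : EE j μ ≠ 0 := by
  by_cases hj : j = 1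
  · rw [hj]; exact (E1_neg h).ne
  · exact (EE_pos h hj).ne'

theorem exists_min : ∃ μ ∈ II, 19 / 2 < μ ∧ ∃ a : ℕ → ℝ, a 1 ^ 2 = 1 ∧ Cone a ∧
      Summable (fun j : ℕ => ((j : ℝ) + 1) ^ 3 * a j ^ 2) ∧
      HasSum (fun j => ww j / EE j μ * a j ^ 2) 0 ∧
      ∀ v, Cone v → Summable (fun j : ℕ => ((j : ℝ) + 1) * v j ^ 2) →
        0 ≤ ∑' j, ww j / EE j μ * a j * v j := by
  obtain ⟨A, B, hA, hB, hAB⟩ := EE_bounds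
  obtain ⟨x1, hx1, m1⟩ := isCompact_Icc.exists_isMaxOn II_ne (EE_cont 1)
  have hle : (19 / 2 : ℝ) ≤ 99 / 10 := by norm_num
  set b := - EE 1 x1 with hb
  have hbp : 0 < b := by have := E1_neg hx1; linarith
  let D : ℕ → ℝ → ℝ := fun j μ => ww j / EE j (projIcc _ _ hle μ)
  have hDeq : ∀ j, ∀ μ ∈ II, D j μ = ww j / EE j μ := by
    intro j μ hμ
    simp only [D]
    rw [projIcc_of_mem hle hμ]
  refine (fun hv : ∃ μ ∈ II, 19 / 2 < μ ∧ ∃ a : ℕ → ℝ, a 1 ^ 2 = 1 ∧ Cone a ∧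
      Summable (fun j : ℕ => ((j : ℝ) + 1) ^ 3 * a j ^ 2) ∧
      HasSum (fun j => D j μ * a j ^ 2) 0 ∧
      ∀ v, Cone v → Summable (fun j : ℕ => ((j : ℝ) + 1) * v j ^ 2) →
        0 ≤ ∑' j, D j μ * a j * v j => ?_) (var D (fun j => ?_) (α := 1 / B) (β := 2 / A + 1 / b)
    (by positivity) ?_ ?_ ?_ ?_)
  · obtain ⟨μ, hμ, h1, a, h2, h3, h4, h5, h6⟩ := hv
    refine ⟨μ, hμ, h1, a, h2, h3, h4, ?_, ?_⟩
    · simpa only [hDeq _ μ hμ] using h5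
    · simpa only [hDeq _ μ hμ] using h6
  · refine continuous_const.div ?_ (fun μ => EE_ne (projIcc _ _ hle μ).2 j)
    exact (EE_cont j).comp_continuous (continuous_subtype_val.comp continuous_projIcc) (fun μ => (projIcc _ _ hle μ).2)
  · intro μ j hj
    have hE := hAB _ (projIcc _ _ hle μ).2 j hj
    have hp := EE_pos (projIcc _ _ hle μ).2 hj
    have hj0 : (0:ℝ) < (j:ℝ) + 1 := by positivity
    simp only [D]
    rw [le_div_iff₀ hp]
    have := hE.2
    rw [le_div_iff₀ hj0] at this
    have := one_le_ww j
    calc 1 / B * ((j:ℝ) + 1) * EE j (projIcc _ _ hle μ) = (EE j (projIcc _ _ hle μ) * ((j:ℝ) + 1)) / B := by ring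
      _ ≤ 1 := by rw [div_le_one hB]; assumption
      _ ≤ _ := this
  · intro μ j
    have hj0 : (0:ℝ) < (j:ℝ) + 1 := by positivity
    simp only [D]
    rw [abs_div, abs_of_pos (ww_pos j), div_le_iff₀ (abs_pos.2 (EE_ne (projIcc _ _ hle μ).2 j))]
    by_cases hj : j = 1
    · subst hj
      have q := m1 (projIcc _ _ hle μ).2
      have q : EE 1 (projIcc _ _ hle μ) ≤ EE 1 x1 := q
      rw [abs_of_neg (E1_neg (projIcc _ _ hle μ).2)]
      have q2 : b ≤ - EE 1 (projIcc _ _ hle μ) := by rw [hb]; linarith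
      have : ww 1 = 1 := by simp [ww]
      rw [this]
      calc (1:ℝ) = 1 / b * 1 * b := by field_simp
        _ ≤ (2 / A + 1 / b) * (((1:ℕ):ℝ) + 1) * -EE 1 (projIcc _ _ hle μ) := by
          gcongr
          · have : 0 < 2 / A := by positivity
            linarith
          · norm_num
    · have hE := (hAB _ (projIcc _ _ hle μ).2 j hj).1
      have hp := EE_pos (projIcc _ _ hle μ).2 hj
      rw [abs_of_pos hp]
      calc ww j ≤ 2 := ww_le j
        _ = 2 / A * ((j:ℝ) + 1) * (A / ((j:ℝ) + 1)) := by field_simp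
        _ ≤ _ := by
          gcongr
          have : 0 < 1 / b := by positivity
          linarith
  · have hm : (19 / 2 : ℝ) ∈ II := ⟨le_rfl, by norm_num⟩
    rw [hDeq _ _ hm, hDeq _ _ hm]
    have p0 : 0 < EE 0 (19 / 2) := EE_pos hm (by norm_num)
    have p1 := E1_neg hm
    have e : 2 * EE 0 (19 / 2) < - EE 1 (19 / 2) := e_left
    have : 1 / (- EE 1 (19 / 2)) < 1 / (2 * EE 0 (19 / 2)) := one_div_lt_one_div_of_lt (by positivity) e
    simp only [ww, if_true, one_ne_zero, if_false]
    have e2 : 2 / EE 0 (19 / 2) / 4 = 1 / (2 * EE 0 (19 / 2)) := by field_simp; norm_num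
    have e3 : 1 / EE 1 (19 / 2) = - (1 / (- EE 1 (19 / 2))) := by rw [div_neg]; ring
    rw [e2, e3]; linarith
  · have hm : (99 / 10 : ℝ) ∈ II := ⟨by norm_num, le_rfl⟩
    rw [hDeq _ _ hm, hDeq _ _ hm]
    have p0 : 0 < EE 0 (99 / 10) := EE_pos hm (by norm_num)
    have p1 := E1_neg hm
    have e : - EE 1 (99 / 10) < EE 0 (99 / 10) / 2 := e_right
    have : 1 / (EE 0 (99 / 10) / 2) < 1 / (- EE 1 (99 / 10)) := one_div_lt_one_div_of_lt (by linarith) e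
    simp only [ww, if_true, one_ne_zero, if_false]
    have e2 : 2 / EE 0 (99 / 10) = 1 / (EE 0 (99 / 10) / 2) := by field_simp
    have e3 : 1 / EE 1 (99 / 10) = - (1 / (- EE 1 (99 / 10))) := by rw [div_neg]; ring
    rw [e2, e3]; linarith

end TOP

namespace TOP
open MeasureTheory

/-- The base measure on the circle. -/
noncomputable def MM : Measure ℝ := volume.restrict (Ioc (-π) π)

instance : IsFiniteMeasure MM := by unfold MM; infer_instance

lemma MM_integral (f : ℝ → ℝ) : ∫ s, f s ∂MM = ∫ s in (-π)..π, f s := by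
  rw [intervalIntegral.integral_of_le (by linarith [pi_pos])]; rfl

lemma MM_real_univ : MM.real univ = 2 * π := by
  unfold MM
  rw [Measure.real, Measure.restrict_apply_univ, Real.volume_Ioc, ENNReal.toReal_ofReal (by linarith [pi_pos])]; ring

lemma int_const (c : ℝ) : ∫ _s, c ∂MM = 2 * π * c := by
  rw [integral_const, MM_real_univ, smul_eq_mul]

lemma int_cos {n : ℤ} (hn : n ≠ 0) : ∫ s, cos (n * s) ∂MM = 0 := by
  rw [MM_integral, intervalIntegral.integral_comp_mul_left (fun x => cos x) (by exact_mod_cast hn : (n:ℝ) ≠ 0)]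
  simp [integral_cos]

lemma int_sin (n : ℤ) : ∫ s, sin (n * s) ∂MM = 0 := by
  by_cases hn : n = 0
  · simp [hn]
  rw [MM_integral, intervalIntegral.integral_comp_mul_left (fun x => sin x) (by exact_mod_cast hn : (n:ℝ) ≠ 0)]
  simp [integral_sin]

lemma cont_int {f : ℝ → ℝ} (hf : Continuous f) : Integrable f MM := by
  unfold MM
  exact (hf.continuousOn.integrableOn_Icc (a := -π) (b := π)).mono_set Ioc_subset_Icc_self

lemma cont_memLp {f : ℝ → ℝ} (hf : Continuous f) : MemLp f 2 MM := by
  rw [memLp_two_iff_integrable_sq hf.aestronglyMeasurable]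
  exact cont_int (hf.pow 2)

lemma int_cos_cos (m n : ℕ) : ∫ s, cos (m * s) * cos (n * s) ∂MM =
    if m = n then (if m = 0 then 2 * π else π) else 0 := by
  have e : ∀ s : ℝ, cos (m * s) * cos (n * s) =
      (1/2) * (cos (((m:ℤ) - n : ℤ) * s)) + (1/2) * cos (((m:ℤ) + n : ℤ) * s) := by
    intro s
    have e1 : (((m:ℤ) - n : ℤ) : ℝ) * s = m * s - n * s := by push_cast; ring
    have e2 : (((m:ℤ) + n : ℤ) : ℝ) * s = m * s + n * s := by push_cast; ring
    rw [e1, e2, cos_sub, cos_add]; ring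
  simp_rw [e]
  rw [integral_add (cont_int (by fun_prop)) (cont_int (by fun_prop)), integral_const_mul, integral_const_mul]
  split_ifs with h1 h2
  · subst h1; subst h2; simp [MM_real_univ]; ring
  · subst h1
    rw [int_cos (n := (m:ℤ) + m) (by omega)]
    simp [MM_real_univ]
  · rw [int_cos (n := (m:ℤ) + n) (by omega), int_cos (n := (m:ℤ) - n) (by omega)]; simp

lemma int_sin_cos (m n : ℕ) : ∫ s, sin (m * s) * cos (n * s) ∂MM = 0 := by
  have e : ∀ s : ℝ, sin (m * s) * cos (n * s) =
      (1/2) * (sin (((m:ℤ) - n : ℤ) * s)) + (1/2) * sin (((m:ℤ) + n : ℤ) * s) := by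
    intro s
    have e1 : (((m:ℤ) - n : ℤ) : ℝ) * s = m * s - n * s := by push_cast; ring
    have e2 : (((m:ℤ) + n : ℤ) : ℝ) * s = m * s + n * s := by push_cast; ring
    rw [e1, e2, sin_sub, sin_add]; ring
  simp_rw [e]
  rw [integral_add (cont_int (by fun_prop)) (cont_int (by fun_prop)), integral_const_mul, integral_const_mul,
    int_sin, int_sin]; simp

lemma exists_density (ν : ℕ → ℝ) (hν : Summable (fun j => ν j ^ 2)) :
    ∃ N : ℝ → ℝ, MemLp N 2 MM ∧ ∀ h : ℝ → ℝ, MemLp h 2 MM →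
      HasSum (fun j => ν j * ∫ s, h s * cos ((9 * j : ℕ) * s) ∂MM) (∫ s, h s * N s ∂MM) := by
  have hmem : ∀ m : ℕ, MemLp (fun s : ℝ => cos (m * s)) 2 MM := fun m => cont_memLp (by fun_prop)
  let f : ℕ → Lp ℝ 2 MM := fun j => (hmem (9 * j)).toLp _
  have hin : ∀ (h : ℝ → ℝ) (hh : MemLp h 2 MM) (k : ℝ → ℝ) (hk : MemLp k 2 MM),
      inner ℝ (hh.toLp h) (hk.toLp k) = ∫ s, h s * k s ∂MM := by
    intro h hh k hk
    rw [L2.inner_def]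
    refine integral_congr_ae ?_
    filter_upwards [hh.coeFn_toLp, hk.coeFn_toLp] with s h1 h2
    rw [h1, h2]; simp [mul_comm]
  have hff : ∀ i j, inner ℝ (f i) (f j) = if i = j then (if i = 0 then 2 * π else π) else 0 := by
    intro i j
    rw [hin, int_cos_cos]
    congr 1
    · simp
    · congr 1; simp
  have hn2 : ∀ i, ‖f i‖ ^ 2 = if i = 0 then 2 * π else π := by
    intro i
    rw [← real_inner_self_eq_norm_sq, hff]; simp
  have hnp : ∀ i, 0 < ‖f i‖ := by
    intro i
    have : 0 < ‖f i‖ ^ 2 := by rw [hn2]; split_ifs <;> positivity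
    by_contra hh
    have : ‖f i‖ = 0 := le_antisymm (not_lt.1 hh) (norm_nonneg _)
    simp_all
  have hon : Orthonormal ℝ (fun i => ‖f i‖⁻¹ • f i) := by
    constructor
    · intro i
      rw [norm_smul, norm_inv, norm_norm, inv_mul_cancel₀ (hnp i).ne']
    · intro i j hij
      simp only
      rw [inner_smul_left, inner_smul_right, hff, if_neg hij]; simp
  have hs : Summable (fun j => ν j • f j) := by
    have h1 := (hon.orthogonalFamily.summable_iff_norm_sq_summable (fun i => ν i * ‖f i‖)).2 ?_
    · refine h1.congr fun j => ?_
      rw [LinearIsometry.toSpanSingleton_apply, smul_smul, mul_assoc, mul_inv_cancel₀ (hnp j).ne', mul_one]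
    · refine Summable.of_nonneg_of_le (fun j => by positivity) (fun j => ?_) (hν.mul_left (2 * π))
      rw [Real.norm_eq_abs, sq_abs, mul_pow, hn2]
      split_ifs <;> nlinarith [sq_nonneg (ν j), pi_pos]
  refine ⟨((∑' j, ν j • f j : Lp ℝ 2 MM) : ℝ → ℝ), Lp.memLp _, fun h hh => ?_⟩
  have h2 := hs.hasSum.mapL (innerSL ℝ (hh.toLp h))
  have e1 : innerSL ℝ (hh.toLp h) (∑' j, ν j • f j) = ∫ s, h s * ((∑' j, ν j • f j : Lp ℝ 2 MM) : ℝ → ℝ) s ∂MM := by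
    rw [innerSL_apply_apply]
    conv_lhs => rw [← Lp.toLp_coeFn (∑' j, ν j • f j) (Lp.memLp _)]
    rw [hin]
  rw [e1] at h2
  have e3 : (fun j => ν j * ∫ s, h s * cos ((9 * j : ℕ) * s) ∂MM) =
      fun j => innerSL ℝ (hh.toLp h) (ν j • f j) := by
    funext j
    rw [map_smul, smul_eq_mul, innerSL_apply_apply, hin]
  rw [e3]; exact h2

lemma poisson_hasSum {x : ℝ} (h0 : 0 ≤ x) (h1 : x < 1) (θ : ℝ) :
    HasSum (fun j : ℕ => x ^ j * cos (j * θ)) ((1 - x * cos θ) / (1 - 2 * x * cos θ + x ^ 2)) := by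
  set z : ℂ := x * Complex.exp (θ * Complex.I) with hz
  have hzn : ‖z‖ < 1 := by
    rw [hz, norm_mul, Complex.norm_exp_ofReal_mul_I, mul_one, Complex.norm_real, Real.norm_eq_abs, abs_of_nonneg h0]; exact h1
  have hs := Complex.reCLM.hasSum (hasSum_geometric_of_norm_lt_one hzn)
  have hre : z.re = x * cos θ := by
    rw [hz, Complex.re_ofReal_mul, Complex.exp_ofReal_mul_I_re]
  have him : z.im = x * sin θ := by
    rw [hz, Complex.im_ofReal_mul, Complex.exp_ofReal_mul_I_im]
  convert hs using 1
  · ext j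
    simp only [Function.comp, Complex.reCLM_apply]
    rw [hz, mul_pow, ← Complex.exp_nat_mul]
    have : (j : ℂ) * (θ * Complex.I) = ((j * θ : ℝ) : ℂ) * Complex.I := by push_cast; ring
    rw [this, ← Complex.ofReal_pow, Complex.re_ofReal_mul, Complex.exp_ofReal_mul_I_re]
  · rw [Complex.reCLM_apply, Complex.inv_re, Complex.normSq_apply]
    simp only [Complex.sub_re, Complex.one_re, Complex.sub_im, Complex.one_im, hre, him]
    congr 1
    nlinarith [sin_sq_add_cos_sq θ]

lemma poisson_den {x : ℝ} (h0 : 0 ≤ x) (h1 : x < 1) (θ : ℝ) : 0 < 1 - 2 * x * cos θ + x ^ 2 := by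
  have := cos_le_one θ
  nlinarith [mul_nonneg h0 (sub_nonneg.2 this), sq_pos_of_pos (sub_pos.2 h1)]

lemma poisson_ge {x : ℝ} (h0 : 0 ≤ x) (h1 : x < 1) (θ : ℝ) :
    1 / 2 ≤ ∑' j : ℕ, x ^ j * cos (j * θ) := by
  rw [(poisson_hasSum h0 h1 θ).tsum_eq, div_le_div_iff₀ two_pos (poisson_den h0 h1 θ)]
  nlinarith

/-- the trace -/
noncomputable def gg (a : ℕ → ℝ) (s : ℝ) : ℝ := ∑' j : ℕ, a j * cos ((9 * j : ℕ) * s)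

lemma gg_term (a : ℕ → ℝ) (s : ℝ) (j : ℕ) : ‖a j * cos ((9 * j : ℕ) * s)‖ ≤ |a j| := by
  rw [norm_mul, Real.norm_eq_abs, Real.norm_eq_abs]
  have := abs_cos_le_one ((9 * j : ℕ) * s)
  nlinarith [abs_nonneg (a j)]

lemma gg_summable {a : ℕ → ℝ} (ha : Summable (fun j => |a j|)) (s : ℝ) :
    Summable (fun j : ℕ => a j * cos ((9 * j : ℕ) * s)) :=
  Summable.of_norm_bounded ha (gg_term a s)

lemma gg_cont {a : ℕ → ℝ} (ha : Summable (fun j => |a j|)) : Continuous (gg a) := by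
  unfold gg
  exact continuous_tsum (fun j => by fun_prop) ha (fun j s => gg_term a s j)

lemma gg_int {a : ℕ → ℝ} (ha : Summable (fun j => |a j|)) (k : ℕ) :
    ∫ s, gg a s * cos ((9 * k : ℕ) * s) ∂MM = π * ww k * a k := by
  have h1 := hasSum_integral_of_summable_integral_norm (μ := MM)
    (F := fun (j : ℕ) (s : ℝ) => (a j * cos ((9 * j : ℕ) * s)) * cos ((9 * k : ℕ) * s))
    (fun j => cont_int (by fun_prop)) ?_
  · have e1 : ∀ s, ∑' j : ℕ, (a j * cos ((9 * j : ℕ) * s)) * cos ((9 * k : ℕ) * s) = gg a s * cos ((9 * k : ℕ) * s) := by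
      intro s; unfold gg; rw [tsum_mul_right]
    simp_rw [e1] at h1
    rw [← h1.tsum_eq, tsum_eq_single k]
    · simp_rw [mul_assoc]
      rw [integral_const_mul, int_cos_cos]
      unfold ww
      by_cases hk : k = 0
      · simp [hk]; ring
      · simp [hk]; ring
    · intro j hj
      simp_rw [mul_assoc]
      rw [integral_const_mul, int_cos_cos, if_neg (by omega), mul_zero]
  · refine Summable.of_nonneg_of_le (fun j => integral_nonneg fun s => norm_nonneg _) (fun j => ?_) (ha.mul_left (2 * π))
    rw [← int_const]
    refine integral_mono (cont_int (by fun_prop)) (cont_int (by fun_prop)) fun s => ?_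
    simp only
    rw [norm_mul]
    have := gg_term a s j
    have h3 : ‖cos ((9 * k : ℕ) * s)‖ ≤ 1 := abs_cos_le_one _
    nlinarith [abs_nonneg (a j), norm_nonneg (a j * cos ((9 * j : ℕ) * s)), norm_nonneg (cos ((9 * k : ℕ) * s))]

lemma gg_nonneg {a : ℕ → ℝ} (ha : Summable (fun j => |a j|)) (hc : Cone a) (s : ℝ) : 0 ≤ gg a s := by
  have h1 : Tendsto (fun n : ℕ => PS a (1 - 1 / ((n:ℝ) + 1)) (9 * s)) atTop (nhds (gg a s)) := by
    have hρ : Tendsto (fun n : ℕ => 1 - 1 / ((n:ℝ) + 1)) atTop (nhds 1) := by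
      simpa using (tendsto_one_div_add_atTop_nhds_zero_nat (𝕜 := ℝ)).const_sub 1
    unfold PS gg
    refine tendsto_tsum_of_dominated_convergence ha (fun j => ?_) ?_
    · have := ((hρ.pow j).const_mul (a j)).mul_const (cos (j * (9 * s)))
      convert this using 2
      rw [one_pow, mul_one]; congr 2; push_cast; ring
    · refine Eventually.of_forall fun n j => ?_
      have q1 : (0:ℝ) < (n:ℝ) + 1 := by positivity
      have q2 : 1 / ((n:ℝ) + 1) ≤ 1 := by rw [div_le_one q1]; linarith [Nat.cast_nonneg (α := ℝ) n]
      have q3 : 0 < 1 / ((n:ℝ) + 1) := by positivity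
      have q5 : 0 ≤ 1 - 1 / ((n:ℝ) + 1) := by linarith
      rw [norm_mul, norm_mul, Real.norm_eq_abs, Real.norm_eq_abs, Real.norm_eq_abs, abs_of_nonneg (pow_nonneg q5 j)]
      have q4 : (1 - 1 / ((n:ℝ) + 1)) ^ j ≤ 1 := pow_le_one₀ (by linarith) (by linarith)
      calc |a j| * (1 - 1 / ((n:ℝ) + 1)) ^ j * |cos (j * (9 * s))| ≤ |a j| * 1 * 1 := by
            gcongr; exact abs_cos_le_one _
        _ = _ := by ring
  refine ge_of_tendsto' h1 fun n => ?_
  have q1 : (0:ℝ) < (n:ℝ) + 1 := by positivity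
  have q2 : 1 / ((n:ℝ) + 1) ≤ 1 := by rw [div_le_one q1]; linarith [Nat.cast_nonneg (α := ℝ) n]
  have q3 : 0 < 1 / ((n:ℝ) + 1) := by positivity
  exact hc.1 _ (by linarith) (by linarith) _

/-- test sequences -/
lemma test_cone (A : Set ℝ) (hA : MeasurableSet A) {ρ : ℝ} (h0 : 0 ≤ ρ) (h1 : ρ < 1) :
    let v : ℕ → ℝ := fun j => (∫ s in A, cos ((9 * j : ℕ) * s) ∂MM) * ρ ^ j / ww j
    Cone v ∧ Summable (fun j : ℕ => ((j : ℝ) + 1) * v j ^ 2) := by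
  intro v
  have hb : ∀ j : ℕ, |∫ s in A, cos ((9 * j : ℕ) * s) ∂MM| ≤ ∫ s in A, 1 ∂MM := by
    intro j
    rw [← Real.norm_eq_abs]
    refine norm_integral_le_of_norm_le (integrable_const _) (Eventually.of_forall fun s => abs_cos_le_one _)
  have hI : ∫ s in A, (1:ℝ) ∂MM ≤ 2 * π := by
    have := setIntegral_le_integral (μ := MM) (s := A) (f := fun _ => (1:ℝ)) (integrable_const _) (Eventually.of_forall fun _ => zero_le_one)
    rwa [int_const, mul_one] at this
  have hvb : ∀ j, |v j| ≤ 2 * π * ρ ^ j := by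
    intro j
    simp only [v]
    rw [abs_div, abs_mul, abs_of_pos (ww_pos j), abs_of_nonneg (pow_nonneg h0 j)]
    refine (div_le_self (by positivity) (one_le_ww j)).trans ?_
    gcongr
    exact (hb j).trans hI
  refine ⟨⟨fun x hx0 hx1 ψ => ?_, ?_⟩, ?_⟩
  · have hy0 : 0 ≤ ρ * x := by positivity
    have hy1 : ρ * x < 1 := by nlinarith
    have hs := hasSum_integral_of_summable_integral_norm (μ := MM.restrict A)
      (F := fun (j : ℕ) (s : ℝ) => (ρ * x) ^ j * cos (j * ψ) / ww j * cos ((9 * j : ℕ) * s)) (fun j => (cont_int (by fun_prop)).restrict) ?_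
    · have e1 : PS v x ψ = ∑' j : ℕ, ∫ s in A, (ρ * x) ^ j * cos (j * ψ) / ww j * cos ((9 * j : ℕ) * s) ∂MM := by
        unfold PS
        congr 1; ext j
        rw [integral_const_mul]
        simp only [v]; rw [mul_pow]; ring
      rw [e1, hs.tsum_eq]
      refine integral_nonneg fun s => ?_
      have p1 := poisson_hasSum hy0 hy1 (9 * s + ψ)
      have p2 := poisson_hasSum hy0 hy1 (9 * s - ψ)
      have p3 := poisson_ge hy0 hy1 (9 * s + ψ)
      have p4 := poisson_ge hy0 hy1 (9 * s - ψ)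
      rw [p1.tsum_eq] at p3
      rw [p2.tsum_eq] at p4
      have p5 := ((p1.add p2).mul_left (1/2)).sub (hasSum_ite_eq (0:ℕ) (1/2 : ℝ))
      have e2 : ∀ j : ℕ, (ρ * x) ^ j * cos (j * ψ) / ww j * cos ((9 * j : ℕ) * s) =
          1 / 2 * ((ρ * x) ^ j * cos (j * (9 * s + ψ)) + (ρ * x) ^ j * cos (j * (9 * s - ψ))) -
            (if j = 0 then 1 / 2 else 0) := by
        intro j
        by_cases hj : j = 0
        · subst hj; simp [ww]; norm_num
        · have e1 : (j:ℝ) * (9 * s + ψ) = (9 * j : ℕ) * s + j * ψ := by push_cast; ring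
          have e2 : (j:ℝ) * (9 * s - ψ) = (9 * j : ℕ) * s - j * ψ := by push_cast; ring
          rw [e1, e2, cos_add, cos_sub]
          simp only [ww, if_neg hj]; ring
      show 0 ≤ ∑' j : ℕ, (ρ * x) ^ j * cos (j * ψ) / ww j * cos ((9 * j : ℕ) * s)
      rw [tsum_congr e2, p5.tsum_eq]
      linarith
    · refine Summable.of_nonneg_of_le (fun j => integral_nonneg fun s => norm_nonneg _) (fun j => ?_) ((summable_geometric_of_lt_one hy0 hy1).mul_left (∫ s in A, (1:ℝ) ∂MM))
      rw [← integral_mul_const]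
      refine integral_mono ((cont_int (by fun_prop)).restrict) (integrable_const _) fun s => ?_
      simp only [norm_mul, norm_div, Real.norm_eq_abs, one_mul]
      rw [abs_of_nonneg (pow_nonneg hy0 j), abs_of_pos (ww_pos j)]
      have := abs_cos_le_one (j * ψ)
      have := abs_cos_le_one ((9 * j : ℕ) * s)
      calc (ρ * x) ^ j * |cos (j * ψ)| / ww j * |cos ((9 * j : ℕ) * s)| ≤ (ρ * x) ^ j * 1 / 1 * 1 := by
            gcongr; exact one_le_ww j
        _ = _ := by ring
  · have := hb 1
    simp only [v]
    rw [abs_div, abs_mul, abs_of_pos (ww_pos _), abs_of_nonneg (pow_nonneg h0 _)]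
    simp [ww] at this ⊢
    have h3 := abs_nonneg (∫ s in A, cos (9 * s) ∂MM)
    have h4 := integral_nonneg (μ := MM.restrict A) (f := fun _ => (1:ℝ)) (fun _ => zero_le_one)
    simp at h4
    nlinarith
  · have hr : ρ ^ 2 < 1 := by nlinarith
    have s1 : Summable (fun j : ℕ => ((j:ℝ) + 1) * (ρ ^ 2) ^ j) := by
      have q1 := summable_pow_mul_geometric_of_norm_lt_one (R := ℝ) 1 (r := ρ ^ 2) (by rw [Real.norm_eq_abs, abs_of_nonneg (by positivity)]; exact hr)
      have q2 := summable_geometric_of_lt_one (by positivity : 0 ≤ ρ ^ 2) hr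
      refine (q1.add q2).congr fun j => by ring
    refine Summable.of_nonneg_of_le (fun j => by positivity) (fun j => ?_) (s1.mul_left ((2 * π) ^ 2))
    have h5 : v j ^ 2 ≤ (2 * π * ρ ^ j) ^ 2 := by rw [← sq_abs]; gcongr; exact hvb j
    calc ((j:ℝ) + 1) * v j ^ 2 ≤ ((j:ℝ) + 1) * (2 * π * ρ ^ j) ^ 2 := by gcongr
      _ = _ := by rw [← pow_mul, mul_comm 2 j, pow_mul]; ring

end TOP

namespace TOP
open MeasureTheory

theorem exists_data : ∃ μ ∈ II, 19 / 2 < μ ∧ ∃ a : ℕ → ℝ, ∃ N : ℝ → ℝ,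
    Summable (fun j => |a j|) ∧ 0 < a 0 ∧ MemLp N 2 MM ∧ (∀ s, 0 ≤ N s) ∧ (∀ s, 0 ≤ gg a s) ∧
    (∀ s, gg a s ≠ 0 → N s = 0) ∧
    (∀ j : ℕ, ∫ s, cos ((9 * j : ℕ) * s) * N s ∂MM = π * ww j * (a j / EE j μ)) ∧
    (∀ m : ℕ, ¬ 9 ∣ m → ∫ s, cos (m * s) * N s ∂MM = 0) ∧
    (∀ m : ℕ, ∫ s, sin (m * s) * N s ∂MM = 0) := by
  obtain ⟨μ, hμ, hμl, a, ha1, hcone, hreg, hQ, hB⟩ := exists_min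
  refine ⟨μ, hμ, hμl, a, ?_⟩
  have hsum : Summable (fun j => |a j|) := by
    have h3 : Summable (fun j : ℕ => 1 / ((j : ℝ) + 1) ^ 3) := by
      have := (summable_nat_add_iff 1).2 (Real.summable_one_div_nat_pow (p := 3).2 (by norm_num))
      simpa using this
    refine Summable.of_nonneg_of_le (fun j => abs_nonneg _) (fun j => ?_) (hreg.add h3)
    have hx : (0:ℝ) < ((j : ℝ) + 1) ^ 3 := by positivity
    set x := ((j : ℝ) + 1) ^ 3
    rw [← sq_abs (a j)]
    have : x * |a j| ^ 2 + 1 / x - |a j| = ((x * |a j| - 1/2) ^ 2 + 3 / 4) / x := by field_simp; ring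
    have : 0 ≤ ((x * |a j| - 1/2) ^ 2 + 3 / 4) / x := by positivity
    linarith
  have ha0 : 0 < a 0 := by
    have := hcone.2
    have h1 : |a 1| = 1 := by rw [← sq_eq_sq₀ (abs_nonneg _) zero_le_one, sq_abs, ha1]; norm_num
    linarith
  set ν : ℕ → ℝ := fun j => a j / EE j μ with hν
  have hν2 : Summable (fun j => ν j ^ 2) := by
    obtain ⟨A, B, hA, hB, hAB⟩ := EE_bounds
    refine Summable.of_norm_bounded_eventually (hreg.mul_left (1 / A ^ 2)) ?_
    filter_upwards [(Set.finite_singleton 1).compl_mem_cofinite] with j hj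
    have hj' : j ≠ 1 := by simpa using hj
    have h1 := (hAB μ hμ j hj').1
    have hp := EE_pos hμ hj'
    have hj1 : (1:ℝ) ≤ (j:ℝ) + 1 := by linarith [Nat.cast_nonneg (α := ℝ) j]
    rw [Real.norm_eq_abs, abs_of_nonneg (by positivity), hν]
    simp only [div_pow]
    have h0 : (0:ℝ) < (j:ℝ) + 1 := by positivity
    calc a j ^ 2 / EE j μ ^ 2 ≤ a j ^ 2 / (A / ((j:ℝ) + 1)) ^ 2 := by gcongr
      _ = 1 / A ^ 2 * (((j:ℝ) + 1) ^ 2 * a j ^ 2) := by field_simp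
      _ ≤ _ := by gcongr; norm_num
  obtain ⟨N, hN, hNs⟩ := exists_density ν hν2
  have hNint : Integrable N MM := hN.integrable (by norm_num)
  have hgN : ∀ᵐ s ∂MM, 0 ≤ N s := by
    refine ae_nonneg_of_forall_setIntegral_nonneg hNint fun A hA _ => ?_
    have hind : MemLp (A.indicator (fun _ => (1:ℝ))) 2 MM := (memLp_const 1).indicator hA
    have hs := hNs _ hind
    have e1 : ∫ s, A.indicator (fun _ => (1:ℝ)) s * N s ∂MM = ∫ s in A, N s ∂MM := by
      rw [← integral_indicator hA]; congr 1; ext s; by_cases h : s ∈ A <;> simp [h]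
    have e2 : ∀ j : ℕ, ∫ s, A.indicator (fun _ => (1:ℝ)) s * cos ((9 * j : ℕ) * s) ∂MM = ∫ s in A, cos ((9 * j : ℕ) * s) ∂MM := by
      intro j
      rw [← integral_indicator hA]; congr 1; ext s; by_cases h : s ∈ A <;> simp [h]
    simp_rw [e1, e2] at hs
    have h1 : Tendsto (fun n : ℕ => ∑' j : ℕ, ν j * (∫ s in A, cos ((9 * j : ℕ) * s) ∂MM) * (1 - 1 / ((n:ℝ) + 1)) ^ j) atTop (nhds (∫ s in A, N s ∂MM)) := by
      rw [← hs.tsum_eq]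
      have hρ : Tendsto (fun n : ℕ => 1 - 1 / ((n:ℝ) + 1)) atTop (nhds 1) := by
        simpa using (tendsto_one_div_add_atTop_nhds_zero_nat (𝕜 := ℝ)).const_sub 1
      refine tendsto_tsum_of_dominated_convergence hs.summable.abs (fun j => ?_) ?_
      · have := ((hρ.pow j).const_mul (ν j * (∫ s in A, cos ((9 * j : ℕ) * s) ∂MM)))
        simpa using this
      · refine Eventually.of_forall fun n j => ?_
        have q1 : (0:ℝ) < (n:ℝ) + 1 := by positivity
        have q2 : 1 / ((n:ℝ) + 1) ≤ 1 := by rw [div_le_one q1]; linarith [Nat.cast_nonneg (α := ℝ) n]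
        have q3 : 0 < 1 / ((n:ℝ) + 1) := by positivity
        have q5 : 0 ≤ 1 - 1 / ((n:ℝ) + 1) := by linarith
        rw [norm_mul, Real.norm_eq_abs, Real.norm_eq_abs, abs_of_nonneg (pow_nonneg q5 j)]
        exact mul_le_of_le_one_right (abs_nonneg _) (pow_le_one₀ q5 (by linarith))
    refine ge_of_tendsto' h1 fun n => ?_
    have q1 : (0:ℝ) < (n:ℝ) + 1 := by positivity
    have q2 : 1 / ((n:ℝ) + 1) ≤ 1 := by rw [div_le_one q1]; linarith [Nat.cast_nonneg (α := ℝ) n]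
    have q3 : 0 < 1 / ((n:ℝ) + 1) := by positivity
    have tc := test_cone A hA (ρ := 1 - 1 / ((n:ℝ) + 1)) (by linarith) (by linarith)
    refine (hB _ tc.1 tc.2).trans (le_of_eq (tsum_congr fun j => ?_))
    simp only [hν]
    have := (ww_pos j).ne'
    have := EE_ne hμ j
    field_simp
  have hg0 := gg_nonneg hsum hcone
  have hgc := gg_cont hsum
  have hgN0 : ∀ᵐ s ∂MM, gg a s * N s = 0 := by
    have h1 := hNs _ (cont_memLp hgc)
    have h2 : ∫ s, gg a s * N s ∂MM = 0 := by
      have h3 : HasSum (fun j => ν j * ∫ s, gg a s * cos ((9 * j : ℕ) * s) ∂MM) 0 := by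
        have := hQ.mul_left π
        rw [mul_zero] at this
        have e : (fun j => ν j * ∫ s, gg a s * cos ((9 * j : ℕ) * s) ∂MM) = fun j => π * (ww j / EE j μ * a j ^ 2) := by
          funext j
          rw [gg_int hsum]; simp only [hν]; ring
        rw [e]; exact this
      exact h1.unique h3
    have h4 : Integrable (fun s => gg a s * N s) MM := by
      exact (MemLp.integrable_mul (p := 2) (q := 2) (cont_memLp hgc) hN)
    have h5 := (integral_eq_zero_iff_of_nonneg_ae (by filter_upwards [hgN] with s hs using mul_nonneg (hg0 s) hs) h4).1 h2
    exact h5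
  -- modification
  set T : Set ℝ := {s | gg a s = 0} with hT
  have hTm : MeasurableSet T := (isClosed_eq hgc continuous_const).measurableSet
  set N' : ℝ → ℝ := T.indicator (fun s => max (N s) 0) with hN'
  have hae : N' =ᵐ[MM] N := by
    filter_upwards [hgN, hgN0] with s h1 h2
    simp only [hN']
    by_cases h : s ∈ T
    · rw [indicator_of_mem h, max_eq_left h1]
    · rw [indicator_of_notMem h]
      rcases mul_eq_zero.1 h2 with h3 | h3
      · exact absurd h3 h
      · exact h3.symm
  have hint : ∀ h : ℝ → ℝ, ∫ s, h s * N' s ∂MM = ∫ s, h s * N s ∂MM := by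
    intro h
    refine integral_congr_ae ?_
    filter_upwards [hae] with s hs
    rw [hs]
  refine ⟨N', hsum, ha0, (memLp_congr_ae hae).2 hN, ?_, hg0, ?_, ?_, ?_, ?_⟩
  · intro s; exact indicator_nonneg (fun s _ => le_max_right _ _) s
  · intro s hs; exact indicator_of_notMem hs _
  · intro j
    rw [hint]
    have h1 := hNs _ (cont_memLp (f := fun s => cos ((9 * j : ℕ) * s)) (by fun_prop))
    rw [← h1.tsum_eq, tsum_eq_single j]
    · rw [int_cos_cos]
      unfold ww
      by_cases hj : j = 0
      · simp [hj, hν]; ring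
      · simp [hj, hν]; ring
    · intro k hk
      rw [int_cos_cos, if_neg (by omega), mul_zero]
  · intro m hm
    rw [hint]
    have h1 := hNs _ (cont_memLp (f := fun s => cos (m * s)) (by fun_prop))
    rw [← h1.tsum_eq]
    convert tsum_zero with k
    rw [int_cos_cos, if_neg, mul_zero]
    rintro rfl; exact hm ⟨k, rfl⟩
  · intro m
    rw [hint]
    have h1 := hNs _ (cont_memLp (f := fun s => sin (m * s)) (by fun_prop))
    rw [← h1.tsum_eq]
    convert tsum_zero with k
    rw [int_sin_cos, mul_zero]

end TOP

namespace TOP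
open MeasureTheory

/-- The data produced by the variational problem. -/
structure Dat (μ : ℝ) (a : ℕ → ℝ) (N : ℝ → ℝ) : Prop where
  hμ : μ ∈ II
  hμl : 19 / 2 < μ
  hsum : Summable (fun j => |a j|)
  ha0 : 0 < a 0
  hN : MemLp N 2 MM
  N0 : ∀ s, 0 ≤ N s
  g0 : ∀ s, 0 ≤ gg a s
  gN : ∀ s, gg a s ≠ 0 → N s = 0
  c9 : ∀ j : ℕ, ∫ s, cos ((9 * j : ℕ) * s) * N s ∂MM = π * ww j * (a j / EE j μ)
  cn : ∀ m : ℕ, ¬ 9 ∣ m → ∫ s, cos (m * s) * N s ∂MM = 0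
  sn : ∀ m : ℕ, ∫ s, sin (m * s) * N s ∂MM = 0

theorem exists_Dat : ∃ μ a N, Dat μ a N := by
  obtain ⟨μ, h1, h2, a, N, h3, h4, h5, h6, h7, h8, h9, h10, h11⟩ := exists_data
  exact ⟨μ, a, N, ⟨h1, h2, h3, h4, h5, h6, h7, h8, h9, h10, h11⟩⟩

lemma cos_expand (θ : ℝ) (M : ℕ) : ∀ n : ℕ, n ≤ M → ((1 + cos θ) / 2) ^ n =
    bt n 0 + 2 * ∑ m ∈ Finset.range M, bt n (m + 1) * cos ((m + 1 : ℕ) * θ) := by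
  intro n
  induction n with
  | zero =>
    intro _
    rw [Finset.sum_eq_zero]
    · simp [bt]
    · intro m _; rw [bt_zero_of_lt (by omega)]; simp
  | succ n ih =>
    intro hn
    rw [pow_succ, ih (by omega)]
    have hcc : ∀ m : ℕ, cos ((m + 1 : ℕ) * θ) * cos θ = (cos ((m : ℕ) * θ) + cos ((m + 2 : ℕ) * θ)) / 2 := by
      intro m
      have e1 : ((m : ℕ) : ℝ) * θ = (m + 1 : ℕ) * θ - θ := by push_cast; ring
      have e2 : ((m + 2 : ℕ) : ℝ) * θ = (m + 1 : ℕ) * θ + θ := by push_cast; ring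
      rw [e1, e2, cos_sub, cos_add]; ring
    set C : ℕ → ℝ := fun m => cos ((m : ℕ) * θ) with hC
    have hC0 : C 0 = 1 := by simp [hC]
    have hC1 : C 1 = cos θ := by simp [hC]
    have a1 := Finset.sum_range_succ (fun m => bt n m * C (m + 1)) M
    have a2 := Finset.sum_range_succ' (fun m => bt n m * C (m + 1)) M
    have b1 := Finset.sum_range_succ (fun m => bt n (m + 1) * C m) M
    have b2 := Finset.sum_range_succ' (fun m => bt n (m + 1) * C m) M
    rw [bt_zero_of_lt (by omega : n < M)] at a1
    rw [bt_zero_of_lt (by omega : n < M + 1)] at b1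
    have hl : (∑ m ∈ Finset.range M, bt n (m + 1) * C (m + 1)) * cos θ =
        ((∑ m ∈ Finset.range M, bt n (m + 1) * C m) + ∑ m ∈ Finset.range M, bt n (m + 1) * C (m + 2)) / 2 := by
      rw [Finset.sum_mul, ← Finset.sum_add_distrib, Finset.sum_div]
      refine Finset.sum_congr rfl fun m _ => ?_
      rw [mul_assoc]; simp only [hC]; rw [hcc]; ring
    have hrr : ∑ m ∈ Finset.range M, bt (n + 1) (m + 1) * C (m + 1) =
        (∑ m ∈ Finset.range M, bt n (m + 1) * C (m + 1)) / 2 +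
        ((∑ m ∈ Finset.range M, bt n m * C (m + 1)) + ∑ m ∈ Finset.range M, bt n (m + 2) * C (m + 1)) / 4 := by
      rw [← Finset.sum_add_distrib, Finset.sum_div, Finset.sum_div, ← Finset.sum_add_distrib]
      refine Finset.sum_congr rfl fun m _ => ?_
      rw [bt_rec]; ring
    show (bt n 0 + 2 * ∑ m ∈ Finset.range M, bt n (m + 1) * C (m + 1)) * ((1 + cos θ) / 2) =
      bt (n + 1) 0 + 2 * ∑ m ∈ Finset.range M, bt (n + 1) (m + 1) * C (m + 1)
    rw [hrr, bt_rec0]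
    simp only [zero_add, add_assoc, hC0, hC1, zero_mul, add_zero, mul_one] at a1 a2 b1 b2 hl ⊢
    norm_num at a1 a2 b1 b2 hl ⊢
    linear_combination hl + (1/2) * a1 - (1/2) * a2 - (1/2) * b1 + (1/2) * b2

lemma int_cos_shift {m : ℕ} (hm : m ≠ 0) (φ : ℝ) : ∫ s, cos (m * (s - φ)) ∂MM = 0 := by
  have e : ∀ s : ℝ, cos (m * (s - φ)) = cos (m * φ) * cos ((m : ℤ) * s) + sin (m * φ) * sin ((m:ℤ) * s) := by
    intro s
    rw [mul_sub, cos_sub]; push_cast; ring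
  simp_rw [e]
  rw [integral_add (cont_int (by fun_prop)) (cont_int (by fun_prop)), integral_const_mul, integral_const_mul,
    int_sin, int_cos (by exact_mod_cast hm)]; simp

lemma int_pow_cos (n : ℕ) (φ : ℝ) : ∫ s, ((1 + cos (s - φ)) / 2) ^ n ∂MM = 2 * π * bt n 0 := by
  simp_rw [fun s => cos_expand (s - φ) n n le_rfl]
  rw [integral_add (integrable_const _) (cont_int (by fun_prop)), int_const, integral_const_mul,
    integral_finsetSum _ (fun m _ => cont_int (by fun_prop)), Finset.sum_eq_zero]
  · ring
  · intro m _
    rw [integral_const_mul, int_cos_shift (by omega), mul_zero]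

noncomputable def rr (p : Fin 3 → ℝ) : ℝ := √(p 0 ^ 2 + p 1 ^ 2 + p 2 ^ 2)

noncomputable def wf (p : Fin 3 → ℝ) (s : ℝ) : ℝ := (1 + (p 0 * cos s + p 1 * sin s) / rr p) / 2

noncomputable def mom (N : ℝ → ℝ) (n : ℕ) (p : Fin 3 → ℝ) : ℝ := ∫ s, wf p s ^ n * N s ∂MM

noncomputable def uu (μ : ℝ) (N : ℝ → ℝ) (p : Fin 3 → ℝ) : ℝ := rr p ^ μ * ∑' n, cc μ n * mom N n p

lemma polar (x y : ℝ) : ∃ R φ : ℝ, 0 ≤ R ∧ x = R * cos φ ∧ y = R * sin φ := by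
  refine ⟨‖(⟨x, y⟩ : ℂ)‖, Complex.arg ⟨x, y⟩, norm_nonneg _, ?_, ?_⟩
  · exact (Complex.norm_mul_cos_arg (⟨x, y⟩ : ℂ)).symm
  · exact (Complex.norm_mul_sin_arg (⟨x, y⟩ : ℂ)).symm

lemma rr_nonneg (p) : 0 ≤ rr p := sqrt_nonneg _

lemma rr_sq (p) : rr p ^ 2 = p 0 ^ 2 + p 1 ^ 2 + p 2 ^ 2 := by
  unfold rr; rw [sq_sqrt (by positivity)]

lemma rr_pos {p : Fin 3 → ℝ} (hp : p ≠ 0) : 0 < rr p := by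
  unfold rr
  apply sqrt_pos.2
  by_contra h
  apply hp
  have h0 : p 0 = 0 := by nlinarith [sq_nonneg (p 0), sq_nonneg (p 1), sq_nonneg (p 2)]
  have h1 : p 1 = 0 := by nlinarith [sq_nonneg (p 0), sq_nonneg (p 1), sq_nonneg (p 2)]
  have h2 : p 2 = 0 := by nlinarith [sq_nonneg (p 0), sq_nonneg (p 1), sq_nonneg (p 2)]
  ext i; fin_cases i <;> simp [*]

lemma rr_zero : rr 0 = 0 := by simp [rr]

lemma wf_polar (p : Fin 3 → ℝ) : ∃ q φ : ℝ, 0 ≤ q ∧ q ≤ 1 ∧ ∀ s, wf p s = (1 + q * cos (s - φ)) / 2 := by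
  obtain ⟨R, φ, hR, hx, hy⟩ := polar (p 0) (p 1)
  refine ⟨R / rr p, φ, div_nonneg hR (rr_nonneg p), ?_, ?_⟩
  · apply div_le_one_of_le₀ _ (rr_nonneg p)
    unfold rr
    apply le_sqrt_of_sq_le
    rw [hx, hy]
    nlinarith [sin_sq_add_cos_sq φ, sq_nonneg (p 2)]
  · intro s
    unfold wf
    rw [hx, hy, cos_sub]; ring

lemma wf_nonneg (p s) : 0 ≤ wf p s := by
  obtain ⟨q, φ, h0, h1, h⟩ := wf_polar p
  rw [h]; nlinarith [neg_one_le_cos (s - φ)]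

lemma wf_le_one (p s) : wf p s ≤ 1 := by
  obtain ⟨q, φ, h0, h1, h⟩ := wf_polar p
  rw [h]; nlinarith [cos_le_one (s - φ)]

lemma wf_cont (p) : Continuous (wf p) := by unfold wf; fun_prop

lemma int_wf_pow (p : Fin 3 → ℝ) (n : ℕ) : ∫ s, wf p s ^ n ∂MM ≤ 4 * π * bt n 0 := by
  obtain ⟨q, φ, h0, h1, h⟩ := wf_polar p
  have e : 4 * π * bt n 0 = ∫ s, (((1 + cos (s - φ)) / 2) ^ n + ((1 + cos (s - (φ + π))) / 2) ^ n) ∂MM := by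
    rw [integral_add (cont_int (by fun_prop)) (cont_int (by fun_prop)), int_pow_cos, int_pow_cos]; ring
  rw [e]
  refine integral_mono (cont_int ((wf_cont p).pow n)) (cont_int (by fun_prop)) fun s => ?_
  have e2 : cos (s - (φ + π)) = - cos (s - φ) := by
    rw [← sub_sub, cos_sub_pi]
  simp only
  rw [h, e2]
  have a1 := neg_one_le_cos (s - φ)
  have a2 := cos_le_one (s - φ)
  have p1 : 0 ≤ ((1 + cos (s - φ)) / 2) ^ n := pow_nonneg (by linarith) n
  have p2 : 0 ≤ ((1 + -cos (s - φ)) / 2) ^ n := pow_nonneg (by linarith) n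
  rcases le_total 0 (cos (s - φ)) with hc | hc
  · have : ((1 + q * cos (s - φ)) / 2) ^ n ≤ ((1 + cos (s - φ)) / 2) ^ n := by
      apply pow_le_pow_left₀
      · nlinarith
      · nlinarith
    linarith
  · have : ((1 + q * cos (s - φ)) / 2) ^ n ≤ ((1 + -cos (s - φ)) / 2) ^ n := by
      apply pow_le_pow_left₀
      · nlinarith
      · nlinarith
    linarith

lemma Dat.Nint {μ a N} (d : Dat μ a N) : Integrable N MM := d.hN.integrable (by norm_num)

lemma Dat.cint {μ a N} (d : Dat μ a N) {f : ℝ → ℝ} (hf : Continuous f) : Integrable (fun s => f s * N s) MM :=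
  MemLp.integrable_mul (p := 2) (q := 2) (cont_memLp hf) d.hN

lemma mom_nonneg {μ a N} (d : Dat μ a N) (n p) : 0 ≤ mom N n p :=
  integral_nonneg fun s => mul_nonneg (pow_nonneg (wf_nonneg p s) n) (d.N0 s)

/-- constant in the moment bound -/
noncomputable def Cm (N : ℝ → ℝ) : ℝ := 4 * π + ∫ s, N s ^ 2 ∂MM

lemma Cm_pos (N) : 0 < Cm N := by
  unfold Cm
  have := integral_nonneg (μ := MM) (f := fun s => N s ^ 2) (fun s => sq_nonneg _)
  have : 0 ≤ ∫ s, N s ^ 2 ∂MM := this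
  positivity

lemma mom_le {μ a N} (d : Dat μ a N) (n p) : mom N n p ≤ Cm N * ((n:ℝ) + 1) ^ (-(1/4) : ℝ) := by
  set l : ℝ := ((n:ℝ) + 1) ^ ((1/4) : ℝ) with hl
  have hn : (0:ℝ) < (n:ℝ) + 1 := by positivity
  have hlp : 0 < l := rpow_pos_of_pos hn _
  have e1 : ((n:ℝ) + 1) ^ (-(1/4) : ℝ) = l⁻¹ := rpow_neg hn.le _
  have e2 : ((n:ℝ) + 1) ^ (-(1/2) : ℝ) = l⁻¹ * l⁻¹ := by
    rw [← e1, ← rpow_add hn]; norm_num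
  have h2 : Integrable (fun s => N s ^ 2) MM := (memLp_two_iff_integrable_sq d.hN.aestronglyMeasurable).1 d.hN
  have h1 : Integrable (fun s => wf p s ^ (2 * n)) MM := cont_int ((wf_cont p).pow _)
  have : mom N n p ≤ ∫ s, (l * wf p s ^ (2 * n) + l⁻¹ * N s ^ 2) ∂MM := by
    unfold mom
    refine integral_mono (d.cint ((wf_cont p).pow n)) ((h1.const_mul l).add (h2.const_mul _)) fun s => ?_
    simp only
    have hw := pow_nonneg (wf_nonneg p s) n
    have e3 : wf p s ^ (2 * n) = (wf p s ^ n) ^ 2 := by rw [mul_comm, pow_mul]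
    rw [e3]
    set x := wf p s ^ n
    have : l * x ^ 2 + l⁻¹ * N s ^ 2 - x * N s = ((l * x - N s / 2) ^ 2 + 3 / 4 * N s ^ 2) / l := by field_simp; ring
    have : 0 ≤ ((l * x - N s / 2) ^ 2 + 3 / 4 * N s ^ 2) / l := by positivity
    linarith
  rw [integral_add (h1.const_mul l) (h2.const_mul _), integral_const_mul, integral_const_mul] at this
  rw [e1]
  have h3 := int_wf_pow p (2 * n)
  have h4 : bt (2 * n) 0 ≤ l⁻¹ * l⁻¹ := by
    rw [← e2]
    refine (bt_le (2 * n) 0).trans ?_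
    apply rpow_le_rpow_of_nonpos hn _ (by norm_num)
    push_cast; linarith [Nat.cast_nonneg (α := ℝ) n]
  calc mom N n p ≤ _ := this
    _ ≤ l * (4 * π * (l⁻¹ * l⁻¹)) + l⁻¹ * ∫ s, N s ^ 2 ∂MM := by
      have : 4 * π * bt (2 * n) 0 ≤ 4 * π * (l⁻¹ * l⁻¹) := by gcongr
      gcongr; linarith
    _ = _ := by unfold Cm; field_simp

lemma cm_bound {μ a N} (d : Dat μ a N) (n p) :
    ‖cc μ n * mom N n p‖ ≤ Bc * Cm N * ((n:ℝ) + 1) ^ (-(5/4) : ℝ) := by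
  have hn : (0:ℝ) < (n:ℝ) + 1 := by positivity
  rw [norm_mul, Real.norm_eq_abs, Real.norm_eq_abs, abs_of_nonneg (mom_nonneg d n p)]
  have h1 := cc_bound d.hμ n
  have h2 := mom_le d n p
  have e : ((n:ℝ) + 1) ^ (-(5/4) : ℝ) = ((n:ℝ) + 1)⁻¹ * ((n:ℝ) + 1) ^ (-(1/4) : ℝ) := by
    rw [← rpow_neg_one, ← rpow_add hn]; norm_num
  have := Bc_pos
  calc |cc μ n| * mom N n p ≤ (Bc / ((n:ℝ) + 1)) * (Cm N * ((n:ℝ) + 1) ^ (-(1/4) : ℝ)) := by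
        gcongr; exact mom_nonneg d n p
    _ = _ := by rw [e]; ring

lemma cm_sum {N : ℝ → ℝ} : Summable (fun n : ℕ => Bc * Cm N * ((n:ℝ) + 1) ^ (-(5/4) : ℝ)) :=
  (summable_rp (by norm_num)).mul_left _

lemma cm_summable {μ a N} (d : Dat μ a N) (p) : Summable (fun n => cc μ n * mom N n p) :=
  Summable.of_norm_bounded cm_sum (fun n => cm_bound d n p)

lemma rr_cont : Continuous rr := by unfold rr; fun_prop

lemma mom_contOn {μ a N} (d : Dat μ a N) (n : ℕ) : ContinuousOn (mom N n) {0}ᶜ := by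
  intro p hp
  refine ContinuousAt.continuousWithinAt ?_
  unfold mom
  refine continuousAt_of_dominated (bound := fun s => N s) ?_ ?_ d.Nint ?_
  · exact Eventually.of_forall fun p => (d.cint ((wf_cont p).pow n)).aestronglyMeasurable
  · refine Eventually.of_forall fun p => Eventually.of_forall fun s => ?_
    rw [norm_mul, Real.norm_eq_abs, Real.norm_eq_abs, abs_of_nonneg (d.N0 s), abs_of_nonneg (pow_nonneg (wf_nonneg p s) n)]
    exact mul_le_of_le_one_left (d.N0 s) (pow_le_one₀ (wf_nonneg p s) (wf_le_one p s))
  · refine Eventually.of_forall fun s => ?_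
    have : ContinuousAt (fun p => wf p s) p := by
      unfold wf
      have := rr_cont.continuousAt (x := p)
      have h0 : rr p ≠ 0 := (rr_pos hp).ne'
      fun_prop (disch := assumption)
    exact (this.pow n).mul continuousAt_const

lemma sum_contOn {μ a N} (d : Dat μ a N) : ContinuousOn (fun p => ∑' n, cc μ n * mom N n p) {0}ᶜ :=
  continuousOn_tsum (fun n => continuousOn_const.mul (mom_contOn d n)) cm_sum (fun n p _ => cm_bound d n p)

lemma uu_abs {μ a N} (d : Dat μ a N) : ∃ C, ∀ p, |uu μ N p| ≤ C * rr p ^ μ := by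
  refine ⟨∑' n : ℕ, Bc * Cm N * ((n:ℝ) + 1) ^ (-(5/4) : ℝ), fun p => ?_⟩
  unfold uu
  rw [abs_mul, abs_of_nonneg (rpow_nonneg (rr_nonneg p) _), mul_comm]
  refine mul_le_mul_of_nonneg_right ?_ (rpow_nonneg (rr_nonneg p) _)
  exact tsum_of_norm_bounded cm_sum.hasSum (fun n => cm_bound d n p)

lemma mu_pos {μ a N} (d : Dat μ a N) : 0 < μ := by have := d.hμl; linarith

lemma uu_zero {μ a N} (d : Dat μ a N) : uu μ N 0 = 0 := by
  unfold uu; rw [rr_zero, zero_rpow (mu_pos d).ne', zero_mul]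

lemma uu_cont {μ a N} (d : Dat μ a N) : Continuous (uu μ N) := by
  rw [continuous_iff_continuousAt]
  intro p
  by_cases hp : p = 0
  · subst hp
    obtain ⟨C, hC⟩ := uu_abs d
    unfold ContinuousAt
    rw [uu_zero d]
    have : Tendsto (fun p => C * rr p ^ μ) (nhds 0) (nhds 0) := by
      have h : Continuous (fun p => C * rr p ^ μ) := by
        exact continuous_const.mul (rr_cont.rpow_const fun _ => Or.inr (mu_pos d).le)
      have h2 := h.tendsto 0
      rwa [rr_zero, zero_rpow (mu_pos d).ne', mul_zero] at h2
    exact squeeze_zero_norm hC this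
  · have h1 : ContinuousAt (fun p => rr p ^ μ) p := (rr_cont.continuousAt).rpow_const (Or.inl (rr_pos hp).ne')
    exact h1.mul ((sum_contOn d).continuousAt (isOpen_compl_singleton.mem_nhds hp))

lemma rr_smul {r : ℝ} (hr : 0 < r) (p) : rr (r • p) = r * rr p := by
  unfold rr
  simp only [Pi.smul_apply, smul_eq_mul]
  have : (r * p 0) ^ 2 + (r * p 1) ^ 2 + (r * p 2) ^ 2 = r ^ 2 * (p 0 ^ 2 + p 1 ^ 2 + p 2 ^ 2) := by ring
  rw [this, sqrt_mul (by positivity), sqrt_sq hr.le]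

lemma wf_smul {r : ℝ} (hr : 0 < r) (p s) : wf (r • p) s = wf p s := by
  unfold wf
  rw [rr_smul hr]
  simp only [Pi.smul_apply, smul_eq_mul]
  rw [mul_assoc, mul_assoc, ← mul_add, mul_div_mul_left _ _ hr.ne']

lemma uu_smul (μ N) {r : ℝ} (hr : 0 < r) (p) : uu μ N (r • p) = r ^ μ * uu μ N p := by
  unfold uu mom
  simp_rw [wf_smul hr, rr_smul hr]
  rw [mul_rpow hr.le (rr_nonneg p), mul_assoc]

lemma uu_symm (μ N) (p : Fin 3 → ℝ) : uu μ N (Function.update p 2 (-(p 2))) = uu μ N p := by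
  have h1 : rr (Function.update p 2 (-(p 2))) = rr p := by
    unfold rr; simp
  have h2 : ∀ s, wf (Function.update p 2 (-(p 2))) s = wf p s := by
    intro s; unfold wf; rw [h1]; simp
  unfold uu mom
  simp_rw [h1, h2]

end TOP

namespace TOP
open MeasureTheory

lemma int_cos_N {μ a N} (d : Dat μ a N) (m : ℕ) (φ : ℝ) :
    ∫ s, cos (m * (s - φ)) * N s ∂MM = cos (m * φ) * ∫ s, cos (m * s) * N s ∂MM := by
  have e : ∀ s : ℝ, cos (m * (s - φ)) * N s = cos (m * φ) * (cos (m * s) * N s) + sin (m * φ) * (sin (m * s) * N s) := by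
    intro s
    rw [mul_sub, cos_sub]; ring
  simp_rw [e]
  rw [integral_add ((d.cint (by fun_prop)).const_mul _) ((d.cint (by fun_prop)).const_mul _), integral_const_mul, integral_const_mul, d.sn]
  ring

/-- density coefficients -/
noncomputable def nu (μ : ℝ) (a : ℕ → ℝ) (j : ℕ) : ℝ := a j / EE j μ

lemma mom_plane {μ a N} (d : Dat μ a N) {p : Fin 3 → ℝ} {φ : ℝ} (hp : ∀ s, wf p s = (1 + cos (s - φ)) / 2) (n : ℕ) :
    mom N n p = ∑' j : ℕ, bt n (9 * j) * (2 * π * nu μ a j * cos ((9 * j : ℕ) * φ)) := by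
  set f : ℕ → ℝ := fun m => (if m = 0 then 1 else 2) * (bt n m * (cos (m * φ) * ∫ s, cos (m * s) * N s ∂MM)) with hf
  have h1 : mom N n p = ∑' m, f m := by
    rw [tsum_eq_sum (s := Finset.range (n + 1)), Finset.sum_range_succ']
    · unfold mom
      have e : ∀ s, wf p s ^ n * N s = bt n 0 * N s +
          ∑ m ∈ Finset.range n, 2 * bt n (m + 1) * (cos ((m + 1 : ℕ) * (s - φ)) * N s) := by
        intro s
        rw [hp, cos_expand (s - φ) n n le_rfl, add_mul, mul_assoc, Finset.sum_mul, Finset.mul_sum]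
        congr 1
        refine Finset.sum_congr rfl fun m _ => by ring
      simp_rw [e]
      rw [integral_add (d.Nint.const_mul _) (integrable_finsetSum _ fun m _ => (d.cint (by fun_prop)).const_mul _),
        integral_finsetSum _ (fun m _ => (d.cint (by fun_prop)).const_mul _), integral_const_mul, add_comm]
      congr 1
      · refine Finset.sum_congr rfl fun m _ => ?_
        rw [integral_const_mul, int_cos_N d]
        simp only [hf]
        rw [if_neg (by omega)]; ring
      · simp [hf]
    · intro m hm
      simp only [hf]
      rw [bt_zero_of_lt (by simp at hm; omega)]; ring
  have inj : Function.Injective (fun j : ℕ => 9 * j) := fun i j h => by simpa using h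
  rw [h1, ← inj.tsum_eq (f := f)]
  · refine tsum_congr fun j => ?_
    simp only [hf]
    rw [d.c9 j]
    unfold nu ww
    by_cases hj : j = 0
    · subst hj; rw [if_pos (by norm_num), if_pos rfl]; ring
    · have : 9 * j ≠ 0 := by omega
      rw [if_neg this, if_neg hj]; ring
  · intro m hm
    by_contra h
    apply hm
    simp only [hf]
    rw [d.cn m]
    · ring
    · rintro ⟨k, hk⟩; exact h ⟨k, hk.symm⟩

lemma EE_abs_hasSum {μ : ℝ} (h : μ ∈ II) {j : ℕ} (hj : 2 ≤ j) :
    HasSum (fun n => |cc μ n * bt n (9 * j)|) (EE j μ) := by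
  have h1 := (cb_summable h (9 * j)).hasSum
  have e : (fun n => |cc μ n * bt n (9 * j)|) = fun n => cc μ n * bt n (9 * j) := by
    funext n
    apply abs_of_nonneg
    by_cases hn : n < 9 * j
    · rw [bt_zero_of_lt hn, mul_zero]
    · exact mul_nonneg (cc_pos h (by omega)).le (bt_nonneg _ _)
  rw [e]; exact h1

lemma sum_plane {μ a N} (d : Dat μ a N) {p : Fin 3 → ℝ} {φ : ℝ} (hp : ∀ s, wf p s = (1 + cos (s - φ)) / 2) :
    ∑' n, cc μ n * mom N n p = 2 * π * gg a φ := by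
  set F : ℕ × ℕ → ℝ := fun x => (cc μ x.2 * bt x.2 (9 * x.1)) * (2 * π * nu μ a x.1 * cos ((9 * x.1 : ℕ) * φ)) with hF
  have hs : Summable F := by
    apply Summable.of_norm
    rw [summable_prod_of_nonneg (fun _ => norm_nonneg _)]
    refine ⟨fun j => ?_, ?_⟩
    · have q := ((cb_summable d.hμ (9 * j)).mul_right (2 * π * nu μ a j * cos ((9 * j : ℕ) * φ))).norm
      exact q
    · refine Summable.of_norm_bounded_eventually (d.hsum.mul_left (2 * π)) ?_
      filter_upwards [((Set.finite_singleton 1).union (Set.finite_singleton 0)).compl_mem_cofinite] with j hj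
      have hj' : 2 ≤ j := by simp at hj; omega
      have hp := EE_pos d.hμ (j := j) (by omega)
      simp only [hF, norm_mul, Real.norm_eq_abs]
      simp_rw [← abs_mul (cc μ _)]
      rw [tsum_mul_right, (EE_abs_hasSum d.hμ hj').tsum_eq]
      unfold nu
      simp only [abs_mul, abs_div, abs_abs, abs_of_pos hp, abs_of_pos pi_pos, Nat.abs_ofNat]
      have := abs_cos_le_one ((9 * j : ℕ) * φ)
      calc EE j μ * (2 * π * (|a j| / EE j μ) * |cos ((9 * j : ℕ) * φ)|) = 2 * π * |a j| * |cos ((9 * j : ℕ) * φ)| := by field_simp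
        _ ≤ 2 * π * |a j| * 1 := by gcongr
        _ = _ := by ring
  have e1 : ∑' n, cc μ n * mom N n p = ∑' n, ∑' j, F (j, n) := by
    refine tsum_congr fun n => ?_
    rw [mom_plane d hp, ← tsum_mul_left]
    refine tsum_congr fun j => ?_
    simp only [hF]; ring
  rw [e1, hs.tsum_comm]
  unfold gg
  rw [← tsum_mul_left]
  refine tsum_congr fun j => ?_
  simp only [hF]
  rw [tsum_mul_right]
  have : ∑' n, cc μ n * bt n (9 * j) = EE j μ := rfl
  rw [this]
  unfold nu
  have := EE_ne d.hμ j
  field_simp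

lemma wf_plane {p : Fin 3 → ℝ} {R φ : ℝ} (hR : 0 < R) (h0 : p 0 = R * cos φ) (h1 : p 1 = R * sin φ) (h2 : p 2 = 0) (s : ℝ) :
    wf p s = (1 + cos (s - φ)) / 2 := by
  have : rr p = R := by
    unfold rr; rw [h0, h1, h2]
    have : (R * cos φ) ^ 2 + (R * sin φ) ^ 2 + 0 ^ 2 = R ^ 2 := by nlinarith [sin_sq_add_cos_sq φ]
    rw [this, sqrt_sq hR.le]
  unfold wf
  rw [this, h0, h1, cos_sub]
  field_simp

lemma rr_plane {p : Fin 3 → ℝ} {R φ : ℝ} (hR : 0 ≤ R) (h0 : p 0 = R * cos φ) (h1 : p 1 = R * sin φ) (h2 : p 2 = 0) :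
    rr p = R := by
  unfold rr; rw [h0, h1, h2]
  have : (R * cos φ) ^ 2 + (R * sin φ) ^ 2 + 0 ^ 2 = R ^ 2 := by nlinarith [sin_sq_add_cos_sq φ]
  rw [this, sqrt_sq hR]

lemma uu_plane {μ a N} (d : Dat μ a N) {p : Fin 3 → ℝ} {R φ : ℝ} (hR : 0 ≤ R)
    (h0 : p 0 = R * cos φ) (h1 : p 1 = R * sin φ) (h2 : p 2 = 0) :
    uu μ N p = R ^ μ * (2 * π * gg a φ) := by
  rcases hR.eq_or_lt with h | h
  · unfold uu
    rw [rr_plane hR h0 h1 h2, ← h, zero_rpow (mu_pos d).ne']; ring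
  · unfold uu
    rw [rr_plane hR h0 h1 h2, sum_plane d (wf_plane h h0 h1 h2)]

lemma uu_nonneg {μ a N} (d : Dat μ a N) {p : Fin 3 → ℝ} (h2 : p 2 = 0) : 0 ≤ uu μ N p := by
  obtain ⟨R, φ, hR, hx, hy⟩ := polar (p 0) (p 1)
  rw [uu_plane d hR hx hy h2]
  have := d.g0 φ
  have := rpow_nonneg hR μ
  positivity

lemma uu_ne {μ a N} (d : Dat μ a N) : uu μ N ≠ 0 := by
  intro h
  have hg : ∀ φ, gg a φ = 0 := by
    intro φ
    have h1 := uu_plane d (p := ![cos φ, sin φ, 0]) (R := 1) (φ := φ) zero_le_one (by simp) (by simp) (by simp)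
    rw [h] at h1
    simp at h1
    exact h1
  have h1 := gg_int d.hsum 0
  simp_rw [hg] at h1
  simp [ww] at h1
  exact absurd h1 d.ha0.ne'

end TOP

namespace TOP
open MeasureTheory

/-- the generating function -/
noncomputable def F0 (μ w : ℝ) : ℝ := ∑' n : ℕ, cc μ n * w ^ n
noncomputable def F1 (μ w : ℝ) : ℝ := ∑' n : ℕ, cc μ n * (n * w ^ (n - 1))
noncomputable def F2 (μ w : ℝ) : ℝ := ∑' n : ℕ, cc μ n * (n * ((n - 1 : ℕ) * w ^ (n - 1 - 1)))

lemma cc_le {μ : ℝ} (h : μ ∈ II) (n : ℕ) : |cc μ n| ≤ Bc := by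
  refine (cc_bound h n).trans ?_
  apply div_le_self Bc_pos.le
  have : (0:ℝ) ≤ n := Nat.cast_nonneg n
  linarith

lemma geo0 {r : ℝ} (h0 : 0 ≤ r) (h1 : r < 1) : Summable (fun n : ℕ => Bc * r ^ n) :=
  (summable_geometric_of_lt_one h0 h1).mul_left _

lemma geo1 {r : ℝ} (h0 : 0 ≤ r) (h1 : r < 1) : Summable (fun n : ℕ => Bc * (n * r ^ (n - 1))) := by
  apply Summable.mul_left
  rw [← summable_nat_add_iff 1]
  have := (summable_pow_mul_geometric_of_norm_lt_one 1 (r := r) (by rwa [norm_of_nonneg h0])).add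
    (summable_geometric_of_lt_one h0 h1)
  refine this.congr fun n => ?_
  push_cast; simp; ring

lemma geo2 {r : ℝ} (h0 : 0 ≤ r) (h1 : r < 1) :
    Summable (fun n : ℕ => Bc * (n * ((n - 1 : ℕ) * r ^ (n - 1 - 1)))) := by
  apply Summable.mul_left
  rw [← summable_nat_add_iff 2]
  have h : ‖r‖ < 1 := by rwa [norm_of_nonneg h0]
  have := ((summable_pow_mul_geometric_of_norm_lt_one 2 h).add
    ((summable_pow_mul_geometric_of_norm_lt_one 1 h).mul_left 3)).add
    ((summable_geometric_of_lt_one h0 h1).mul_left 2)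
  refine this.congr fun n => ?_
  have e : n + 2 - 1 = n + 1 := rfl
  have e2 : n + 1 - 1 = n := rfl
  rw [e, e2]
  push_cast; ring

lemma F0_deriv {μ : ℝ} (h : μ ∈ II) {w : ℝ} (hw : |w| < 1) : HasDerivAt (F0 μ) (F1 μ w) w := by
  obtain ⟨r, hr, hr1⟩ := exists_between hw
  have h0 : 0 < r := (abs_nonneg w).trans_lt hr
  have := hasDerivAt_tsum_of_isPreconnected (u := fun n : ℕ => Bc * (n * r ^ (n - 1)))
    (g := fun (n : ℕ) w => cc μ n * w ^ n) (g' := fun (n : ℕ) w => cc μ n * (n * w ^ (n - 1)))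
    (t := Ioo (-r) r) (y₀ := 0) (y := w) (geo1 h0.le hr1) isOpen_Ioo isPreconnected_Ioo
    (fun n y _ => (hasDerivAt_pow n y).const_mul _) ?_ ⟨by linarith, by linarith⟩ ?_ ?_
  · exact this
  · intro n y hy
    rw [norm_mul, norm_mul, norm_pow, Real.norm_eq_abs, Real.norm_eq_abs, Real.norm_eq_abs, Nat.abs_cast]
    have : |y| ≤ r := abs_le.2 ⟨hy.1.le, hy.2.le⟩
    have := cc_le h n
    have := Bc_pos
    gcongr
  · apply summable_of_ne_finset_zero (s := {0})
    intro n hn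
    simp at hn
    simp [hn]
  · exact abs_lt.1 hr

lemma F1_deriv {μ : ℝ} (h : μ ∈ II) {w : ℝ} (hw : |w| < 1) : HasDerivAt (F1 μ) (F2 μ w) w := by
  obtain ⟨r, hr, hr1⟩ := exists_between hw
  have h0 : 0 < r := (abs_nonneg w).trans_lt hr
  have := hasDerivAt_tsum_of_isPreconnected (u := fun n : ℕ => Bc * (n * ((n - 1 : ℕ) * r ^ (n - 1 - 1))))
    (g := fun (n : ℕ) w => cc μ n * (n * w ^ (n - 1))) (g' := fun (n : ℕ) w => cc μ n * (n * ((n - 1 : ℕ) * w ^ (n - 1 - 1))))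
    (t := Ioo (-r) r) (y₀ := 0) (y := w) (geo2 h0.le hr1) isOpen_Ioo isPreconnected_Ioo
    (fun n y _ => ((hasDerivAt_pow (n-1) y).const_mul _).const_mul _) ?_ ⟨by linarith, by linarith⟩ ?_ ?_
  · exact this
  · intro n y hy
    rw [norm_mul, norm_mul, norm_mul, norm_pow, Real.norm_eq_abs, Real.norm_eq_abs, Real.norm_eq_abs, Real.norm_eq_abs, Nat.abs_cast, Nat.abs_cast]
    have : |y| ≤ r := abs_le.2 ⟨hy.1.le, hy.2.le⟩
    have := cc_le h n
    have := Bc_pos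
    gcongr
  · apply summable_of_ne_finset_zero (s := {0, 1})
    intro n hn
    simp at hn
    have : n - 1 ≠ 0 := by omega
    simp [this]
  · exact abs_lt.1 hr

lemma F_ode {μ : ℝ} (h : μ ∈ II) {w : ℝ} (hw : |w| < 1) :
    w * (1 - w) * F2 μ w + (1 - 2 * w) * F1 μ w + μ * (μ + 1) * F0 μ w = 0 := by
  have a0 := abs_nonneg w
  have s0 : Summable (fun n : ℕ => cc μ n * w ^ n) := by
    refine Summable.of_norm_bounded (geo0 a0 hw) fun n => ?_
    rw [norm_mul, norm_pow, Real.norm_eq_abs, Real.norm_eq_abs]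
    have := cc_le h n
    gcongr
  have s1 : Summable (fun n : ℕ => cc μ n * (n * w ^ (n - 1))) := by
    refine Summable.of_norm_bounded (geo1 a0 hw) fun n => ?_
    rw [norm_mul, norm_mul, norm_pow, Real.norm_eq_abs, Real.norm_eq_abs, Real.norm_eq_abs, Nat.abs_cast]
    have := cc_le h n
    have := Bc_pos
    gcongr
  have s2 : Summable (fun n : ℕ => cc μ n * (n * ((n - 1 : ℕ) * w ^ (n - 1 - 1)))) := by
    refine Summable.of_norm_bounded (geo2 a0 hw) fun n => ?_
    rw [norm_mul, norm_mul, norm_mul, norm_pow, Real.norm_eq_abs, Real.norm_eq_abs, Real.norm_eq_abs, Real.norm_eq_abs, Nat.abs_cast, Nat.abs_cast]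
    have := cc_le h n
    have := Bc_pos
    gcongr
  have H0 : HasSum _ (F0 μ w) := s0.hasSum
  have H1 : HasSum _ (F1 μ w) := s1.hasSum
  have H2 : HasSum _ (F2 μ w) := s2.hasSum
  have A := (H2.mul_left w).add H1
  have A' := (hasSum_nat_add_iff' 1).2 A
  have B := (((H2.mul_left (w * w)).add (H1.mul_left (2 * w))).sub (H0.mul_left (μ * (μ + 1))))
  have := A'.sub B
  have z : ∀ n : ℕ, (fun n : ℕ => w * (cc μ n * (n * ((n - 1 : ℕ) * w ^ (n - 1 - 1)))) + cc μ n * (n * w ^ (n - 1))) (n + 1)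
     - (w * w * (cc μ n * (n * ((n - 1 : ℕ) * w ^ (n - 1 - 1)))) + 2 * w * (cc μ n * (n * w ^ (n - 1))) - μ * (μ + 1) * (cc μ n * w ^ n)) = 0 := by
    intro n
    have e : cc μ (n + 1) * ((n:ℝ) + 1) ^ 2 = cc μ n * qq μ n := by
      rw [cc_succ]; field_simp
    unfold qq at e
    rcases n with _ | _ | n
    · simp at e ⊢; linarith
    · simp at e ⊢; linear_combination w * e
    · have e1 : n + 1 + 1 - 1 = n + 1 := rfl
      have e2 : n + 1 + 1 + 1 - 1 = n + 1 + 1 := rfl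
      have e3 : n + 1 - 1 = n := rfl
      simp only [e1, e2, e3]
      push_cast at e ⊢
      linear_combination w ^ (n + 2) * e
  have u := this.unique ((funext z : _ = fun _ : ℕ => (0:ℝ)) ▸ hasSum_zero)
  simp at u
  linear_combination u

lemma line2 {μ R' R2 W' W2 : ℝ} (h : μ ∈ II) {R R1 W W1 : ℝ → ℝ}
    (hR : ∀ᶠ t in nhds 0, HasDerivAt R (R1 t) t) (hW : ∀ᶠ t in nhds 0, HasDerivAt W (W1 t) t)
    (hR0 : 0 < R 0) (hW0 : |W 0| < 1)
    (hR2 : HasDerivAt R1 R2 0) (hW2 : HasDerivAt W1 W2 0)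
    {ψ : ℝ → ℝ} {D : ℝ} (hψ : ∀ᶠ t in nhds 0, HasDerivAt (fun t => R t ^ μ * F0 μ (W t)) (ψ t) t)
    (hD : HasDerivAt ψ D 0) (hR' : R1 0 = R') (hW' : W1 0 = W') :
    D = R 0 ^ (μ - 2) * ((μ * (μ - 1) * R' ^ 2 + μ * R 0 * R2) * F0 μ (W 0) + 2 * μ * R 0 * R' * W' * F1 μ (W 0)
      + R 0 ^ 2 * (F2 μ (W 0) * W' ^ 2 + F1 μ (W 0) * W2)) := by
  have cR := hR.self_of_nhds.continuousAt
  have cW := hW.self_of_nhds.continuousAt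
  have pR := cR.eventually (lt_mem_nhds hR0)
  have pW := (continuous_abs.continuousAt.comp cW).eventually (gt_mem_nhds hW0)
  have e : ψ =ᶠ[nhds 0] fun t => (R1 t * μ * R t ^ (μ - 1)) * F0 μ (W t) + R t ^ μ * (F1 μ (W t) * W1 t) := by
    filter_upwards [hR, hW, pR, pW, hψ] with t h1 h2 h3 h4 h5
    refine h5.unique ?_
    exact (h1.rpow_const (Or.inl h3.ne')).mul ((F0_deriv h h4).comp t h2)
  have hR1 := hR.self_of_nhds
  have hW1 := hW.self_of_nhds
  have E := hD.congr_of_eventuallyEq e.symm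
  have E2 := (((hR2.mul_const μ).mul (hR1.rpow_const (p := μ - 1) (Or.inl hR0.ne'))).mul ((F0_deriv h hW0).comp 0 hW1)).add
    ((hR1.rpow_const (p := μ) (Or.inl hR0.ne')).mul (((F1_deriv h hW0).comp 0 hW1).mul hW2))
  rw [E.unique E2]
  simp only [Function.comp, Pi.mul_apply]
  rw [hR', hW']
  have r1 : R 0 ^ (μ - 1 - 1) = R 0 ^ (μ - 2) := by ring_nf
  have r2 : R 0 ^ (μ - 1) = R 0 ^ (μ - 2) * R 0 := by
    rw [← rpow_add_one hR0.ne']; ring_nf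
  have r3 : R 0 ^ μ = R 0 ^ (μ - 2) * R 0 ^ 2 := by
    rw [← rpow_natCast, ← rpow_add hR0]; norm_num
  rw [r1, r2, r3]
  ring

end TOP

namespace TOP
open MeasureTheory

lemma rr_contDiffAt {p : Fin 3 → ℝ} (hp : p ≠ 0) : ContDiffAt ℝ 2 rr p := by
  have := rr_pos hp
  unfold rr at this ⊢
  exact ContDiffAt.sqrt (by fun_prop) (sqrt_pos.1 this).ne'

lemma pd_line {f : (Fin 3 → ℝ) → ℝ} {p : Fin 3 → ℝ} (hf : ContDiffAt ℝ 2 f p) (i : Fin 3) :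
    (∀ᶠ t : ℝ in nhds 0, HasDerivAt (fun t : ℝ => f (p + t • Pi.single i 1)) (pd i f (p + t • Pi.single i 1)) t) ∧
    HasDerivAt (fun t : ℝ => pd i f (p + t • Pi.single i 1)) (pd i (pd i f) p) 0 := by
  have hl : ∀ t : ℝ, HasDerivAt (fun t : ℝ => p + t • (Pi.single i 1 : Fin 3 → ℝ)) (Pi.single i 1) t := by
    intro t
    simpa using ((hasDerivAt_id t).smul_const (Pi.single i 1 : Fin 3 → ℝ)).const_add p
  have h0 : p + (0:ℝ) • (Pi.single i 1 : Fin 3 → ℝ) = p := by simp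
  constructor
  · have h1 : ∀ᶠ q in nhds p, ContDiffAt ℝ 2 f q := hf.eventually (by simp)
    have h2 : Tendsto (fun t : ℝ => p + t • (Pi.single i 1 : Fin 3 → ℝ)) (nhds 0) (nhds p) := by
      have := (hl 0).continuousAt.tendsto
      rwa [h0] at this
    filter_upwards [h2.eventually h1] with t ht
    exact (ht.differentiableAt (by norm_num)).hasFDerivAt.comp_hasDerivAt t (hl t)
  · have h1 : DifferentiableAt ℝ (pd i f) p := by
      have : DifferentiableAt ℝ (fderiv ℝ f) p := (hf.fderiv_right (m := 1) (by norm_num)).differentiableAt (by norm_num)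
      exact this.clm_apply (differentiableAt_const _)
    have h2 := h1.hasFDerivAt
    rw [← h0] at h2
    have := h2.comp_hasDerivAt (0:ℝ) (hl 0)
    rw [h0] at this
    exact this

/-- the direction vector -/
noncomputable def ev (s : ℝ) : Fin 3 → ℝ := ![cos s, sin s, 0]

lemma lap_kernel {μ : ℝ} (h : μ ∈ II) {p : Fin 3 → ℝ} (hp : p ≠ 0) {s : ℝ} (hw : wf p s < 1)
    (hG : ContDiffAt ℝ 2 (fun q => rr q ^ μ * F0 μ (wf q s)) p) :
    lap (fun q => rr q ^ μ * F0 μ (wf q s)) p = 0 := by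
  have hr := rr_pos hp
  have hw' : |wf p s| < 1 := abs_lt.2 ⟨by linarith [wf_nonneg p s], hw⟩
  set Y := p 0 * cos s + p 1 * sin s with hY
  have key : ∀ i, pd i (pd i (fun q => rr q ^ μ * F0 μ (wf q s))) p =
      rr p ^ (μ - 2) * ((μ * (μ - 1) * (p i / rr p) ^ 2 + μ * rr p * (1 / rr p - p i ^ 2 / rr p ^ 3)) * F0 μ (wf p s)
      + 2 * μ * rr p * (p i / rr p) * ((ev s i / rr p - Y * p i / rr p ^ 3) / 2) * F1 μ (wf p s)
      + rr p ^ 2 * (F2 μ (wf p s) * ((ev s i / rr p - Y * p i / rr p ^ 3) / 2) ^ 2 +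
        F1 μ (wf p s) * ((- 2 * ev s i * p i / rr p ^ 3 - Y / rr p ^ 3 + 3 * Y * p i ^ 2 / rr p ^ 5) / 2))) := by
    intro i
    obtain ⟨l1, l2⟩ := pd_line hG i
    set R : ℝ → ℝ := fun t => rr (p + t • Pi.single i 1) with hR
    set Yt : ℝ → ℝ := fun t => Y + ev s i * t with hYt
    have h0 : p + (0:ℝ) • (Pi.single i 1 : Fin 3 → ℝ) = p := by simp
    have hRe : ∀ t, R t = √ (rr p ^ 2 + 2 * t * p i + t ^ 2) := by
      intro t
      rw [rr_sq]; simp only [hR]; unfold rr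
      congr 1
      fin_cases i <;> simp <;> ring
    have hR0 : R 0 = rr p := by simp [hR]
    have hWe : ∀ t, wf (p + t • Pi.single i 1) s = (1 + Yt t / R t) / 2 := by
      intro t
      unfold wf
      simp only [hYt, hR, hY, ev]
      congr 3
      fin_cases i <;> simp <;> ring
    have hRd : ∀ t, 0 < R t → HasDerivAt R ((p i + t) / R t) t := by
      intro t ht
      have e : R = fun t => √ (rr p ^ 2 + 2 * t * p i + t ^ 2) := funext hRe
      have ht' := ht
      rw [hRe] at ht' ⊢
      rw [e]
      have b : HasDerivAt (fun t => rr p ^ 2 + 2 * t * p i + t ^ 2) (2 * (p i + t)) t := by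
        refine (((((hasDerivAt_id t).const_mul 2).mul_const (p i)).const_add (rr p ^ 2)).add (hasDerivAt_pow 2 t)).congr_deriv ?_
        norm_num; ring
      refine (b.sqrt (sqrt_pos.1 ht').ne').congr_deriv ?_
      field_simp
    have cR : Continuous R := by
      rw [show R = fun t => √ (rr p ^ 2 + 2 * t * p i + t ^ 2) from funext hRe]; fun_prop
    have pR : ∀ᶠ t in nhds 0, 0 < R t := cR.continuousAt.eventually (lt_mem_nhds (by rw [hR0]; exact hr))
    have hYd : ∀ t, HasDerivAt Yt (ev s i) t := fun t =>
      (((hasDerivAt_id t).const_mul (ev s i)).const_add Y).congr_deriv (mul_one _)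
    have hWd : ∀ t, 0 < R t → HasDerivAt (fun t => (1 + Yt t / R t) / 2) ((ev s i / R t - Yt t * (p i + t) / R t ^ 3) / 2) t := by
      intro t ht
      refine ((((hYd t).div (hRd t ht) ht.ne').const_add 1).div_const 2).congr_deriv ?_
      field_simp
    have hR0' : 0 < R 0 := by rw [hR0]; exact hr
    have a1 : HasDerivAt (fun t => p i + t) 1 (0:ℝ) := (hasDerivAt_id 0).const_add _
    have hR2 : HasDerivAt (fun t => (p i + t) / R t) (1 / rr p - p i ^ 2 / rr p ^ 3) 0 := by
      refine (a1.div (hRd 0 hR0') hR0'.ne').congr_deriv ?_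
      rw [hR0]; field_simp; ring
    have hW2 : HasDerivAt (fun t => (ev s i / R t - Yt t * (p i + t) / R t ^ 3) / 2)
        ((- 2 * ev s i * p i / rr p ^ 3 - Y / rr p ^ 3 + 3 * Y * p i ^ 2 / rr p ^ 5) / 2) 0 := by
      have b1 := (hasDerivAt_const (0:ℝ) (ev s i)).div (hRd 0 hR0') hR0'.ne'
      have b2 := ((hYd 0).mul a1).div ((hRd 0 hR0').pow 3) (pow_pos hR0' 3).ne'
      refine ((b1.sub b2).div_const 2).congr_deriv ?_
      simp only [Pi.mul_apply, Pi.pow_apply]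
      rw [hR0]
      simp only [hYt]
      field_simp
      ring
    have := line2 h (R := R) (W := fun t => (1 + Yt t / R t) / 2)
      (pR.mono hRd) (pR.mono hWd) hR0' (by
        show |(1 + Yt 0 / R 0) / 2| < 1
        rw [← hWe, h0]; exact hw') hR2 hW2 (ψ := fun t => pd i (fun q => rr q ^ μ * F0 μ (wf q s)) (p + t • Pi.single i 1))
      (D := pd i (pd i (fun q => rr q ^ μ * F0 μ (wf q s))) p) ?_ l2 rfl rfl
    · rw [this]
      rw [← hWe, h0, hR0]
      simp only [hYt]
      simp
    · simp only [hWe] at l1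
      exact l1
  have hq := rr_sq p
  have hwe : wf p s = (1 + Y / rr p) / 2 := rfl
  have ode := F_ode h hw'
  have e0 : ev s 0 = cos s := rfl
  have e1 : ev s 1 = sin s := rfl
  have e2 : ev s 2 = 0 := rfl
  have sc := sin_sq_add_cos_sq s
  unfold lap
  rw [Fin.sum_univ_three, key, key, key, e0, e1, e2]
  generalize F0 μ (wf p s) = f0 at *
  generalize F1 μ (wf p s) = f1 at *
  generalize F2 μ (wf p s) = f2 at *
  have A1 : (p 0 / rr p) ^ 2 + (p 1 / rr p) ^ 2 + (p 2 / rr p) ^ 2 = 1 := by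
    field_simp; linarith
  have A2 : (1 / rr p - p 0 ^ 2 / rr p ^ 3) + (1 / rr p - p 1 ^ 2 / rr p ^ 3) + (1 / rr p - p 2 ^ 2 / rr p ^ 3) = 2 / rr p := by
    field_simp; linarith
  have A3 : (p 0 / rr p) * ((cos s / rr p - Y * p 0 / rr p ^ 3) / 2) + (p 1 / rr p) * ((sin s / rr p - Y * p 1 / rr p ^ 3) / 2)
      + (p 2 / rr p) * ((0 / rr p - Y * p 2 / rr p ^ 3) / 2) = 0 := by
    field_simp
    linear_combination rr p ^ 2 * (-hY) + Y * hq
  have A4 : ((cos s / rr p - Y * p 0 / rr p ^ 3) / 2) ^ 2 + ((sin s / rr p - Y * p 1 / rr p ^ 3) / 2) ^ 2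
      + ((0 / rr p - Y * p 2 / rr p ^ 3) / 2) ^ 2 = wf p s * (1 - wf p s) / rr p ^ 2 := by
    rw [hwe]; field_simp
    linear_combination 2 * Y * rr p ^ 2 * hY - Y ^ 2 * hq + rr p ^ 4 * sc
  have A5 : (- 2 * cos s * p 0 / rr p ^ 3 - Y / rr p ^ 3 + 3 * Y * p 0 ^ 2 / rr p ^ 5) / 2 +
      (- 2 * sin s * p 1 / rr p ^ 3 - Y / rr p ^ 3 + 3 * Y * p 1 ^ 2 / rr p ^ 5) / 2 +
      (- 2 * 0 * p 2 / rr p ^ 3 - Y / rr p ^ 3 + 3 * Y * p 2 ^ 2 / rr p ^ 5) / 2 = (1 - 2 * wf p s) / rr p ^ 2 := by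
    rw [hwe]; field_simp
    linear_combination 2 * rr p ^ 2 * hY - 3 * Y * hq
  have hr2 : rr p ^ 2 * (wf p s * (1 - wf p s) / rr p ^ 2) = wf p s * (1 - wf p s) := by field_simp
  have hr3 : rr p ^ 2 * ((1 - 2 * wf p s) / rr p ^ 2) = (1 - 2 * wf p s) := by field_simp
  have hr4 : rr p * (2 / rr p) = 2 := by field_simp
  linear_combination rr p ^ (μ - 2) * (μ * (μ - 1) * f0 * A1 + μ * rr p * f0 * A2 + μ * f0 * hr4 + 2 * μ * rr p * f1 * A3
    + rr p ^ 2 * f2 * A4 + f2 * hr2 + rr p ^ 2 * f1 * A5 + f1 * hr3 + ode)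

end TOP

namespace TOP
open MeasureTheory

/-- the carrier of the density -/
def TT0 (a : ℕ → ℝ) : Set ℝ := {s | s ∈ Icc (-π) π ∧ gg a s = 0}

lemma TT0_closed {μ a N} (d : Dat μ a N) : IsClosed (TT0 a) := by
  have : IsClosed (Icc (-π) π ∩ gg a ⁻¹' {0}) := isClosed_Icc.inter (isClosed_singleton.preimage (gg_cont d.hsum))
  exact this

lemma TT0_compact {μ a N} (d : Dat μ a N) : IsCompact (TT0 a) :=
  isCompact_Icc.of_isClosed_subset (TT0_closed d) fun _ h => h.1

/-- power series in a Banach algebra -/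
lemma ps_contDiffAt {μ : ℝ} (h : μ ∈ II) {A : Type*} [NormedCommRing A] [NormedAlgebra ℝ A] [CompleteSpace A]
    {f : A} (hf : ‖f‖ < 1) : ContDiffAt ℝ 2 (fun f : A => ∑' n, cc μ n • f ^ n) f ∧ HasSum (fun n => cc μ n • f ^ n) (∑' n, cc μ n • f ^ n) := by
  set P := FormalMultilinearSeries.ofScalars A (cc μ) with hP
  have hrad : (1 : ENNReal) ≤ P.radius := by
    have := P.le_radius_of_bound (‖P 0‖ + Bc) (r := 1) ?_
    · simpa using this
    · intro n
      simp only [NNReal.coe_one, one_pow, mul_one]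
      rcases Nat.eq_zero_or_pos n with rfl | hn
      · linarith [Bc_pos]
      · have := FormalMultilinearSeries.ofScalars_norm_le A (cc μ) n hn
        have h2 := cc_le h n
        rw [Real.norm_eq_abs] at this
        linarith [norm_nonneg (P 0)]
  have hb := P.hasFPowerSeriesOnBall (lt_of_lt_of_le one_pos hrad)
  have hmem : f ∈ Metric.eball (0:A) P.radius := by
    refine Metric.eball_subset_eball hrad ?_
    rw [Metric.mem_eball, edist_zero_right]
    rw [← ofReal_norm, ENNReal.ofReal_lt_one]; exact hf
  have e : P.sum = fun f : A => ∑' n, cc μ n • f ^ n := by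
    funext g
    unfold FormalMultilinearSeries.sum
    refine tsum_congr fun n => ?_
    rw [hP, FormalMultilinearSeries.ofScalars_apply_eq]
  constructor
  · rw [← e]
    exact (hb.analyticOnNhd f hmem).contDiffAt
  · have := hb.hasSum (y := f) hmem
    rw [zero_add, e] at this
    simpa [hP, FormalMultilinearSeries.ofScalars_apply_eq] using this

noncomputable def cosT (a : ℕ → ℝ) : C(TT0 a, ℝ) := ⟨fun s => cos s, by fun_prop⟩
noncomputable def sinT (a : ℕ → ℝ) : C(TT0 a, ℝ) := ⟨fun s => sin s, by fun_prop⟩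
noncomputable def Wc (a : ℕ → ℝ) (p : Fin 3 → ℝ) : C(TT0 a, ℝ) :=
  (1 / 2 : ℝ) • (1 : C(TT0 a, ℝ)) + ((p 0 / rr p / 2) • cosT a + (p 1 / rr p / 2) • sinT a)

lemma Wc_apply (a : ℕ → ℝ) (p : Fin 3 → ℝ) (s : TT0 a) : Wc a p s = wf p s := by
  simp [Wc, cosT, sinT, wf]; ring

section
variable {μ : ℝ} {a : ℕ → ℝ} {N : ℝ → ℝ}

lemma N_sub_int (d : Dat μ a N) : Integrable (fun s : TT0 a => N s) (MM.comap Subtype.val) := by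
  have hm := (TT0_closed d).measurableSet
  have h1 : IntegrableOn N (TT0 a) MM := d.Nint.integrableOn
  have := (MeasurableEmbedding.subtype_coe hm).integrable_map_iff (g := N) (μ := MM.comap Subtype.val)
  rw [(MeasurableEmbedding.subtype_coe hm).map_comap, Subtype.range_coe] at this
  exact this.1 h1

lemma gN_sub_int (d : Dat μ a N) (g : C(TT0 a, ℝ)) : Integrable (fun s : TT0 a => g s * N s) (MM.comap Subtype.val) := by
  have := isCompact_iff_compactSpace.1 (TT0_compact d)
  exact (N_sub_int d).bdd_mul (c := ‖g‖) g.continuous.aestronglyMeasurable (Eventually.of_forall fun s => g.norm_coe_le_norm s)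

lemma exists_L (d : Dat μ a N) [CompactSpace (TT0 a)] : ∃ L : C(TT0 a, ℝ) →L[ℝ] ℝ, ∀ g, L g = ∫ s, g s * N s ∂(MM.comap Subtype.val) := by
  refine ⟨LinearMap.mkContinuous (𝕜 := ℝ) (𝕜₂ := ℝ) (σ := RingHom.id ℝ) ⟨⟨fun g : C(TT0 a, ℝ) => ∫ s, g s * N s ∂(MM.comap Subtype.val), ?_⟩, ?_⟩
    (∫ s : TT0 a, N s ∂(MM.comap Subtype.val)) ?_, fun g => rfl⟩
  · intro f g
    rw [← integral_add (gN_sub_int d f) (gN_sub_int d g)]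
    simp [add_mul]
  · intro c g
    simp only [ContinuousMap.smul_apply, smul_eq_mul, mul_assoc, RingHom.id_apply]
    rw [integral_const_mul]
  · intro g
    simp only [LinearMap.coe_mk, AddHom.coe_mk]
    rw [mul_comm, ← integral_const_mul]
    refine norm_integral_le_of_norm_le ((N_sub_int d).const_mul _) (Eventually.of_forall fun s => ?_)
    rw [norm_mul, norm_of_nonneg (d.N0 s)]
    exact mul_le_mul_of_nonneg_right (g.norm_coe_le_norm s) (d.N0 s)

lemma mom_L (d : Dat μ a N) (n : ℕ) (p : Fin 3 → ℝ) :
    ∫ s, (Wc a p ^ n) s * N s ∂(MM.comap Subtype.val) = mom N n p := by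
  have hm := (TT0_closed d).measurableSet
  simp only [ContinuousMap.pow_apply, Wc_apply]
  rw [integral_subtype_comap hm (fun s => wf p s ^ n * N s)]
  unfold mom
  apply setIntegral_eq_integral_of_ae_compl_eq_zero
  unfold MM
  filter_upwards [ae_restrict_mem measurableSet_Ioc] with s hs h
  have : gg a s ≠ 0 := fun h0 => h ⟨⟨hs.1.le, hs.2⟩, h0⟩
  rw [d.gN s this, mul_zero]

lemma cd_smul {A : Type*} [NormedAddCommGroup A] [NormedSpace ℝ A] {f : (Fin 3 → ℝ) → ℝ} {g : (Fin 3 → ℝ) → A}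
    {p : Fin 3 → ℝ} (hf : ContDiffAt ℝ 2 f p) (hg : ContDiffAt ℝ 2 g p) : ContDiffAt ℝ 2 (fun q => f q • g q) p :=
  hf.smul hg

lemma Wc_contDiffAt (d : Dat μ a N) [CompactSpace (TT0 a)] {p : Fin 3 → ℝ} (hp : p ≠ 0) : ContDiffAt ℝ 2 (Wc a) p := by
  have h := rr_contDiffAt hp
  have h0 := (rr_pos hp).ne'
  unfold Wc
  refine contDiffAt_const.add (ContDiffAt.add (cd_smul ?_ contDiffAt_const) (cd_smul ?_ contDiffAt_const))
  · exact (ContDiffAt.div (by fun_prop) h h0).div_const _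
  · exact (ContDiffAt.div (by fun_prop) h h0).div_const _

lemma lap_clm {A : Type*} [NormedAddCommGroup A] [NormedSpace ℝ A] {H : (Fin 3 → ℝ) → A} {p : Fin 3 → ℝ}
    (hH : ContDiffAt ℝ 2 H p) : ∃ K : A, ∀ ℓ : A →L[ℝ] ℝ, lap (fun q => ℓ (H q)) p = ℓ K := by
  refine ⟨∑ i, fderiv ℝ (fun q => fderiv ℝ H q (Pi.single i 1)) p (Pi.single i 1), fun ℓ => ?_⟩
  unfold lap
  rw [map_sum]
  refine Finset.sum_congr rfl fun i _ => ?_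
  have h1 : ∀ᶠ q in nhds p, ContDiffAt ℝ 2 H q := hH.eventually (by simp)
  have e : pd i (fun q => ℓ (H q)) =ᶠ[nhds p] fun q => ℓ (fderiv ℝ H q (Pi.single i 1)) := by
    filter_upwards [h1] with q hq
    unfold pd
    have := (ℓ.hasFDerivAt.comp q (hq.differentiableAt (by norm_num)).hasFDerivAt).fderiv
    have e2 : fderiv ℝ (fun q => ℓ (H q)) q = _ := this
    rw [e2]; rfl
  have h2 : DifferentiableAt ℝ (fun q => fderiv ℝ H q (Pi.single i 1)) p := by
    have : DifferentiableAt ℝ (fderiv ℝ H) p := (hH.fderiv_right (m := 1) (by norm_num)).differentiableAt (by norm_num)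
    exact this.clm_apply (differentiableAt_const _)
  have e3 := (ℓ.hasFDerivAt.comp p h2.hasFDerivAt).fderiv
  have e4 : pd i (pd i (fun q => ℓ (H q))) p = fderiv ℝ (fun q => ℓ (fderiv ℝ H q (Pi.single i 1))) p (Pi.single i 1) := by
    show fderiv ℝ _ p _ = _
    rw [e.fderiv_eq]
  rw [e4]
  have e5 : fderiv ℝ (fun q => ℓ (fderiv ℝ H q (Pi.single i 1))) p = _ := e3
  rw [e5]; rfl

lemma lap_congr {f g : (Fin 3 → ℝ) → ℝ} {p : Fin 3 → ℝ} (h : f =ᶠ[nhds p] g) : lap f p = lap g p := by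
  unfold lap
  refine Finset.sum_congr rfl fun i _ => ?_
  have : pd i f =ᶠ[nhds p] pd i g := by
    filter_upwards [h.eventuallyEq_nhds] with q hq
    unfold pd
    rw [hq.fderiv_eq]
  show fderiv ℝ _ p _ = fderiv ℝ _ p _
  rw [this.fderiv_eq]

lemma uu_periodic_zero (d : Dat μ a N) {p : Fin 3 → ℝ} {s : ℝ} (hp : p ≠ 0) (hs : gg a s = 0) (hw : ¬ wf p s < 1) :
    p 2 = 0 ∧ uu μ N p = 0 := by
  have hr := rr_pos hp
  have h1 : wf p s = 1 := le_antisymm (wf_le_one p s) (not_lt.1 hw)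
  unfold wf at h1
  have h2 : (p 0 * cos s + p 1 * sin s) = rr p := by
    have : (p 0 * cos s + p 1 * sin s) / rr p = 1 := by linarith
    rwa [div_eq_one_iff_eq hr.ne'] at this
  have hq := rr_sq p
  have sc := sin_sq_add_cos_sq s
  have h3 : (p 0 * sin s - p 1 * cos s) ^ 2 + p 2 ^ 2 = 0 := by
    rw [← h2] at hq
    linear_combination -hq + (p 0 ^ 2 + p 1 ^ 2) * sc
  have h4 : p 2 = 0 := by nlinarith [sq_nonneg (p 0 * sin s - p 1 * cos s), sq_nonneg (p 2)]
  have h5 : p 0 * sin s - p 1 * cos s = 0 := by nlinarith [sq_nonneg (p 0 * sin s - p 1 * cos s), sq_nonneg (p 2)]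
  refine ⟨h4, ?_⟩
  rw [uu_plane d hr.le (φ := s) ?_ ?_ h4, hs]
  · ring
  · rw [← h2]; linear_combination (-p 0) * sc + sin s * h5
  · rw [← h2]; linear_combination (-p 1) * sc - cos s * h5

theorem uu_off (d : Dat μ a N) {p : Fin 3 → ℝ} (hp : p ∈ (contactSet (uu μ N) 2)ᶜ) :
    ContDiffAt ℝ 2 (uu μ N) p ∧ lap (uu μ N) p = 0 := by
  have hp0 : p ≠ 0 := by
    rintro rfl
    exact hp ⟨rfl, uu_zero d⟩
  have hr := rr_pos hp0
  have : CompactSpace (TT0 a) := isCompact_iff_compactSpace.1 (TT0_compact d)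
  obtain ⟨L, hL⟩ := exists_L d
  have hW := Wc_contDiffAt d hp0
  have hwlt : ∀ s : TT0 a, wf p s < 1 := by
    intro s
    by_contra h
    exact hp (uu_periodic_zero d hp0 s.2.2 h)
  have hn : ‖Wc a p‖ < 1 := by
    rw [ContinuousMap.norm_lt_iff _ one_pos]
    intro s
    rw [Wc_apply, norm_of_nonneg (wf_nonneg p s)]
    exact hwlt s
  set H : (Fin 3 → ℝ) → C(TT0 a, ℝ) := fun q => rr q ^ μ • ∑' n, cc μ n • Wc a q ^ n with hH
  have hHc : ContDiffAt ℝ 2 H p := by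
    refine cd_smul ?_ ?_
    · exact (rr_contDiffAt hp0).rpow_const_of_ne hr.ne'
    · exact ContDiffAt.comp p (ps_contDiffAt d.hμ hn).1 hW
  have near : ∀ᶠ q in nhds p, ‖Wc a q‖ < 1 :=
    hW.continuousAt.norm.eventually (gt_mem_nhds hn)
  have app : ∀ ℓ : C(TT0 a, ℝ) →L[ℝ] ℝ, ∀ᶠ q in nhds p, ℓ (H q) = rr q ^ μ * ∑' n, cc μ n * ℓ (Wc a q ^ n) := by
    intro ℓ
    filter_upwards [near] with q hq
    simp only [hH]
    rw [map_smul, smul_eq_mul]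
    have := ((ps_contDiffAt d.hμ hq).2.mapL ℓ).tsum_eq
    rw [← this]
    simp
  have eL : uu μ N =ᶠ[nhds p] fun q => L (H q) := by
    filter_upwards [app L] with q hq
    rw [hq]
    unfold uu
    simp_rw [hL, mom_L d]
  have hsm : ContDiffAt ℝ 2 (fun q => L (H q)) p := L.contDiff.contDiffAt.comp p hHc
  refine ⟨hsm.congr_of_eventuallyEq eL, ?_⟩
  obtain ⟨K, hK⟩ := lap_clm hHc
  rw [lap_congr eL, hK]
  have : K = 0 := by
    ext s
    have h1 := hK (ContinuousMap.evalCLM ℝ s)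
    have eS : (fun q => rr q ^ μ * F0 μ (wf q s)) =ᶠ[nhds p] fun q => ContinuousMap.evalCLM ℝ s (H q) := by
      filter_upwards [app (ContinuousMap.evalCLM ℝ s)] with q hq
      rw [hq]
      simp [F0, Wc_apply]
    rw [← lap_congr eS] at h1
    have hc : ContDiffAt ℝ 2 (fun q => ContinuousMap.evalCLM ℝ s (H q)) p :=
      ContDiffAt.comp p (ContinuousMap.evalCLM ℝ s : C(TT0 a, ℝ) →L[ℝ] ℝ).contDiff.contDiffAt hHc
    have h2 := lap_kernel d.hμ hp0 (hwlt s) (hc.congr_of_eventuallyEq eS)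
    rw [h2] at h1
    simpa using h1.symm
  rw [this, map_zero]

end

end TOP

namespace TOP
open MeasureTheory

lemma bn_anti {μ : ℝ} (h : μ ∈ II) (k : ℕ) :
    ((k + 1 + 10 : ℕ) : ℝ) * cc μ (k + 1 + 10) ≤ ((k + 10 : ℕ) : ℝ) * cc μ (k + 10) := by
  have e : k + 1 + 10 = (k + 10) + 1 := by ring
  have hn : 10 ≤ k + 10 := by omega
  rw [e, cc_mul_anti hn]
  have hc := cc_pos h hn
  have hl := lam_bounds h
  have : (0:ℝ) ≤ (k + 10 : ℕ) := Nat.cast_nonneg _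
  have h2 : 0 ≤ μ * (μ + 1) / (((k + 10 : ℕ) : ℝ) * ((k + 10 : ℕ) + 1)) := by
    apply div_nonneg (by linarith); positivity
  exact mul_le_of_le_one_right (by positivity) (by linarith)

lemma bn_mono {μ : ℝ} (h : μ ∈ II) (k : ℕ) :
    ((k + 10 : ℕ) : ℝ) * cc μ (k + 10) - 108 * Bc / ((k + 10 : ℕ) : ℝ) ≤
    ((k + 1 + 10 : ℕ) : ℝ) * cc μ (k + 1 + 10) - 108 * Bc / ((k + 1 + 10 : ℕ) : ℝ) := by
  have e : k + 1 + 10 = (k + 10) + 1 := by ring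
  have hn : 10 ≤ k + 10 := by omega
  rw [e, cc_mul_anti hn]
  have hc := cc_pos h hn
  have hl := lam_bounds h
  have hb := cc_bound h (k + 10)
  rw [abs_of_pos hc, le_div_iff₀ (by positivity)] at hb
  have hB := Bc_pos
  push_cast at hb ⊢
  set n : ℝ := (k:ℝ) + 10 with hnn
  have hn0 : 0 < n := by positivity
  have e3 : 108 * Bc / n - 108 * Bc / (n + 1) = 108 * Bc / (n * (n + 1)) := by field_simp; ring
  have e4 : n * cc μ (k + 10) * (1 - μ * (μ + 1) / (n * (n + 1))) = n * cc μ (k + 10) - (n * cc μ (k+10)) * (μ * (μ + 1)) / (n * (n + 1)) := by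
    field_simp
  have h5 : (n * cc μ (k+10)) * (μ * (μ + 1)) / (n * (n + 1)) ≤ 108 * Bc / (n * (n + 1)) := by
    have : n * cc μ (k + 10) ≤ Bc := by nlinarith
    have : (n * cc μ (k+10)) * (μ * (μ + 1)) ≤ 108 * Bc := by nlinarith [mul_pos hn0 hc]
    exact div_le_div_of_nonneg_right this (by positivity)
  rw [e4]
  linarith

lemma exists_split {μ : ℝ} (h : μ ∈ II) : ∃ C K : ℝ, 0 ≤ C ∧ 0 ≤ K ∧ ∀ n : ℕ, n ≠ 0 → |cc μ n - C / n| ≤ K / (n:ℝ) ^ 2 := by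
  set b : ℕ → ℝ := fun k => ((k + 10 : ℕ) : ℝ) * cc μ (k + 10) with hb
  have hB := Bc_pos
  have b0 : ∀ k, 0 ≤ b k := fun k => mul_nonneg (Nat.cast_nonneg _) (cc_pos h (by omega)).le
  have anti : Antitone b := antitone_nat_of_succ_le (bn_anti h)
  have mono : Monotone (fun k => b k - 108 * Bc / ((k + 10 : ℕ) : ℝ)) := monotone_nat_of_le_succ (bn_mono h)
  have bdd : BddBelow (range b) := ⟨0, by rintro _ ⟨k, rfl⟩; exact b0 k⟩
  set C := ⨅ k, b k with hC
  have C0 : 0 ≤ C := le_ciInf b0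
  refine ⟨C, 108 * Bc + 100 * (Bc + C), C0, by positivity, ?_⟩
  intro n hn
  have hnp : (1:ℝ) ≤ n := by exact_mod_cast Nat.one_le_iff_ne_zero.2 hn
  rcases le_or_gt 10 n with h10 | h10
  · obtain ⟨k, rfl⟩ := Nat.exists_eq_add_of_le' h10
    have h1 : C ≤ b k := ciInf_le bdd k
    have h2 : b k - 108 * Bc / ((k + 10 : ℕ) : ℝ) ≤ C := by
      refine le_ciInf fun m => ?_
      rcases le_total k m with hkm | hkm
      · have := mono hkm
        simp only at this
        have h4 : 0 ≤ 108 * Bc / ((m + 10 : ℕ) : ℝ) := by positivity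
        linarith
      · have := anti hkm
        have h4 : 0 ≤ 108 * Bc / ((k + 10 : ℕ) : ℝ) := by positivity
        linarith
    have e : cc μ (k + 10) - C / ((k + 10 : ℕ):ℝ) = (b k - C) / ((k + 10 : ℕ):ℝ) := by
      simp only [hb]; field_simp
    rw [e, abs_of_nonneg (by apply div_nonneg <;> linarith), div_le_div_iff₀ (by linarith) (by positivity)]
    have h3 : b k - C ≤ 108 * Bc / ((k + 10 : ℕ) : ℝ) := by linarith
    rw [le_div_iff₀ (by linarith)] at h3
    have h5 : 0 ≤ 100 * (Bc + C) := by positivity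
    nlinarith [mul_nonneg h5 (by linarith : (0:ℝ) ≤ ((k + 10 : ℕ) : ℝ))]
  · have h1 : |cc μ n - C / n| ≤ Bc + C := by
      refine (abs_sub _ _).trans ?_
      rw [abs_of_nonneg (by positivity : 0 ≤ C / n)]
      have : C / n ≤ C := div_le_self C0 hnp
      linarith [cc_le h n]
    refine h1.trans ?_
    rw [le_div_iff₀ (by positivity)]
    have : (n:ℝ) ≤ 10 := by exact_mod_cast h10.le
    have h2 : (n:ℝ) ^ 2 ≤ 100 := by nlinarith
    nlinarith

/-- test points above the unit circle -/
noncomputable def pp (φ τ : ℝ) : Fin 3 → ℝ := ![cos φ, sin φ, sinh τ]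

lemma rr_pp (φ τ : ℝ) : rr (pp φ τ) = cosh τ := by
  unfold rr
  have : (pp φ τ 0) ^ 2 + (pp φ τ 1) ^ 2 + (pp φ τ 2) ^ 2 = cosh τ ^ 2 := by
    simp only [pp, Matrix.cons_val_zero, Matrix.cons_val_one, Matrix.cons_val]
    rw [cosh_sq]; linarith [sin_sq_add_cos_sq φ]
  rw [this, sqrt_sq (cosh_pos τ).le]

lemma wf_pp (φ τ s : ℝ) : wf (pp φ τ) s = (1 + cos (s - φ) / cosh τ) / 2 := by
  unfold wf
  rw [rr_pp]
  simp only [pp, Matrix.cons_val_zero, Matrix.cons_val_one]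
  rw [cos_sub]; ring_nf

lemma wf_pp_diff (φ τ s : ℝ) : |wf (pp φ τ) s - wf (pp φ 0) s| ≤ sinh τ ^ 2 := by
  rw [wf_pp, wf_pp, cosh_zero]
  have hc := one_le_cosh τ
  have e : (1 + cos (s - φ) / cosh τ) / 2 - (1 + cos (s - φ) / 1) / 2 = - (cos (s - φ) * ((cosh τ - 1) / cosh τ)) / 2 := by
    field_simp; ring
  rw [e, abs_div, abs_neg, abs_mul, abs_of_nonneg (div_nonneg (by linarith) (by linarith) : 0 ≤ (cosh τ - 1) / cosh τ)]
  have h1 := abs_cos_le_one (s - φ)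
  have h2 : (cosh τ - 1) / cosh τ ≤ cosh τ - 1 := div_le_self (by linarith) hc
  have h3 : 0 ≤ (cosh τ - 1) / cosh τ := div_nonneg (by linarith) (by linarith)
  have h4 : cosh τ - 1 ≤ sinh τ ^ 2 := by rw [sinh_sq]; nlinarith
  rw [abs_of_pos (by norm_num : (0:ℝ) < 2)]
  have : |cos (s - φ)| * ((cosh τ - 1) / cosh τ) ≤ (cosh τ - 1) / cosh τ := mul_le_of_le_one_left h3 h1
  nlinarith [sq_nonneg (sinh τ)]

lemma pow_diff {x y : ℝ} (hx0 : 0 ≤ x) (hx1 : x ≤ 1) (hy0 : 0 ≤ y) (hy1 : y ≤ 1) (n : ℕ) :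
    |x ^ n - y ^ n| ≤ n * |x - y| := by
  induction n with
  | zero => simp
  | succ n ih =>
    have e : x ^ (n + 1) - y ^ (n + 1) = x ^ n * (x - y) + (x ^ n - y ^ n) * y := by ring
    rw [e]
    refine (abs_add_le _ _).trans ?_
    rw [abs_mul, abs_mul, abs_of_nonneg (pow_nonneg hx0 n), abs_of_nonneg hy0]
    have h1 : x ^ n * |x - y| ≤ |x - y| := mul_le_of_le_one_left (abs_nonneg _) (pow_le_one₀ hx0 hx1)
    have h2 : |x ^ n - y ^ n| * y ≤ |x ^ n - y ^ n| := mul_le_of_le_one_right (abs_nonneg _) hy1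
    push_cast
    linarith

lemma mom_diff {μ a N} (d : Dat μ a N) (φ τ : ℝ) (n : ℕ) :
    |mom N n (pp φ τ) - mom N n (pp φ 0)| ≤ (n * sinh τ ^ 2) ^ (3/4 : ℝ) * ∫ s, N s ∂MM := by
  unfold mom
  have hi : ∀ p, Integrable (fun s => wf p s ^ n * N s) MM := fun p => d.cint ((wf_cont p).pow n)
  rw [← integral_sub (hi _) (hi _), ← integral_const_mul, ← Real.norm_eq_abs]
  refine norm_integral_le_of_norm_le (d.Nint.const_mul _) (Eventually.of_forall fun s => ?_)
  rw [← sub_mul, norm_mul, norm_of_nonneg (d.N0 s), Real.norm_eq_abs]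
  refine mul_le_mul_of_nonneg_right ?_ (d.N0 s)
  set z : ℝ := n * sinh τ ^ 2 with hz
  have hz0 : 0 ≤ z := by positivity
  have x0 := wf_nonneg (pp φ τ) s
  have x1 := wf_le_one (pp φ τ) s
  have y0 := wf_nonneg (pp φ 0) s
  have y1 := wf_le_one (pp φ 0) s
  rcases le_total z 1 with h | h
  · have h1 : |wf (pp φ τ) s ^ n - wf (pp φ 0) s ^ n| ≤ z := by
      refine (pow_diff x0 x1 y0 y1 n).trans ?_
      exact mul_le_mul_of_nonneg_left (wf_pp_diff φ τ s) (Nat.cast_nonneg n)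
    refine h1.trans ?_
    rcases hz0.eq_or_lt with h0 | h0
    · rw [← h0]; positivity
    · calc z = z ^ (1:ℝ) := (rpow_one z).symm
        _ ≤ z ^ (3/4:ℝ) := rpow_le_rpow_of_exponent_ge h0 h (by norm_num)
  · refine le_trans ?_ (one_le_rpow h (by norm_num))
    have a1 := pow_nonneg x0 n
    have a2 := pow_le_one₀ (n := n) x0 x1
    have a3 := pow_nonneg y0 n
    have a4 := pow_le_one₀ (n := n) y0 y1
    rw [abs_le]; constructor <;> linarith

lemma sum_rp : Summable (fun n : ℕ => ((n:ℝ)) ^ (-(5/4) : ℝ)) := Real.summable_nat_rpow.2 (by norm_num)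

lemma momn_bound {μ a N} (d : Dat μ a N) (n p) : |mom N n p / n| ≤ Cm N * (n:ℝ) ^ (-(5/4) : ℝ) := by
  rcases Nat.eq_zero_or_pos n with rfl | hn
  · simp
  have hn' : (0:ℝ) < n := by exact_mod_cast hn
  rw [abs_of_nonneg (div_nonneg (mom_nonneg d n p) hn'.le), div_le_iff₀ hn', mul_assoc, ← rpow_add_one hn'.ne']
  refine (mom_le d n p).trans ?_
  refine mul_le_mul_of_nonneg_left ?_ (Cm_pos N).le
  have : (-(5/4) + 1 : ℝ) = -(1/4) := by norm_num
  rw [this]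
  exact rpow_le_rpow_of_nonpos hn' (by linarith) (by norm_num)

lemma momn_summable {μ a N} (d : Dat μ a N) (p) : Summable (fun n : ℕ => mom N n p / n) :=
  Summable.of_norm_bounded (sum_rp.mul_left _) (fun n => momn_bound d n p)

/-- logarithmic potential -/
noncomputable def Lam (N : ℝ → ℝ) (φ τ : ℝ) : ℝ := ∑' n : ℕ, mom N n (pp φ τ) / n
noncomputable def QQ (μ : ℝ) (N : ℝ → ℝ) (φ τ : ℝ) : ℝ := ∑' n : ℕ, cc μ n * mom N n (pp φ τ)

lemma Q_split {μ a N} (d : Dat μ a N) (φ : ℝ) : ∃ C K : ℝ, 0 ≤ C ∧ ∀ τ, 0 ≤ τ →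
    |QQ μ N φ τ - QQ μ N φ 0 - C * (Lam N φ τ - Lam N φ 0)| ≤ K * sinh τ ^ (3/2 : ℝ) := by
  obtain ⟨C, K, hC, hK, h⟩ := exists_split d.hμ
  set I := ∫ s, N s ∂MM with hI
  have hI0 : 0 ≤ I := integral_nonneg d.N0
  refine ⟨C, K * I * ∑' n : ℕ, (n:ℝ) ^ (-(5/4) : ℝ), hC, fun τ hτ => ?_⟩
  have hs : 0 ≤ sinh τ := sinh_nonneg_iff.2 hτ
  have H1 := ((cm_summable d (pp φ τ)).hasSum.sub (cm_summable d (pp φ 0)).hasSum).sub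
    (((momn_summable d (pp φ τ)).hasSum.sub (momn_summable d (pp φ 0)).hasSum).mul_left C)
  have H2 : QQ μ N φ τ - QQ μ N φ 0 - C * (Lam N φ τ - Lam N φ 0) = _ := H1.tsum_eq.symm
  rw [H2, ← Real.norm_eq_abs]
  have hb : ∀ n : ℕ, ‖(cc μ n * mom N n (pp φ τ) - cc μ n * mom N n (pp φ 0)) - C * (mom N n (pp φ τ) / n - mom N n (pp φ 0) / n)‖
      ≤ K * I * sinh τ ^ (3/2:ℝ) * (n:ℝ) ^ (-(5/4) : ℝ) := by
    intro n
    rcases Nat.eq_zero_or_pos n with rfl | hn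
    · simp [mom]
    have hn' : (0:ℝ) < n := by exact_mod_cast hn
    have e : (cc μ n * mom N n (pp φ τ) - cc μ n * mom N n (pp φ 0)) - C * (mom N n (pp φ τ) / n - mom N n (pp φ 0) / n)
      = (cc μ n - C / n) * (mom N n (pp φ τ) - mom N n (pp φ 0)) := by ring
    rw [e, Real.norm_eq_abs, abs_mul]
    refine (mul_le_mul (h n hn.ne') (mom_diff d φ τ n) (abs_nonneg _) (by positivity)).trans (le_of_eq ?_)
    rw [mul_rpow hn'.le (by positivity), ← rpow_natCast (sinh τ) 2, ← rpow_mul hs]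
    have e2 : (n:ℝ) ^ (-(5/4) : ℝ) = (n:ℝ) ^ (3/4 : ℝ) / (n:ℝ) ^ 2 := by
      rw [← rpow_natCast (n:ℝ) 2, ← rpow_sub hn']; norm_num
    have e3 : (((2:ℕ):ℝ) * (3/4) : ℝ) = 3/2 := by norm_num
    rw [e2, e3]
    ring
  refine (tsum_of_norm_bounded (sum_rp.mul_left _).hasSum hb).trans (le_of_eq ?_)
  rw [tsum_mul_left]; ring

lemma Lam_cont0 {μ a N} (d : Dat μ a N) (φ : ℝ) : Tendsto (Lam N φ) (nhds 0) (nhds (Lam N φ 0)) := by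
  unfold Lam
  refine tendsto_tsum_of_dominated_convergence (bound := fun n : ℕ => Cm N * (n:ℝ) ^ (-(5/4) : ℝ)) (sum_rp.mul_left _) ?_
    (Eventually.of_forall fun τ n => momn_bound d n _)
  intro n
  refine Tendsto.div_const ?_ _
  rw [tendsto_iff_dist_tendsto_zero]
  refine squeeze_zero (fun _ => dist_nonneg) (fun τ => mom_diff d φ τ n) ?_
  have : Continuous fun τ : ℝ => (n * sinh τ ^ 2) ^ (3/4 : ℝ) * ∫ s, N s ∂MM := by
    refine Continuous.mul ?_ continuous_const
    exact Continuous.rpow_const (by fun_prop) (fun _ => Or.inr (by norm_num))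
  have := this.tendsto 0
  simpa using this

end TOP

namespace TOP
open MeasureTheory

lemma log_hasSum {x : ℝ} (h0 : 0 ≤ x) (h1 : x < 1) (θ : ℝ) :
    HasSum (fun m : ℕ => x ^ m * cos (m * θ) / m) (-(1/2) * log (1 - 2 * x * cos θ + x ^ 2)) := by
  set z : ℂ := (x : ℂ) * Complex.exp (θ * Complex.I) with hz
  have hn : ‖z‖ < 1 := by
    rw [hz, norm_mul, Complex.norm_exp_ofReal_mul_I, Complex.norm_real, norm_of_nonneg h0, mul_one]; exact h1
  have H := Complex.hasSum_re (Complex.hasSum_taylorSeries_neg_log hn)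
  have e1 : ∀ m : ℕ, (z ^ m / m).re = x ^ m * cos (m * θ) / m := by
    intro m
    have : z ^ m / m = ((x ^ m / m : ℝ) : ℂ) * Complex.exp ((m * θ : ℝ) * Complex.I) := by
      rw [hz, mul_pow, ← Complex.exp_nat_mul]; push_cast; ring_nf
    rw [this, Complex.re_ofReal_mul, Complex.exp_ofReal_mul_I_re]; ring
  have e2 : (-Complex.log (1 - z)).re = -(1/2) * log (1 - 2 * x * cos θ + x ^ 2) := by
    rw [Complex.neg_re, Complex.log_re]
    have : ‖1 - z‖ ^ 2 = 1 - 2 * x * cos θ + x ^ 2 := by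
      rw [Complex.sq_norm, Complex.normSq_apply]
      simp only [hz, Complex.sub_re, Complex.sub_im, Complex.re_ofReal_mul, Complex.im_ofReal_mul, Complex.exp_ofReal_mul_I_re,
        Complex.exp_ofReal_mul_I_im, Complex.one_re, Complex.one_im]
      linear_combination x ^ 2 * sin_sq_add_cos_sq θ
    rw [← this, Real.log_pow]; push_cast; ring
  simp only [e1] at H
  rwa [e2] at H

lemma real_log_hasSum {w : ℝ} (hw : |w| < 1) : HasSum (fun n : ℕ => w ^ n / n) (-log (1 - w)) := by
  have := hasSum_pow_div_log_of_abs_lt_one hw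
  have h2 := (hasSum_nat_add_iff' (f := fun n : ℕ => w ^ n / n) (g := -log (1 - w)) 1).1 (by simpa using this)
  exact h2

section
variable {μ : ℝ} {a : ℕ → ℝ} {N : ℝ → ℝ}

noncomputable def Psi (N : ℝ → ℝ) (φ τ : ℝ) : ℝ := -∫ s, log (2 * (cosh τ - cos (s - φ))) * N s ∂MM

lemma cosh_gt {τ : ℝ} (h : 0 < τ) (θ : ℝ) : 0 < cosh τ - cos θ := by
  have := one_lt_cosh.2 h.ne'
  linarith [cos_le_one θ]

lemma logc (φ : ℝ) {τ : ℝ} (h : 0 < τ) : Continuous fun s => log (2 * (cosh τ - cos (s - φ))) := by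
  refine Continuous.log (by fun_prop) fun s => ?_
  have := cosh_gt h (s - φ)
  positivity

lemma logi (d : Dat μ a N) (φ : ℝ) {τ : ℝ} (h : 0 < τ) :
    Integrable (fun s => -(log (2 * (cosh τ - cos (s - φ))) * N s)) MM := (d.cint (logc φ h)).neg

lemma Lam_eq (d : Dat μ a N) (φ : ℝ) {τ : ℝ} (h : 0 < τ) :
    Lam N φ τ = log (4 * cosh τ) * ∫ s, N s ∂MM + Psi N φ τ := by
  have hi : ∀ n : ℕ, Integrable (fun s => wf (pp φ τ) s ^ n / n * N s) MM := fun n => by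
    have := (d.cint ((wf_cont (pp φ τ)).pow n)).div_const (n:ℝ)
    refine this.congr (Eventually.of_forall fun s => ?_)
    simp only [Pi.pow_apply]; ring
  have e : ∀ n : ℕ, ∫ s, wf (pp φ τ) s ^ n / n * N s ∂MM = mom N n (pp φ τ) / n := by
    intro n
    unfold mom
    rw [← integral_div]
    congr 1; funext s; ring
  have H := hasSum_integral_of_summable_integral_norm hi (by
    refine (momn_summable d (pp φ τ)).congr fun n => ?_
    rw [← e]
    congr 1; funext s
    rw [norm_of_nonneg]
    exact mul_nonneg (div_nonneg (pow_nonneg (wf_nonneg _ _) _) (Nat.cast_nonneg n)) (d.N0 s))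
  simp only [e] at H
  have H2 : Lam N φ τ = _ := H.tsum_eq
  rw [H2]
  unfold Psi
  rw [← integral_const_mul, ← integral_neg, ← integral_add (d.Nint.const_mul _) (logi d φ h)]
  congr 1
  funext s
  have hw : wf (pp φ τ) s = 1 - 2 * (cosh τ - cos (s - φ)) / (4 * cosh τ) := by
    rw [wf_pp]; have := cosh_pos τ; field_simp; ring
  have hp := cosh_gt h (s - φ)
  have hc := cosh_pos τ
  have hw1 : |wf (pp φ τ) s| < 1 := by
    rw [abs_of_nonneg (wf_nonneg _ _), hw]
    have : 0 < 2 * (cosh τ - cos (s - φ)) / (4 * cosh τ) := by positivity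
    linarith
  have := ((real_log_hasSum hw1).mul_right (N s)).tsum_eq
  rw [this]
  have e3 : 1 - wf (pp φ τ) s = 2 * (cosh τ - cos (s - φ)) / (4 * cosh τ) := by rw [hw]; ring
  rw [e3, log_div (by positivity) (by positivity)]
  ring

lemma Psi_anti (d : Dat μ a N) (φ : ℝ) {τ τ' : ℝ} (h : 0 < τ) (h' : τ ≤ τ') : Psi N φ τ' ≤ Psi N φ τ := by
  unfold Psi
  apply neg_le_neg
  refine integral_mono (d.cint (logc φ h)) (d.cint (logc φ (h.trans_le h'))) fun s => ?_
  refine mul_le_mul_of_nonneg_right ?_ (d.N0 s)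
  have := cosh_gt h (s - φ)
  have hc : cosh τ ≤ cosh τ' := cosh_le_cosh.2 (by rw [abs_of_pos h, abs_of_pos (h.trans_le h')]; exact h')
  exact log_le_log (by positivity) (by linarith)

noncomputable def SS (μ : ℝ) (a : ℕ → ℝ) (φ τ : ℝ) : ℝ :=
  ∑' j : ℕ, nu μ a j * cos ((9 * j : ℕ) * φ) / (9 * j : ℕ) * exp (-τ) ^ (9 * j)

lemma Psi_eq (d : Dat μ a N) (φ : ℝ) {τ : ℝ} (h : 0 < τ) :
    Psi N φ τ = -τ * (∫ s, N s ∂MM) + 2 * π * SS μ a φ τ := by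
  set x := exp (-τ) with hx
  have x0 : 0 < x := exp_pos _
  have x1 : x < 1 := by rw [hx, exp_lt_one_iff]; linarith
  have hi : ∀ m : ℕ, Integrable (fun s => 2 * (x ^ m * cos (m * (s - φ)) / m) * N s) MM := fun m => d.cint (by fun_prop)
  have e : ∀ m : ℕ, ∫ s, 2 * (x ^ m * cos (m * (s - φ)) / m) * N s ∂MM = 2 * x ^ m / m * (cos (m * φ) * ∫ s, cos (m * s) * N s ∂MM) := by
    intro m
    rw [← int_cos_N d, ← integral_const_mul]
    congr 1; funext s; ring
  have H := hasSum_integral_of_summable_integral_norm hi (by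
    refine Summable.of_nonneg_of_le (fun m => integral_nonneg fun s => norm_nonneg _) (fun m => ?_)
      (((summable_geometric_of_lt_one x0.le x1).mul_left 2).mul_right (∫ s, N s ∂MM))
    rw [← integral_const_mul]
    refine integral_mono (hi m).norm (d.Nint.const_mul _) fun s => ?_
    simp only
    rw [norm_mul, norm_of_nonneg (d.N0 s)]
    refine mul_le_mul_of_nonneg_right ?_ (d.N0 s)
    rw [Real.norm_eq_abs, abs_mul, abs_div, abs_mul, abs_of_pos (pow_pos x0 m), Nat.abs_cast, abs_of_pos (by norm_num : (0:ℝ) < 2)]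
    have h1 := abs_cos_le_one (m * (s - φ))
    have h3 : x ^ m * |cos (m * (s - φ))| ≤ x ^ m := mul_le_of_le_one_right (pow_pos x0 m).le h1
    have h2 : x ^ m * |cos (m * (s - φ))| / m ≤ x ^ m := by
      rcases Nat.eq_zero_or_pos m with rfl | hm
      · simp
      · refine (div_le_self (by positivity) ?_).trans h3
        exact_mod_cast hm
    linarith)
  have hD : ∀ s, 1 - 2 * x * cos (s - φ) + x ^ 2 = x * (2 * (cosh τ - cos (s - φ))) := by
    intro s
    rw [cosh_eq, ← hx, show exp τ = x⁻¹ by rw [hx, exp_neg, inv_inv]]; field_simp; ring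
  have e2 : ∫ s, ∑' m : ℕ, 2 * (x ^ m * cos (m * (s - φ)) / m) * N s ∂MM = τ * (∫ s, N s ∂MM) + Psi N φ τ := by
    unfold Psi
    rw [← integral_const_mul, ← integral_neg, ← integral_add (d.Nint.const_mul _) (logi d φ h)]
    congr 1
    funext s
    have hp := cosh_gt h (s - φ)
    rw [(((log_hasSum x0.le x1 (s - φ)).mul_left 2).mul_right (N s)).tsum_eq, hD, log_mul x0.ne' (by positivity)]
    rw [hx, log_exp]; ring
  rw [e2] at H
  simp only [e] at H
  have inj : Function.Injective (fun j : ℕ => 9 * j) := fun i j h => by simpa using h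
  have H3 := (inj.hasSum_iff (f := fun m : ℕ => 2 * x ^ m / m * (cos (m * φ) * ∫ s, cos (m * s) * N s ∂MM)) (by
    intro m hm
    rw [d.cn m]
    · ring
    · rintro ⟨k, hk⟩; exact hm ⟨k, hk.symm⟩)).2 H
  have H4 : 2 * π * SS μ a φ τ = τ * (∫ s, N s ∂MM) + Psi N φ τ := by
    rw [← H3.tsum_eq]
    unfold SS
    rw [← tsum_mul_left]
    refine tsum_congr fun j => ?_
    simp only [Function.comp]
    rw [d.c9 j]
    unfold nu ww
    by_cases hj : j = 0
    · subst hj; simp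
    · rw [if_neg hj]; ring
  linarith

end
end TOP

namespace TOP
open MeasureTheory

section
variable {μ : ℝ} {a : ℕ → ℝ} {N : ℝ → ℝ}

noncomputable def GA (a : ℕ → ℝ) (φ τ : ℝ) : ℝ := ∑' j : ℕ, a j * cos ((9 * j : ℕ) * φ) * exp (-τ) ^ (9 * j)

lemma int_cos_cos_shift (k m : ℕ) (φ : ℝ) : ∫ s, cos (k * s) * cos (m * (s - φ)) ∂MM =
    if m = k then (if k = 0 then 2 * π else π) * cos (k * φ) else 0 := by
  have e : ∀ s : ℝ, cos (k * s) * cos (m * (s - φ)) = cos (m * φ) * (cos (m * s) * cos (k * s)) + sin (m * φ) * (sin (m * s) * cos (k * s)) := by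
    intro s
    rw [mul_sub, cos_sub]; ring
  simp_rw [e]
  rw [integral_add (cont_int (by fun_prop)) (cont_int (by fun_prop)), integral_const_mul, integral_const_mul, int_sin_cos, int_cos_cos]
  split_ifs with h1 h2 h3 <;> first | omega | (subst h1; ring) | ring

lemma pk_cos {x : ℝ} (h0 : 0 ≤ x) (h1 : x < 1) (φ : ℝ) (k : ℕ) :
    ∫ s, cos (k * s) * ((1 - x * cos (s - φ)) / (1 - 2 * x * cos (s - φ) + x ^ 2)) ∂MM
      = x ^ k * ((if k = 0 then 2 * π else π) * cos (k * φ)) := by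
  have hi : ∀ m : ℕ, Integrable (fun s => cos (k * s) * (x ^ m * cos (m * (s - φ)))) MM := fun m => cont_int (by fun_prop)
  have H := hasSum_integral_of_summable_integral_norm hi (by
    refine Summable.of_nonneg_of_le (fun m => integral_nonneg fun s => norm_nonneg _) (fun m => ?_)
      ((summable_geometric_of_lt_one h0 h1).mul_left (2 * π))
    rw [← int_const]
    refine integral_mono (hi m).norm (integrable_const _) fun s => ?_
    simp only
    rw [norm_mul, norm_mul, norm_of_nonneg (pow_nonneg h0 m), Real.norm_eq_abs, Real.norm_eq_abs]
    have h1 := abs_cos_le_one (m * (s - φ))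
    have h2 := abs_cos_le_one (k * s)
    have h3 := pow_nonneg h0 m
    have h4 : x ^ m * |cos (m * (s - φ))| ≤ x ^ m := mul_le_of_le_one_right h3 h1
    have h5 : 0 ≤ x ^ m * |cos (m * (s - φ))| := by positivity
    exact (mul_le_of_le_one_left h5 h2).trans h4)
  have e : ∀ m : ℕ, ∫ s, cos (k * s) * (x ^ m * cos (m * (s - φ))) ∂MM = if m = k then x ^ k * ((if k = 0 then 2 * π else π) * cos (k * φ)) else 0 := by
    intro m
    have : ∀ s, cos (k * s) * (x ^ m * cos (m * (s - φ))) = x ^ m * (cos (k * s) * cos (m * (s - φ))) := fun s => by ring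
    simp_rw [this]
    rw [integral_const_mul, int_cos_cos_shift]
    split_ifs with h1 <;> first | (subst h1; ring) | ring
  simp only [e] at H
  have H2 := H.unique (hasSum_ite_eq k _)
  rw [← H2]
  congr 1; funext s
  rw [((poisson_hasSum h0 h1 (s - φ)).mul_left (cos (k * s))).tsum_eq]

lemma GA_eq (d : Dat μ a N) (φ : ℝ) {τ : ℝ} (h : 0 < τ) :
    GA a φ τ / sinh τ = (2 * π)⁻¹ * ∫ s, gg a s / (cosh τ - cos (s - φ)) ∂MM := by
  set x := exp (-τ) with hx
  have x0 : 0 < x := exp_pos _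
  have x1 : x < 1 := by rw [hx, exp_lt_one_iff]; linarith
  set A : ℝ → ℝ := fun s => (1 - x * cos (s - φ)) / (1 - 2 * x * cos (s - φ) + x ^ 2) with hA
  have cA : Continuous A := by
    simp only [hA]
    exact Continuous.div (by fun_prop) (by fun_prop) (fun s => (poisson_den x0.le x1 _).ne')
  have hpk : ∀ s, 2 * A s - 1 = sinh τ * (1 / (cosh τ - cos (s - φ))) := by
    intro s
    have h1 := poisson_den x0.le x1 (s - φ)
    have h2 := cosh_gt h (s - φ)
    have e1 : 1 - 2 * x * cos (s - φ) + x ^ 2 = x * (2 * (cosh τ - cos (s - φ))) := by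
      rw [cosh_eq, ← hx, show exp τ = x⁻¹ by rw [hx, exp_neg, inv_inv]]; field_simp; ring
    have e2 : sinh τ = (1 - x ^ 2) / (2 * x) := by
      rw [sinh_eq, ← hx, show exp τ = x⁻¹ by rw [hx, exp_neg, inv_inv]]; field_simp
    have e3 : cosh τ = (1 + x ^ 2) / (2 * x) := by
      rw [cosh_eq, ← hx, show exp τ = x⁻¹ by rw [hx, exp_neg, inv_inv]]; field_simp
    simp only [hA]
    rw [e1, e2]
    have h2' := h2.ne'
    field_simp
    rw [e3]
    field_simp
    ring
  have cg := gg_cont d.hsum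
  obtain ⟨B, hB⟩ := (isCompact_Icc (a := -π) (b := π)).exists_bound_of_continuousOn cA.continuousOn
  have hi : ∀ j : ℕ, Integrable (fun s => a j * cos ((9 * j : ℕ) * s) * A s) MM := fun j => cont_int (by fun_prop)
  have H := hasSum_integral_of_summable_integral_norm hi (by
    refine Summable.of_nonneg_of_le (fun m => integral_nonneg fun s => norm_nonneg _) (fun j => ?_)
      ((d.hsum.mul_right B).mul_left (2 * π))
    rw [← int_const]
    refine integral_mono_ae (hi j).norm (integrable_const _) ?_
    unfold MM
    filter_upwards [ae_restrict_mem measurableSet_Ioc] with s hs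
    rw [norm_mul]
    exact mul_le_mul (gg_term a s j) (hB s ⟨hs.1.le, hs.2⟩) (norm_nonneg _) (abs_nonneg _))
  have e : ∀ j : ℕ, ∫ s, a j * cos ((9 * j : ℕ) * s) * A s ∂MM = π * (a j * cos ((9 * j : ℕ) * φ) * x ^ (9 * j)) + if j = 0 then π * a 0 else 0 := by
    intro j
    have : ∀ s, a j * cos ((9 * j : ℕ) * s) * A s = a j * (cos ((9 * j : ℕ) * s) * A s) := fun s => by ring
    simp_rw [this]
    rw [integral_const_mul, pk_cos x0.le x1 φ (9 * j)]
    by_cases hj : j = 0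
    · subst hj; simp; ring
    · rw [if_neg (by omega), if_neg hj]; ring
  have e2 : ∫ s, ∑' j : ℕ, a j * cos ((9 * j : ℕ) * s) * A s ∂MM = ∫ s, gg a s * A s ∂MM := by
    congr 1; funext s
    rw [tsum_mul_right]; rfl
  rw [e2] at H
  simp only [e] at H
  have sG : Summable (fun j : ℕ => a j * cos ((9 * j : ℕ) * φ) * x ^ (9 * j)) := by
    refine Summable.of_norm_bounded d.hsum fun j => ?_
    rw [norm_mul, norm_of_nonneg (pow_nonneg x0.le _)]
    exact (mul_le_of_le_one_right (norm_nonneg _) (pow_le_one₀ x0.le x1.le)).trans (gg_term a φ j)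
  have H3 := (sG.hasSum.mul_left π).add (hasSum_ite_eq 0 (π * a 0))
  have H4 := H.unique H3
  have H5 : ∫ s, gg a s * A s ∂MM = π * GA a φ τ + π * a 0 := H4
  have H6 : ∫ s, gg a s ∂MM = 2 * π * a 0 := by
    have := gg_int d.hsum 0
    simp [ww] at this
    rw [this]; ring
  have H7 : ∫ s, gg a s * (2 * A s - 1) ∂MM = 2 * π * GA a φ τ := by
    have : ∀ s, gg a s * (2 * A s - 1) = 2 * (gg a s * A s) - gg a s := fun s => by ring
    simp_rw [this]
    rw [integral_sub (cont_int (by fun_prop)) (cont_int cg), integral_const_mul, H5, H6]; ring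
  have hs := sinh_pos_iff.2 h
  have H8 : ∫ s, gg a s * (2 * A s - 1) ∂MM = sinh τ * ∫ s, gg a s / (cosh τ - cos (s - φ)) ∂MM := by
    rw [← integral_const_mul]
    congr 1; funext s
    rw [hpk]; ring
  rw [div_eq_iff hs.ne']
  have hpi := pi_pos
  rw [H8] at H7
  field_simp
  linarith

lemma GA_anti (d : Dat μ a N) (φ : ℝ) : AntitoneOn (fun τ => GA a φ τ / sinh τ) (Ioi 0) := by
  intro τ h τ' h' hh
  have h : 0 < τ := h
  have h' : 0 < τ' := h'
  simp only
  rw [GA_eq d φ h, GA_eq d φ h']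
  have cg := gg_cont d.hsum
  have ci : ∀ {t : ℝ}, 0 < t → Integrable (fun s => gg a s / (cosh t - cos (s - φ))) MM := fun {t} ht =>
    cont_int (Continuous.div cg (by fun_prop) fun s => (cosh_gt ht _).ne')
  refine mul_le_mul_of_nonneg_left ?_ (by have := pi_pos; positivity)
  refine integral_mono (ci h') (ci h) fun s => ?_
  have hc : cosh τ ≤ cosh τ' := cosh_le_cosh.2 (by rw [abs_of_pos h, abs_of_pos h']; exact hh)
  exact div_le_div_of_nonneg_left (d.g0 s) (cosh_gt h _) (by linarith)

lemma ser_cont {c : ℕ → ℝ} (hc : Summable fun j => |c j|) :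
    Tendsto (fun τ => ∑' j : ℕ, c j * exp (-τ) ^ (9 * j)) (nhdsWithin 0 (Ioi 0)) (nhds (∑' j : ℕ, c j * exp (-0) ^ (9 * j))) := by
  refine tendsto_tsum_of_dominated_convergence hc (fun j => ?_) ?_
  · have : Continuous fun τ : ℝ => c j * exp (-τ) ^ (9 * j) := by fun_prop
    exact (this.tendsto 0).mono_left nhdsWithin_le_nhds
  · filter_upwards [self_mem_nhdsWithin] with τ hτ j
    have hτ : 0 < τ := hτ
    rw [norm_mul, norm_of_nonneg (by positivity : 0 ≤ exp (-τ) ^ (9 * j))]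
    exact mul_le_of_le_one_right (norm_nonneg _) (pow_le_one₀ (exp_pos _).le (exp_le_one_iff.2 (by linarith)))

lemma exp_pow_bd {τ : ℝ} (h : 0 < τ) (k : ℕ) : |exp (-τ) ^ k - 1| ≤ k * τ := by
  have h1 : exp (-τ) ^ k ≤ 1 := pow_le_one₀ (exp_pos _).le (exp_le_one_iff.2 (by linarith))
  rw [abs_of_nonpos (by linarith), ← exp_nat_mul]
  have := add_one_le_exp ((k:ℝ) * -τ)
  linarith

lemma ser_deriv {c : ℕ → ℝ} (hc : Summable fun j => |c j|) (hc' : Summable fun j : ℕ => |c j| * (9 * j : ℕ)) :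
    (∃ B, 0 ≤ B ∧ ∀ τ, 0 < τ → |(∑' j : ℕ, c j * exp (-τ) ^ (9 * j)) - ∑' j : ℕ, c j * exp (-0) ^ (9 * j)| ≤ B * τ) ∧
    ∃ l, Tendsto (fun τ => ((∑' j : ℕ, c j * exp (-τ) ^ (9 * j)) - ∑' j : ℕ, c j * exp (-0) ^ (9 * j)) / τ) (nhdsWithin 0 (Ioi 0)) (nhds l) := by
  have hs : ∀ τ, 0 ≤ τ → Summable fun j : ℕ => c j * exp (-τ) ^ (9 * j) := by
    intro τ hτ
    refine Summable.of_norm_bounded hc fun j => ?_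
    rw [norm_mul, norm_of_nonneg (by positivity : 0 ≤ exp (-τ) ^ (9 * j))]
    exact mul_le_of_le_one_right (norm_nonneg _) (pow_le_one₀ (exp_pos _).le (exp_le_one_iff.2 (by linarith)))
  have hd : ∀ τ, 0 < τ → HasSum (fun j : ℕ => c j * (exp (-τ) ^ (9 * j) - 1))
      ((∑' j : ℕ, c j * exp (-τ) ^ (9 * j)) - ∑' j : ℕ, c j * exp (-0) ^ (9 * j)) := by
    intro τ hτ
    have := (hs τ hτ.le).hasSum.sub (hs 0 le_rfl).hasSum
    have e : (fun j : ℕ => c j * (exp (-τ) ^ (9 * j) - 1)) = fun j : ℕ => c j * exp (-τ) ^ (9 * j) - c j * exp (-0) ^ (9 * j) := by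
      funext j; rw [neg_zero, exp_zero, one_pow]; ring
    rw [e]; exact this
  have hb : ∀ τ, 0 < τ → ∀ j : ℕ, ‖c j * (exp (-τ) ^ (9 * j) - 1)‖ ≤ |c j| * (9 * j : ℕ) * τ := by
    intro τ hτ j
    rw [norm_mul, Real.norm_eq_abs, Real.norm_eq_abs, mul_assoc]
    exact mul_le_mul_of_nonneg_left (exp_pow_bd hτ _) (abs_nonneg _)
  refine ⟨⟨∑' j : ℕ, |c j| * (9 * j : ℕ), tsum_nonneg fun j => by positivity, fun τ hτ => ?_⟩, ∑' j : ℕ, c j * (-(9 * j : ℕ)), ?_⟩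
  · rw [← (hd τ hτ).tsum_eq, ← Real.norm_eq_abs]
    exact tsum_of_norm_bounded (hc'.hasSum.mul_right τ) (hb τ hτ)
  · have : (fun τ => ((∑' j : ℕ, c j * exp (-τ) ^ (9 * j)) - ∑' j : ℕ, c j * exp (-0) ^ (9 * j)) / τ) =ᶠ[nhdsWithin 0 (Ioi 0)]
        fun τ => ∑' j : ℕ, c j * (exp (-τ) ^ (9 * j) - 1) / τ := by
      filter_upwards [self_mem_nhdsWithin] with τ hτ
      rw [tsum_div_const, (hd τ hτ).tsum_eq]
    refine Tendsto.congr' this.symm ?_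
    refine tendsto_tsum_of_dominated_convergence hc' (fun j => ?_) ?_
    · have h1 : HasDerivAt (fun τ : ℝ => exp (-τ) ^ (9 * j)) (-((9 * j : ℕ) : ℝ)) 0 := by
        have e : (fun τ : ℝ => exp (-τ) ^ (9 * j)) = fun τ => exp (-((9 * j : ℕ) : ℝ) * τ) := by
          funext τ; rw [← exp_nat_mul]; ring_nf
        rw [e]
        refine ((hasDerivAt_id (0:ℝ)).const_mul (-((9 * j : ℕ) : ℝ))).exp.congr_deriv ?_
        simp
      have h2 := h1.hasDerivWithinAt (s := Ioi 0)
      rw [hasDerivWithinAt_iff_tendsto_slope' (by simp)] at h2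
      refine (h2.const_mul (c j)).congr fun τ => ?_
      rw [slope_def_field]; simp; ring
    · filter_upwards [self_mem_nhdsWithin] with τ hτ j
      have hτ : 0 < τ := hτ
      rw [norm_div, norm_of_nonneg hτ.le, div_le_iff₀ hτ]
      exact hb τ hτ j

end
end TOP

namespace TOP
open MeasureTheory

section
variable {μ : ℝ} {a : ℕ → ℝ} {N : ℝ → ℝ}

lemma rho_bd (h : μ ∈ II) : ∃ B, 0 ≤ B ∧ ∀ j : ℕ, |√(kap μ) / EE j μ - 9 * j| ≤ B := by
  refine ⟨5 + |√(kap μ) / EE 0 μ - 9 * (0:ℕ)| + |√(kap μ) / EE 1 μ - 9 * (1:ℕ)|, by positivity, fun j => ?_⟩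
  have h0 := abs_nonneg (√(kap μ) / EE 0 μ - 9 * (0:ℕ))
  have h1 := abs_nonneg (√(kap μ) / EE 1 μ - 9 * (1:ℕ))
  by_cases hj : 2 ≤ j
  · have := EE_asym h hj; linarith
  · have : j = 0 ∨ j = 1 := by omega
    rcases this with rfl | rfl <;> linarith

noncomputable def bb (μ : ℝ) (a : ℕ → ℝ) (φ : ℝ) (j : ℕ) : ℝ :=
  (√(kap μ) / EE j μ - 9 * j) * (a j * cos ((9 * j : ℕ) * φ)) / (9 * j : ℕ)

lemma bb_sum (d : Dat μ a N) (φ : ℝ) :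
    Summable (fun j => |bb μ a φ j|) ∧ Summable (fun j : ℕ => |bb μ a φ j| * (9 * j : ℕ)) := by
  obtain ⟨B, hB, h⟩ := rho_bd d.hμ
  have key : ∀ j, |(√(kap μ) / EE j μ - 9 * j) * (a j * cos ((9 * j : ℕ) * φ))| ≤ B * |a j| := fun j => by
    rw [abs_mul]
    exact mul_le_mul (h j) (gg_term a φ j) (abs_nonneg _) hB
  constructor
  · refine Summable.of_nonneg_of_le (fun j => abs_nonneg _) (fun j => ?_) (d.hsum.mul_left B)
    refine le_trans ?_ (key j)
    unfold bb
    rw [abs_div]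
    rcases Nat.eq_zero_or_pos j with rfl | hj
    · simp; positivity
    · refine div_le_self (abs_nonneg _) ?_
      rw [Nat.abs_cast]
      exact_mod_cast (by omega : 1 ≤ 9 * j)
  · refine Summable.of_nonneg_of_le (fun j => by positivity) (fun j => ?_) (d.hsum.mul_left B)
    refine le_trans ?_ (key j)
    unfold bb
    rw [abs_div, Nat.abs_cast]
    rcases Nat.eq_zero_or_pos j with rfl | hj
    · simp; positivity
    · rw [div_mul_cancel₀]
      positivity

lemma ser_sum {c : ℕ → ℝ} (hc : Summable fun j => |c j|) {τ : ℝ} (hτ : 0 ≤ τ) :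
    Summable fun j : ℕ => c j * exp (-τ) ^ (9 * j) := by
  refine Summable.of_norm_bounded hc fun j => ?_
  rw [norm_mul, norm_of_nonneg (by positivity : 0 ≤ exp (-τ) ^ (9 * j))]
  exact mul_le_of_le_one_right (norm_nonneg _) (pow_le_one₀ (exp_pos _).le (exp_le_one_iff.2 (by linarith)))

lemma gabs (d : Dat μ a N) (φ : ℝ) : Summable fun j : ℕ => |a j * cos ((9 * j : ℕ) * φ)| :=
  Summable.of_nonneg_of_le (fun j => abs_nonneg _) (fun j => gg_term a φ j) d.hsum

noncomputable def PB (μ : ℝ) (a : ℕ → ℝ) (φ τ : ℝ) : ℝ := ∑' j : ℕ, bb μ a φ j * exp (-τ) ^ (9 * j)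

lemma SS_split (d : Dat μ a N) (φ : ℝ) {τ : ℝ} (hτ : 0 ≤ τ) :
    √(kap μ) * SS μ a φ τ = GA a φ τ - a 0 + PB μ a φ τ := by
  have h1 : HasSum _ (GA a φ τ) := (ser_sum (gabs d φ) hτ).hasSum
  have h2 : HasSum _ (PB μ a φ τ) := (ser_sum (bb_sum d φ).1 hτ).hasSum
  have h3 := (h1.sub (hasSum_ite_eq 0 (a 0))).add h2
  rw [← h3.tsum_eq]
  unfold SS
  rw [← tsum_mul_left]
  congr 1; funext j
  rcases Nat.eq_zero_or_pos j with rfl | hj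
  · simp [bb]
  · rw [if_neg hj.ne']
    unfold bb nu
    have := EE_ne d.hμ j
    have hj' : (0:ℝ) < j := by exact_mod_cast hj
    push_cast
    field_simp
    ring

lemma GA_lim (d : Dat μ a N) (φ : ℝ) : Tendsto (GA a φ) (nhdsWithin 0 (Ioi 0)) (nhds (GA a φ 0)) := ser_cont (gabs d φ)

lemma PB_lim (d : Dat μ a N) (φ : ℝ) : Tendsto (PB μ a φ) (nhdsWithin 0 (Ioi 0)) (nhds (PB μ a φ 0)) := ser_cont (bb_sum d φ).1

lemma GA_zero (φ : ℝ) : GA a φ 0 = gg a φ := by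
  unfold GA gg; simp

lemma SS_lim (d : Dat μ a N) (φ : ℝ) : Tendsto (SS μ a φ) (nhdsWithin 0 (Ioi 0)) (nhds (SS μ a φ 0)) := by
  have hk : √(kap μ) ≠ 0 := (sqrt_pos.2 (kap_pos d.hμ)).ne'
  have e : ∀ τ, 0 ≤ τ → SS μ a φ τ = (√(kap μ))⁻¹ * (GA a φ τ - a 0 + PB μ a φ τ) := fun τ hτ => by
    rw [← SS_split d φ hτ, inv_mul_cancel_left₀ hk]
  rw [e 0 le_rfl]
  refine Tendsto.congr' (f₁ := fun τ => (√(kap μ))⁻¹ * (GA a φ τ - a 0 + PB μ a φ τ)) ?_ ((((GA_lim d φ).sub_const _).add (PB_lim d φ)).const_mul _)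
  filter_upwards [self_mem_nhdsWithin] with τ hτ
  exact (e τ (le_of_lt hτ)).symm

lemma Lam_zero (d : Dat μ a N) (φ : ℝ) : Lam N φ 0 = log 4 * (∫ s, N s ∂MM) + 2 * π * SS μ a φ 0 := by
  have h1 : Tendsto (Lam N φ) (nhdsWithin 0 (Ioi 0)) (nhds (Lam N φ 0)) := (Lam_cont0 d φ).mono_left nhdsWithin_le_nhds
  set I := ∫ s, N s ∂MM with hI
  have h2 : Tendsto (fun τ : ℝ => log (4 * cosh τ) * I + (-τ * I + 2 * π * SS μ a φ τ)) (nhdsWithin 0 (Ioi 0)) (nhds (log (4 * cosh 0) * I + (-0 * I + 2 * π * SS μ a φ 0))) := by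
    refine Tendsto.add ?_ (Tendsto.add ?_ ((SS_lim d φ).const_mul _))
    · have : Continuous fun τ : ℝ => log (4 * cosh τ) * I :=
        (Continuous.log (by fun_prop) (fun τ => by have := cosh_pos τ; positivity)).mul_const _
      exact (this.tendsto 0).mono_left nhdsWithin_le_nhds
    · have : Continuous fun τ : ℝ => -τ * I := by fun_prop
      exact (this.tendsto 0).mono_left nhdsWithin_le_nhds
  have h3 : (fun τ : ℝ => log (4 * cosh τ) * I + (-τ * I + 2 * π * SS μ a φ τ)) =ᶠ[nhdsWithin 0 (Ioi 0)] Lam N φ := by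
    filter_upwards [self_mem_nhdsWithin] with τ hτ
    rw [Lam_eq d φ hτ, Psi_eq d φ hτ]
  have := tendsto_nhds_unique h1 (h2.congr' h3)
  rw [this, cosh_zero]; ring_nf

lemma Lam_diff (d : Dat μ a N) (φ : ℝ) {τ : ℝ} (h : 0 < τ) :
    Lam N φ τ - Lam N φ 0 = log (cosh τ) * (∫ s, N s ∂MM) - τ * (∫ s, N s ∂MM) + 2 * π * (SS μ a φ τ - SS μ a φ 0) := by
  rw [Lam_zero d, Lam_eq d φ h, Psi_eq d φ h, log_mul (by norm_num) (cosh_pos τ).ne']; ring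

lemma SS_le (d : Dat μ a N) (φ : ℝ) {τ : ℝ} (h : 0 < τ) :
    2 * π * (SS μ a φ τ - SS μ a φ 0) ≤ τ * (∫ s, N s ∂MM) := by
  set I := ∫ s, N s ∂MM with hI
  have h2 : Tendsto (fun t : ℝ => -t * I + 2 * π * SS μ a φ t) (nhdsWithin 0 (Ioi 0)) (nhds (-0 * I + 2 * π * SS μ a φ 0)) := by
    refine (Tendsto.add ?_ ((SS_lim d φ).const_mul _))
    have : Continuous fun τ : ℝ => -τ * I := by fun_prop
    exact (this.tendsto 0).mono_left nhdsWithin_le_nhds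
  have := ge_of_tendsto h2 (b := Psi N φ τ) (by
    filter_upwards [Ioo_mem_nhdsGT h] with t ht
    rw [← Psi_eq d φ ht.1]
    exact Psi_anti d φ ht.1 ht.2.le)
  rw [Psi_eq d φ h] at this
  linarith

lemma lim_of_deriv {f : ℝ → ℝ} {f' : ℝ} (h : HasDerivAt f f' 0) (h0 : f 0 = 0) :
    Tendsto (fun τ => f τ / τ) (nhdsWithin 0 (Ioi 0)) (nhds f') := by
  have h2 := h.hasDerivWithinAt (s := Ioi 0)
  rw [hasDerivWithinAt_iff_tendsto_slope' (by simp)] at h2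
  refine h2.congr fun τ => ?_
  rw [slope_def_field, h0, sub_zero, sub_zero]

lemma tau_sinh : Tendsto (fun τ : ℝ => τ / sinh τ) (nhdsWithin 0 (Ioi 0)) (nhds 1) := by
  have h := lim_of_deriv (hasDerivAt_sinh 0) sinh_zero
  rw [cosh_zero] at h
  have := h.inv₀ one_ne_zero
  simpa using this

lemma log_cosh_sinh : Tendsto (fun τ : ℝ => log (cosh τ) / sinh τ) (nhdsWithin 0 (Ioi 0)) (nhds 0) := by
  have h1 : HasDerivAt (fun τ => log (cosh τ)) 0 0 := by
    refine ((hasDerivAt_cosh 0).log (cosh_pos 0).ne').congr_deriv ?_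
    simp
  have h := (lim_of_deriv h1 (by simp)).mul tau_sinh
  rw [zero_mul] at h
  refine h.congr' ?_
  filter_upwards [self_mem_nhdsWithin] with τ hτ
  have hτ : 0 < τ := hτ
  field_simp

theorem Lam_slope (d : Dat μ a N) (φ : ℝ) (hg : gg a φ = 0) :
    ∃ l, l ≤ 0 ∧ Tendsto (fun τ => (Lam N φ τ - Lam N φ 0) / sinh τ) (nhdsWithin 0 (Ioi 0)) (nhds l) := by
  set I := ∫ s, N s ∂MM with hI
  have hI0 : 0 ≤ I := integral_nonneg d.N0
  have hk : 0 < √(kap μ) := sqrt_pos.2 (kap_pos d.hμ)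
  have hpi := pi_pos
  have hS : ∀ τ, 0 < τ → √(kap μ) * (SS μ a φ τ - SS μ a φ 0) = GA a φ τ + (PB μ a φ τ - PB μ a φ 0) := fun τ hτ => by
    rw [mul_sub, SS_split d φ hτ.le, SS_split d φ le_rfl, GA_zero, hg]; ring
  obtain ⟨⟨B, hB0, hB⟩, l1, hl1⟩ := ser_deriv (bb_sum d φ).1 (bb_sum d φ).2
  have hB' : ∀ τ, 0 < τ → |PB μ a φ τ - PB μ a φ 0| ≤ B * τ := hB
  have hl1' : Tendsto (fun τ => (PB μ a φ τ - PB μ a φ 0) / τ) (nhdsWithin 0 (Ioi 0)) (nhds l1) := hl1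
  have hbd : BddAbove ((fun τ => GA a φ τ / sinh τ) '' Ioi 0) := by
    refine ⟨√(kap μ) * I / (2 * π) + B, ?_⟩
    rintro _ ⟨τ, hτ, rfl⟩
    have hτ : 0 < τ := hτ
    have hs := sinh_pos_iff.2 hτ
    have hts : τ ≤ sinh τ := self_le_sinh_iff.2 hτ.le
    simp only
    rw [div_le_iff₀ hs]
    have h1 := SS_le d φ hτ
    have h2 := hS τ hτ
    have h3 := (abs_le.1 (hB' τ hτ)).1
    have h4 : SS μ a φ τ - SS μ a φ 0 ≤ τ * I / (2 * π) := by
      rw [le_div_iff₀ (by positivity)]; linarith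
    have h5 := mul_le_mul_of_nonneg_left h4 hk.le
    have h6 : GA a φ τ ≤ (√(kap μ) * I / (2 * π) + B) * τ := by
      have : √(kap μ) * (τ * I / (2 * π)) = √(kap μ) * I / (2 * π) * τ := by ring
      rw [add_mul]; linarith
    exact h6.trans (mul_le_mul_of_nonneg_left hts (by positivity))
  have hGA := (GA_anti d φ).tendsto_nhdsGT hbd
  set L := sSup ((fun τ => GA a φ τ / sinh τ) '' Ioi 0)
  have T : Tendsto (fun τ => (log (cosh τ) / sinh τ) * I - (τ / sinh τ) * I + 2 * π / √(kap μ) * (GA a φ τ / sinh τ + (PB μ a φ τ - PB μ a φ 0) / τ * (τ / sinh τ)))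
      (nhdsWithin 0 (Ioi 0)) (nhds (0 * I - 1 * I + 2 * π / √(kap μ) * (L + l1 * 1))) :=
    ((log_cosh_sinh.mul_const I).sub (tau_sinh.mul_const I)).add ((hGA.add (hl1'.mul tau_sinh)).const_mul _)
  have T2 := T.congr' (f₂ := fun τ => (Lam N φ τ - Lam N φ 0) / sinh τ) (by
    filter_upwards [self_mem_nhdsWithin] with τ hτ
    have hτ : 0 < τ := hτ
    have hs := sinh_pos_iff.2 hτ
    have h2 := hS τ hτ
    have h3 : SS μ a φ τ - SS μ a φ 0 = (GA a φ τ + (PB μ a φ τ - PB μ a φ 0)) / √(kap μ) := by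
      rw [← h2]; field_simp
    rw [Lam_diff d φ hτ, h3, ← hI]
    field_simp)
  refine ⟨_, ?_, T2⟩
  have T3 := log_cosh_sinh.mul_const I
  rw [zero_mul] at T3
  refine le_of_tendsto_of_tendsto T2 T3 ?_
  filter_upwards [self_mem_nhdsWithin] with τ hτ
  have hτ : 0 < τ := hτ
  have hs := sinh_pos_iff.2 hτ
  rw [div_mul_eq_mul_div]
  refine div_le_div_of_nonneg_right ?_ hs.le
  have := Lam_diff d φ hτ
  have := SS_le d φ hτ
  linarith

lemma QQ_zero (d : Dat μ a N) (φ : ℝ) (hg : gg a φ = 0) : QQ μ N φ 0 = 0 := by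
  have h1 := uu_plane d (p := pp φ 0) (R := 1) (φ := φ) zero_le_one (by simp [pp]) (by simp [pp]) (by simp [pp])
  rw [hg, mul_zero, mul_zero] at h1
  have h2 : uu μ N (pp φ 0) = rr (pp φ 0) ^ μ * QQ μ N φ 0 := rfl
  rw [h1, rr_pp, cosh_zero, one_rpow, one_mul] at h2
  exact h2.symm

theorem uu_slope (d : Dat μ a N) (φ : ℝ) (hg : gg a φ = 0) :
    ∃ l, l ≤ 0 ∧ Tendsto (fun τ => uu μ N (pp φ τ) / sinh τ) (nhdsWithin 0 (Ioi 0)) (nhds l) := by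
  obtain ⟨C, K, hC, hK⟩ := Q_split d φ
  obtain ⟨l, hl, hT⟩ := Lam_slope d φ hg
  have hQ : Tendsto (fun τ => QQ μ N φ τ / sinh τ) (nhdsWithin 0 (Ioi 0)) (nhds (C * l)) := by
    have hz : Tendsto (fun τ => (QQ μ N φ τ - QQ μ N φ 0 - C * (Lam N φ τ - Lam N φ 0)) / sinh τ) (nhdsWithin 0 (Ioi 0)) (nhds 0) := by
      have hc : Tendsto (fun τ => K * sinh τ ^ (1/2 : ℝ)) (nhdsWithin 0 (Ioi 0)) (nhds 0) := by
        have : Continuous fun τ => K * sinh τ ^ (1/2 : ℝ) :=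
          continuous_const.mul (continuous_sinh.rpow_const fun x => Or.inr (by norm_num))
        have := (this.tendsto 0).mono_left (nhdsWithin_le_nhds (s := Ioi 0))
        simpa using this
      refine squeeze_zero_norm' ?_ hc
      filter_upwards [self_mem_nhdsWithin] with τ hτ
      have hτ : 0 < τ := hτ
      have hs := sinh_pos_iff.2 hτ
      rw [norm_div, norm_of_nonneg hs.le, div_le_iff₀ hs, Real.norm_eq_abs]
      refine (hK τ hτ.le).trans (le_of_eq ?_)
      rw [mul_assoc, show (3/2:ℝ) = 1/2 + 1 by norm_num, rpow_add hs, rpow_one]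
    have := hz.add (hT.const_mul C)
    rw [zero_add] at this
    refine this.congr fun τ => ?_
    rw [QQ_zero d φ hg]; ring
  have hc : Tendsto (fun τ => cosh τ ^ μ) (nhdsWithin 0 (Ioi 0)) (nhds 1) := by
    have : Continuous fun τ => cosh τ ^ μ := continuous_cosh.rpow_const fun x => Or.inl (cosh_pos x).ne'
    have := (this.tendsto 0).mono_left (nhdsWithin_le_nhds (s := Ioi 0))
    simpa using this
  refine ⟨C * l, mul_nonpos_of_nonneg_of_nonpos hC hl, ?_⟩
  have := hc.mul hQ
  rw [one_mul] at this
  refine this.congr fun τ => ?_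
  have h2 : uu μ N (pp φ τ) = rr (pp φ τ) ^ μ * QQ μ N φ τ := rfl
  rw [h2, rr_pp]; ring

lemma upper_contact (d : Dat μ a N) {p : Fin 3 → ℝ} {R φ : ℝ} (hR : 0 < R) (h0 : p 0 = R * cos φ) (h1 : p 1 = R * sin φ)
    (h2 : p 2 = 0) (hu : uu μ N p = 0) : ∃ e, e ≤ 0 ∧ HasUpperDeriv (uu μ N) 2 p e := by
  have hRm : 0 < R ^ μ := rpow_pos_of_pos hR μ
  have hg : gg a φ = 0 := by
    rw [uu_plane d hR.le h0 h1 h2] at hu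
    have := pi_pos
    rcases mul_eq_zero.1 hu with h | h
    · exact absurd h hRm.ne'
    · rcases mul_eq_zero.1 h with h | h
      · linarith
      · exact h
  obtain ⟨l, hl, hT⟩ := uu_slope d φ hg
  refine ⟨R ^ μ / R * l, mul_nonpos_of_nonneg_of_nonpos (by positivity) hl, ?_⟩
  unfold HasUpperDeriv
  have ha : Tendsto (fun t : ℝ => arsinh (t / R)) (nhdsWithin 0 (Ioi 0)) (nhdsWithin 0 (Ioi 0)) := by
    refine tendsto_nhdsWithin_iff.2 ⟨?_, ?_⟩
    · have : Continuous fun t : ℝ => arsinh (t / R) := continuous_arsinh.comp (by fun_prop)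
      have := (this.tendsto 0).mono_left (nhdsWithin_le_nhds (s := Ioi 0))
      simpa using this
    · filter_upwards [self_mem_nhdsWithin] with t ht
      exact arsinh_pos_iff.2 (div_pos ht hR)
  refine ((hT.comp ha).const_mul (R ^ μ / R)).congr' ?_
  filter_upwards [self_mem_nhdsWithin] with t ht
  have ht : 0 < t := ht
  have e : p + t • (Pi.single 2 1 : Fin 3 → ℝ) = R • pp φ (arsinh (t / R)) := by
    funext i
    fin_cases i
    · simp [pp, h0]
    · simp [pp, h1]
    · simp [pp, h2, sinh_arsinh]
      field_simp
  rw [e, uu_smul μ N hR, hu, sub_zero]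
  simp only [Function.comp]
  rw [sinh_arsinh]
  field_simp

lemma upper_zero (d : Dat μ a N) : HasUpperDeriv (uu μ N) 2 0 0 := by
  unfold HasUpperDeriv
  obtain ⟨C, hC⟩ := uu_abs d
  have hμ := d.hμl
  have hc : Tendsto (fun t : ℝ => C * t ^ (μ - 1)) (nhdsWithin 0 (Ioi 0)) (nhds 0) := by
    have : Continuous fun t : ℝ => C * t ^ (μ - 1) :=
      continuous_const.mul (continuous_id.rpow_const fun x => Or.inr (by linarith))
    have := (this.tendsto 0).mono_left (nhdsWithin_le_nhds (s := Ioi 0))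
    simpa [zero_rpow (by linarith : μ - 1 ≠ 0)] using this
  refine squeeze_zero_norm' ?_ hc
  filter_upwards [self_mem_nhdsWithin] with t ht
  have ht : 0 < t := ht
  rw [uu_zero d, sub_zero, zero_add, norm_div, norm_of_nonneg ht.le, div_le_iff₀ ht, Real.norm_eq_abs]
  refine (hC _).trans (le_of_eq ?_)
  have : rr (t • (Pi.single 2 1 : Fin 3 → ℝ)) = t := by
    unfold rr; simp [sqrt_sq ht.le]
  rw [this, mul_assoc, ← rpow_add_one ht.ne', sub_add_cancel]

lemma upper_off (d : Dat μ a N) {p : Fin 3 → ℝ} (h2 : p 2 = 0) (hp : p ∈ (contactSet (uu μ N) 2)ᶜ) :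
    HasUpperDeriv (uu μ N) 2 p 0 := by
  have hd := ((uu_off d hp).1.differentiableAt (by norm_num)).hasFDerivAt
  set v : Fin 3 → ℝ := Pi.single 2 1 with hv
  have hline : HasDerivAt (fun t : ℝ => p + t • v) v 0 := by
    simpa using ((hasDerivAt_id (0:ℝ)).smul_const v).const_add p
  have hd' : HasFDerivAt (uu μ N) (fderiv ℝ (uu μ N) p) (p + (0:ℝ) • v) := by simpa using hd
  have hD := hd'.comp_hasDerivAt (0:ℝ) hline
  set D := fderiv ℝ (uu μ N) p v
  have heven : ∀ t : ℝ, uu μ N (p + (-t) • v) = uu μ N (p + t • v) := by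
    intro t
    rw [← uu_symm μ N (p + t • v)]
    congr 1
    funext i
    fin_cases i <;> simp [hv, h2]
  have hN : HasDerivAt (fun t : ℝ => uu μ N (p + (-t) • v)) (-D) 0 := by
    have hD2 : HasDerivAt (uu μ N ∘ fun t : ℝ => p + t • v) D (-(0:ℝ)) := by rw [neg_zero]; exact hD
    have := hD2.comp (0:ℝ) (hasDerivAt_neg (0:ℝ))
    rw [mul_neg_one] at this
    exact this
  simp only [heven] at hN
  have hD3 : HasDerivAt (fun t : ℝ => uu μ N (p + t • v)) D 0 := hD
  have hD0 : D = 0 := by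
    have := hD3.unique hN
    linarith
  rw [hD0] at hD3
  unfold HasUpperDeriv
  have := lim_of_deriv (hD3.sub_const (uu μ N p)) (by simp)
  exact this

theorem uu_sol (d : Dat μ a N) : IsTOPSol μ (uu μ N) 2 where
  cont := uu_cont d
  symm := uu_symm μ N
  homog := fun r hr x => uu_smul μ N hr x
  smooth := fun x hx => (uu_off d hx).1.contDiffWithinAt
  harm := fun x hx => (uu_off d hx).2
  nonneg := fun x hx => uu_nonneg d hx
  upper := fun x hx => by
    by_cases hu : uu μ N x = 0
    · obtain ⟨R, φ, hR, h0, h1⟩ := polar (x 0) (x 1)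
      rcases hR.eq_or_lt with h | h
      · have : x = 0 := by
          funext i
          fin_cases i
          · simp [h0, ← h]
          · simp [h1, ← h]
          · simpa using hx
        rw [this]
        exact ⟨0, le_rfl, upper_zero d⟩
      · exact upper_contact d h h0 h1 hx hu
    · exact ⟨0, le_rfl, upper_off d hx fun hc => hu hc.2⟩

theorem final : ∃ μ : ℝ, 0 < μ ∧ (∀ k : ℕ, μ ≠ k) ∧ (∀ k : ℕ, μ ≠ 2 * k + 3 / 2) ∧
      ∃ u : (Fin 3 → ℝ) → ℝ, IsTOPSol μ u 2 ∧ u ≠ 0 := by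
  obtain ⟨μ, a, N, d⟩ := exists_Dat
  have h1 := d.hμl
  have h2 := d.hμ.2
  refine ⟨μ, by linarith, ?_, ?_, uu μ N, uu_sol d, uu_ne d⟩
  · rintro k rfl
    have h3 : (9:ℝ) < k := by linarith
    have h4 : (k:ℝ) < 10 := by linarith
    have h3 : 9 < k := by exact_mod_cast h3
    have h4 : k < 10 := by exact_mod_cast h4
    omega
  · rintro k rfl
    have h3 : (4:ℝ) < k := by linarith
    have h4 : (k:ℝ) < 5 := by linarith
    have h3 : 4 < k := by exact_mod_cast h3
    have h4 : k < 5 := by exact_mod_cast h4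
    omega

end
end TOP

/-- The set of frequencies in dimension 3 is strictly larger than the two-dimensional set
`ℕ ∪ {2k + 3/2 : k ∈ ℕ}`: there is a homogeneity `μ > 0` not of either form admitting a
nontrivial `μ`-homogeneous solution of the thin obstacle problem in `ℝ³`. -/
theorem new_frequency_in_3d :
    ∃ μ : ℝ, 0 < μ ∧ (∀ k : ℕ, μ ≠ k) ∧ (∀ k : ℕ, μ ≠ 2 * k + 3 / 2) ∧
      ∃ u : (Fin 3 → ℝ) → ℝ, IsTOPSol μ u 2 ∧ u ≠ 0 := by
  exact TOP.final
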